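/- For every δ ∈ (0,1) there exists α = α(δ) > 0 such that for every κ ∈ (0,1), the probability that simultaneously every path P in V_N with ‖x_P − y_P‖ ≥ κN and |P| ≤ N^{1+α} satisfies |{z ∈ P : η^{V_{5N}}(z) ≥ −15√δ · log N}| ≥ κN/8, tends to 1 as N → ∞. -/

import Mathlib

open MeasureTheory ProbabilityTheory Real Set Filter

/-- The lattice ℤ². -/
abbrev Z2 := ℤ × ℤ

/-- Nearest-neighbor adjacency on ℤ². -/
def Adj (x y : Z2) : Prop := |x.1 - y.1| + |x.2 - y.2| = 1

/-- The `L^∞` distance on ℤ². -/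
def linf (x y : Z2) : ℤ := max |x.1 - y.1| |x.2 - y.2|

/-- The Euclidean distance on ℤ². -/
noncomputable def eZ (x y : Z2) : ℝ :=
  Real.sqrt (((x.1 - y.1 : ℤ) : ℝ) ^ 2 + ((x.2 - y.2 : ℤ) : ℝ) ^ 2)

/-- Inner boundary `∂B` of a set `B ⊆ ℤ²`: points of `B` having a nearest neighbor
outside `B`. -/
def bdry (B : Set Z2) : Set Z2 := {z | z ∈ B ∧ ∃ w, Adj z w ∧ w ∉ B}

/-- Number of nearest-neighbor paths of length `t` from `x` to `y` avoiding `∂B`. -/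
noncomputable def nWalks (B : Set Z2) (t : ℕ) (x y : Z2) : ℕ :=
  Nat.card {f : Fin (t + 1) → Z2 //
    f 0 = x ∧ f (Fin.last t) = y ∧ (∀ i, f i ∉ bdry B) ∧
    ∀ i : Fin t, Adj (f i.castSucc) (f i.succ)}

/-- The Green function of simple random walk on ℤ² killed upon hitting `∂B`:
`G_B(x,y) = E_x [∑_{t=0}^{τ-1} 1_{S_t = y}]`, where `τ` is the hitting time of `∂B`. -/
noncomputable def greenFn (B : Set Z2) (x y : Z2) : ℝ :=
  ∑' t : ℕ, (1 / 4 : ℝ) ^ t * nWalks B t x y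

/-- A centered (jointly) Gaussian family: every finite linear combination is a
centered Gaussian random variable. -/
def IsCenteredGaussianFamily {Ω : Type*} [MeasureSpace Ω] {ι : Type*} (f : ι → Ω → ℝ) : Prop :=
  ∀ (s : Finset ι) (c : ι → ℝ), ∃ v : NNReal,
    Measure.map (fun ω => ∑ i ∈ s, c i * f i ω) (ℙ : Measure Ω) = gaussianReal 0 v

/-- `η` is a discrete Gaussian free field on `B` with Dirichlet boundary conditions:
a centered Gaussian field, vanishing outside `B`, whose covariance on `B` is the
Green function of simple random walk killed at `∂B`. -/
def IsDGFF {Ω : Type*} [MeasureSpace Ω] (B : Set Z2) (η : Z2 → Ω → ℝ) : Prop :=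
  IsCenteredGaussianFamily (fun z : Z2 => η z) ∧
  (∀ z, z ∉ B → η z = 0) ∧
  (∀ x ∈ B, ∀ y ∈ B, ∫ ω, η x ω * η y ω = greenFn B x y)

/-- `F` is the harmonic extension of `η` from outside `B`: it agrees with `η` on
`B^c ∪ ∂B` and is discrete harmonic on `B ∖ ∂B`. -/
def IsHarmExt {Ω : Type*} [MeasureSpace Ω] (η F : Z2 → Ω → ℝ) (B : Set Z2) : Prop :=
  (∀ z, z ∉ B \ bdry B → F z = η z) ∧
  (∀ z ∈ B \ bdry B, ∀ ω, 4 * F z ω =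
    F (z.1 + 1, z.2) ω + F (z.1 - 1, z.2) ω + F (z.1, z.2 + 1) ω + F (z.1, z.2 - 1) ω)

/-- The box of side length `ℓ` centered at `x`. -/
def boxZ (x : Z2) (ℓ : ℤ) : Set Z2 :=
  {z | x.1 - ℓ / 2 ≤ z.1 ∧ z.1 ≤ x.1 + ℓ / 2 ∧ x.2 - ℓ / 2 ≤ z.2 ∧ z.2 ≤ x.2 + ℓ / 2}

/-- `V_N = [0,N)² ∩ ℤ²`. -/
def VN (N : ℕ) : Set Z2 := {z | 0 ≤ z.1 ∧ z.1 < (N : ℤ) ∧ 0 ≤ z.2 ∧ z.2 < (N : ℤ)}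

/-- `V_{5N} = [-2N, 3N)² ∩ ℤ²`. -/
def V5N (N : ℕ) : Set Z2 :=
  {z | -(2 * (N : ℤ)) ≤ z.1 ∧ z.1 < 3 * (N : ℤ) ∧ -(2 * (N : ℤ)) ≤ z.2 ∧ z.2 < 3 * (N : ℤ)}

/-- The field `η_j`: `η_0 = η^{V_{5N}} - H_K` and `η_j = H_{K^j} - H_{K^{j+1}}` for
`j ≥ 1`, where `H ℓ x` denotes the value at `x` of the harmonic extension of the
field `η` from outside the box of side `ℓ` centered at `x`. -/
def etaJ {Ω : Type*} (η : Z2 → Ω → ℝ) (H : ℤ → Z2 → Ω → ℝ) (K : ℕ) (j : ℕ) (x : Z2) :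
    Ω → ℝ :=
  if j = 0 then fun ω => η x ω - H (K : ℤ) x ω
  else fun ω => H ((K : ℤ) ^ j) x ω - H ((K : ℤ) ^ (j + 1)) x ω

/-- A path in `V` given as a nonempty list of vertices of `V` in which consecutive
vertices are nearest neighbors. -/
def LPathIn (V : Set Z2) (P : List Z2) : Prop :=
  P ≠ [] ∧ P.Chain' Adj ∧ ∀ z ∈ P, z ∈ V


open MeasureTheory ProbabilityTheory Real Set Filter

namespace HV

/-- `(a, b)` is a node of scale `r`: `b` is the first exit time after `a` from the ball of radius
`r` around `g a`. -/
def Node (g : ℕ → ℂ) (r : ℝ) (a b : ℕ) : Prop :=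
  a < b ∧ r ≤ ‖g b - g a‖ ∧ ∀ s, a ≤ s → s < b → ‖g s - g a‖ < r

lemma Node.lt_add {g : ℕ → ℂ} {r : ℝ} {a b T : ℕ} (h : Node g r a b) (hb : b ≤ T)
    (hg : ∀ i < T, ‖g (i + 1) - g i‖ ≤ 1) {s : ℕ} (hs : a ≤ s) (hsb : s ≤ b) :
    ‖g s - g a‖ < r + 1 := by
  obtain ⟨h1, h2, h3⟩ := h
  rcases hsb.lt_or_eq with h4 | h4
  · linarith [h3 s hs h4]
  · subst h4
    have h5 := h3 (s - 1) (by omega) (by omega)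
    have h6 := hg (s - 1) (by omega)
    rw [show s - 1 + 1 = s by omega] at h6
    calc ‖g s - g a‖ = ‖(g s - g (s - 1)) + (g (s - 1) - g a)‖ := by congr 1; ring
      _ ≤ ‖g s - g (s - 1)‖ + ‖g (s - 1) - g a‖ := norm_add_le _ _
      _ < r + 1 := by linarith

lemma greedy (g : ℕ → ℂ) {r : ℝ} (hr : 0 < r) (b : ℕ)
    (hg : ∀ i < b, ‖g (i + 1) - g i‖ ≤ 1) : ∀ k a, a ≤ b →
    (∃ τ : ℕ → ℕ, τ 0 = a ∧ (∀ i < k, Node g r (τ i) (τ (i + 1))) ∧ τ k ≤ b) ∨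
    (∃ m : ℕ → ℕ, m a = 0 ∧ (∀ s t, a ≤ s → s ≤ t → t ≤ b → m s ≤ m t) ∧ m b < k ∧
      (∀ t, a ≤ t → t ≤ b → ‖g t - g a‖ < m t * (r + 1) + r) ∧
      (∀ s t, a ≤ s → s ≤ t → t ≤ b → ‖g t - g s‖ ≤ ((m t : ℝ) - m s + 2) * (r + 1))) := by
  intro k
  induction k with
  | zero => intro a ha; left; exact ⟨fun _ => a, rfl, by simp, ha⟩
  | succ k ih =>
    intro a ha
    by_cases hex : ∃ t, a < t ∧ t ≤ b ∧ r ≤ ‖g t - g a‖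
    · classical
      let c := Nat.find hex
      obtain ⟨hc1, hc2, hc3⟩ := Nat.find_spec hex
      have hmin : ∀ s, a ≤ s → s < c → ‖g s - g a‖ < r := by
        intro s h1 h2
        rcases h1.eq_or_lt with h | h
        · subst h; simpa using hr
        · have := Nat.find_min hex h2
          push Not at this
          exact this h (by omega)
      have hnode : Node g r a c := ⟨hc1, hc3, hmin⟩
      have hcb : c ≤ b := hc2
      rcases ih c hc2 with ⟨τ, h0, h1, h2⟩ | ⟨m, h0, h1, h2, h3, h4⟩
      · left
        refine ⟨fun i => if i = 0 then a else τ (i - 1), by simp, ?_, by simpa using h2⟩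
        intro i hi
        rcases Nat.eq_zero_or_pos i with rfl | hi0
        · simpa [h0] using hnode
        · have := h1 (i - 1) (by omega)
          rw [show i - 1 + 1 = i by omega] at this
          simp [show i ≠ 0 by omega, this]
      · right
        have hac : a < c := hc1
        have hca : ‖g c - g a‖ < r + 1 := hnode.lt_add hcb hg hac.le le_rfl
        refine ⟨fun s => if s < c then 0 else m s + 1, by simp [hac], ?_, ?_, ?_, ?_⟩
        · intro s t hs hst ht
          by_cases hsc : s < c
          · simp [hsc]
          · simp [hsc, show ¬ t < c by omega, h1 s t (by omega) hst ht]
        · simp [show ¬ b < c by omega, h2]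
        · intro t hat htb
          by_cases htc : t < c
          · simpa [htc] using hmin t hat htc
          · have h5 := h3 t (by omega) htb
            have : ‖g t - g a‖ ≤ ‖g t - g c‖ + ‖g c - g a‖ := by
              simpa using norm_add_le (g t - g c) (g c - g a)
            simp only [htc, if_false]; push_cast; nlinarith
        · intro s t hs hst htb
          by_cases htc : t < c
          · have e1 := hmin t (by omega) htc
            have e2 := hmin s hs (by omega)
            have : ‖g t - g s‖ ≤ ‖g t - g a‖ + ‖g s - g a‖ := by
              simpa using norm_sub_le (g t - g a) (g s - g a)
            simp only [htc, show s < c by omega, if_true]; push_cast; nlinarith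
          · by_cases hsc : s < c
            · have e2 := hmin s hs (by omega)
              have h5 := h3 t (by omega) htb
              have e3 : ‖g t - g s‖ ≤ ‖g t - g c‖ + ‖g c - g s‖ := by
                simpa using norm_add_le (g t - g c) (g c - g s)
              have e4 : ‖g c - g s‖ ≤ ‖g c - g a‖ + ‖g s - g a‖ := by
                simpa using norm_sub_le (g c - g a) (g s - g a)
              simp only [htc, hsc, if_false, if_true]; push_cast; nlinarith
            · have := h4 s t (by omega) hst htb
              simp only [htc, hsc, if_false]; push_cast
              linarith
    · right
      push Not at hex
      have hmin : ∀ s, a ≤ s → s ≤ b → ‖g s - g a‖ < r := by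
        intro s h1 h2
        rcases h1.eq_or_lt with h | h
        · subst h; simpa using hr
        · exact hex s h h2
      refine ⟨fun _ => 0, rfl, by simp, by simp, ?_, ?_⟩
      · intro t h1 h2; simpa using hmin t h1 h2
      · intro s t h1 h2 h3
        have e1 := hmin t (by omega) h3
        have e2 := hmin s h1 (by omega)
        have : ‖g t - g s‖ ≤ ‖g t - g a‖ + ‖g s - g a‖ := by
          simpa using norm_sub_le (g t - g a) (g s - g a)
        push_cast; nlinarith

/-- existence of `k` consecutive nodes, when the displacement is large. -/
lemma exists_nodes (g : ℕ → ℂ) {r : ℝ} (hr : 0 < r) (a b k : ℕ) (hab : a ≤ b)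
    (hg : ∀ i < b, ‖g (i + 1) - g i‖ ≤ 1) (hk : k * (r + 1) ≤ ‖g b - g a‖) :
    ∃ τ : ℕ → ℕ, τ 0 = a ∧ (∀ i < k, Node g r (τ i) (τ (i + 1))) ∧ τ k ≤ b := by
  rcases greedy g hr b hg k a hab with h | ⟨m, _, _, h2, h3, _⟩
  · exact h
  · exfalso
    have := h3 b hab le_rfl
    have h4 : (m b : ℝ) + 1 ≤ k := by exact_mod_cast h2
    nlinarith

/-- geometry: near-equality in the triangle inequality. -/
lemma tube (v d : ℂ) {D e : ℝ} (hD : ‖d‖ = D) (hDp : 0 < D) (he : 0 ≤ e)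
    (hsum : ‖v‖ + ‖d - v‖ ≤ D + e) (heD : e ≤ D) :
    ‖v - ((‖v‖ / D : ℝ) : ℂ) * d‖ ^ 2 ≤ 3 * ‖v‖ * e := by
  have h1 : ‖v‖ ^ 2 = v.re ^ 2 + v.im ^ 2 := by
    rw [← Complex.normSq_eq_norm_sq, Complex.normSq_apply]; ring
  have h2 : D ^ 2 = d.re ^ 2 + d.im ^ 2 := by
    rw [← hD, ← Complex.normSq_eq_norm_sq, Complex.normSq_apply]; ring
  have h3 : ‖d - v‖ ^ 2 = (d.re - v.re) ^ 2 + (d.im - v.im) ^ 2 := by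
    rw [← Complex.normSq_eq_norm_sq, Complex.normSq_apply]; simp; ring
  have h4 : ‖v - ((‖v‖ / D : ℝ) : ℂ) * d‖ ^ 2
      = (v.re - ‖v‖ / D * d.re) ^ 2 + (v.im - ‖v‖ / D * d.im) ^ 2 := by
    rw [← Complex.normSq_eq_norm_sq, Complex.normSq_apply]
    simp only [Complex.sub_re, Complex.sub_im, Complex.re_ofReal_mul, Complex.im_ofReal_mul]; ring
  rw [h4]
  set s := ‖v‖ with hs
  have hs0 : 0 ≤ s := norm_nonneg v
  set s2 := ‖d - v‖
  have hs20 : 0 ≤ s2 := norm_nonneg _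
  set P := v.re * d.re + v.im * d.im with hP
  have h5 : 2 * P = s ^ 2 + D ^ 2 - s2 ^ 2 := by rw [h1, h2, h3, hP]; ring
  have h6 : (v.re - s / D * d.re) ^ 2 + (v.im - s / D * d.im) ^ 2
      = 2 * s * (s - P / D) := by
    have : (v.re - s / D * d.re) ^ 2 + (v.im - s / D * d.im) ^ 2
      = (v.re ^ 2 + v.im ^ 2) - 2 * (s / D) * P + (s / D) ^ 2 * (d.re ^ 2 + d.im ^ 2) := by
      rw [hP]; ring
    rw [this, ← h1, ← h2]; field_simp; ring
  rw [h6]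
  have h7 : s2 ^ 2 ≤ (D + e - s) ^ 2 := by
    apply pow_le_pow_left₀ hs20; linarith
  have h8 : s - P / D ≤ 3 / 2 * e := by
    rw [sub_le_iff_le_add, ← sub_le_iff_le_add', le_div_iff₀ hDp]
    nlinarith [mul_nonneg he hs0, mul_le_mul_of_nonneg_left heD he]
  nlinarith

end HV

open MeasureTheory ProbabilityTheory Real Set Filter

namespace HV

lemma tau_mono {g : ℕ → ℂ} {r : ℝ} {τ : ℕ → ℕ} {k : ℕ}
    (h : ∀ i < k, Node g r (τ i) (τ (i + 1))) : ∀ i j, i ≤ j → j ≤ k → τ i ≤ τ j := by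
  intro i j hij
  induction j, hij using Nat.le_induction with
  | base => intro _; exact le_rfl
  | succ j hj ih =>
    intro hk
    exact (ih (by omega)).trans (h j (by omega)).1.le

lemma straight (g : ℕ → ℂ) {r : ℝ} (hr : 1 ≤ r) (K : ℕ) (hK : 4 ≤ K) (a b : ℕ)
    (hg : ∀ i < b, ‖g (i + 1) - g i‖ ≤ 1)
    (hnode : Node g (K * (K * (r + 1) + 1)) a b)
    (m : ℕ → ℕ) (hm0 : m a = 0) (hmb : m b < K ^ 2 + 1)
    (hmono : ∀ s t, a ≤ s → s ≤ t → t ≤ b → m s ≤ m t)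
    (hm : ∀ s t, a ≤ s → s ≤ t → t ≤ b → ‖g t - g s‖ ≤ ((m t : ℝ) - m s + 2) * (r + 1))
    (τ : ℕ → ℕ) (h0 : τ 0 = a) (hτ : ∀ i < K, Node g (K * (r + 1)) (τ i) (τ (i + 1)))
    (hτb : τ K ≤ b) (i : ℕ) (hi : i < K) :
    ‖g (τ i) - (g a + ((i / K : ℝ) : ℂ) * (g b - g a))‖ ≤ 10 * (K * (r + 1)) := by
  have hmonoτ := tau_mono hτ
  have hKr : (4 : ℝ) ≤ K := by exact_mod_cast hK
  have haτ : ∀ i ≤ K, a ≤ τ i := fun i hi => h0 ▸ hmonoτ 0 i (by omega) hi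
  have hτb' : ∀ i ≤ K, τ i ≤ b := fun i hi => (hmonoτ i K hi le_rfl).trans hτb
  set ρ := r + 1 with hρ
  have hρ2 : 2 ≤ ρ := by linarith
  have hab : a ≤ b := hnode.1.le
  have hmbr : (m b : ℝ) ≤ K ^ 2 := by exact_mod_cast Nat.lt_succ_iff.mp hmb
  -- lower bound of m
  have hml : ∀ i ≤ K, (i : ℝ) * (K - 2) ≤ m (τ i) := by
    intro i
    induction i with
    | zero => intro _; simp
    | succ i ih =>
      intro hi
      have e1 := (hτ i (by omega)).2.1
      have e2 := hm (τ i) (τ (i + 1)) (haτ i (by omega)) (hτ i (by omega)).1.le (hτb' _ hi)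
      have e3 := ih (by omega)
      have e4 : (K : ℝ) ≤ (m (τ (i + 1)) : ℝ) - m (τ i) + 2 := by
        have : (K : ℝ) * ρ ≤ ((m (τ (i + 1)) : ℝ) - m (τ i) + 2) * ρ := e1.trans e2
        exact le_of_mul_le_mul_right this (by linarith)
      push_cast; linarith
  -- upper bound of distance
  have hup : ∀ i ≤ K, ‖g (τ i) - g a‖ ≤ i * (K * ρ + 1) := by
    intro i
    induction i with
    | zero => intro _; simp [h0]
    | succ i ih =>
      intro hi
      have e1 := (hτ i (by omega)).lt_add (hτb' _ hi) hg (hτ i (by omega)).1.le le_rfl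
      have e3 := ih (by omega)
      have : ‖g (τ (i + 1)) - g a‖ ≤ ‖g (τ (i + 1)) - g (τ i)‖ + ‖g (τ i) - g a‖ := by
        simpa using norm_add_le (g (τ (i + 1)) - g (τ i)) (g (τ i) - g a)
      push_cast; linarith
  set D := ‖g b - g a‖ with hD
  have hD1 : K * (K * ρ + 1) ≤ D := hnode.2.1
  have hD2 : D < K * (K * ρ + 1) + 1 := hnode.lt_add le_rfl hg hab le_rfl
  have hDp : 0 < D := by nlinarith
  set x := g (τ i) with hx
  set v := x - g a with hv
  set d := g b - g a with hd
  have ht1 : a ≤ τ i := haτ i hi.le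
  have ht2 : τ i ≤ b := hτb' i hi.le
  have hs1 : ‖v‖ ≤ ((m (τ i) : ℝ) + 2) * ρ := by
    have := hm a (τ i) le_rfl ht1 ht2
    rw [hm0] at this; simpa using this
  have hs2 : ‖d - v‖ ≤ ((m b : ℝ) - m (τ i) + 2) * ρ := by
    have := hm (τ i) b ht1 ht2 le_rfl
    rw [show d - v = g b - g (τ i) by rw [hd, hv, hx]; ring]; exact this
  have hmib : (m (τ i) : ℝ) ≤ m b := by exact_mod_cast hmono _ _ ht1 ht2 le_rfl
  have hmi := hml i hi.le
  have hiK : (i : ℝ) ≤ K := by exact_mod_cast hi.le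
  have hi0 : (0 : ℝ) ≤ i := by positivity
  have hsum : ‖v‖ + ‖d - v‖ ≤ D + 4 * ρ := by
    have : ((m b : ℝ)) * ρ ≤ K ^ 2 * ρ := mul_le_mul_of_nonneg_right hmbr (by linarith)
    nlinarith
  have hKK : (16 : ℝ) ≤ K * K := by nlinarith
  have h4D : 4 * ρ ≤ D := by
    have := mul_le_mul_of_nonneg_right hKK (by linarith : 0 ≤ ρ)
    have e : (K : ℝ) * (K * ρ + 1) = K * K * ρ + K := by ring
    linarith
  have htube := tube v d hD.symm hDp (by linarith : 0 ≤ 4 * ρ) hsum h4D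
  have hv2 : ‖v‖ ≤ 2 * K ^ 2 * ρ := by
    refine hs1.trans (mul_le_mul_of_nonneg_right ?_ (by linarith)); nlinarith
  have h5 : ‖v - ((‖v‖ / D : ℝ) : ℂ) * d‖ ≤ 5 * (K * ρ) := by
    apply le_of_sq_le_sq _ (by positivity)
    nlinarith [mul_le_mul_of_nonneg_right hv2 (by linarith : 0 ≤ ρ)]
  have h6 : ‖((‖v‖ / D - i / K : ℝ) : ℂ) * d‖ ≤ 5 * (K * ρ) := by
    rw [norm_mul, Complex.norm_real, ← hD, Real.norm_eq_abs, ← abs_of_pos hDp, ← abs_mul,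
      abs_of_pos hDp]
    have : (‖v‖ / D - i / K) * D = ‖v‖ - i * (D / K) := by field_simp
    rw [this]
    have k1 : K * ρ + 1 ≤ D / K := by rw [le_div_iff₀ (by linarith)]; linarith
    have k2 : D / K ≤ K * ρ + 2 := by rw [div_le_iff₀ (by linarith)]; nlinarith
    have k3 := hup i hi.le
    have k4 : (i : ℝ) * (K * ρ + 1) ≤ i * (D / K) := mul_le_mul_of_nonneg_left k1 hi0
    have k5 : (i : ℝ) * (D / K) ≤ i * (K * ρ + 2) := mul_le_mul_of_nonneg_left k2 hi0
    have k6 : D ≤ ‖v‖ + ‖d - v‖ := by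
      have := norm_add_le v (d - v); simpa [← hD] using this
    have hKρ : 0 ≤ K * ρ := by positivity
    rw [abs_le]
    constructor
    · have k7 : ((m b : ℝ) - m (τ i) + 2) * ρ ≤ (K ^ 2 - i * (K - 2) + 2) * ρ :=
        mul_le_mul_of_nonneg_right (by linarith) (by linarith)
      have k8 : (i : ℝ) * ρ ≤ K * ρ := mul_le_mul_of_nonneg_right hiK (by linarith)
      have k9 : 4 * ρ ≤ K * ρ := mul_le_mul_of_nonneg_right hKr (by linarith)
      have k10 : K * 2 ≤ K * ρ := mul_le_mul_of_nonneg_left hρ2 (by linarith)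
      have k11 : (K ^ 2 - i * (K - 2) + 2) * ρ
        = K * (K * ρ + 1) - K - i * (K * ρ + 2) + 2 * i + 2 * (i * ρ) + 2 * ρ := by ring
      linarith
    · have k8 : K * 2 ≤ K * ρ := mul_le_mul_of_nonneg_left hρ2 (by linarith)
      linarith
  have : x - (g a + ((i / K : ℝ) : ℂ) * d)
      = (v - ((‖v‖ / D : ℝ) : ℂ) * d) + ((‖v‖ / D - i / K : ℝ) : ℂ) * d := by
    rw [hv]; push_cast; ring
  rw [this]
  refine (norm_add_le _ _).trans ?_
  linarith

lemma sum_log_le {ι : Type*} (s : Finset ι) (x : ι → ℝ) (X : ℝ) (hX : 0 < X)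
    (hx : ∀ i ∈ s, 0 < x i) (hsum : ∑ i ∈ s, x i ≤ s.card * X) :
    ∑ i ∈ s, Real.log (x i) ≤ s.card * Real.log X := by
  have h : ∀ i ∈ s, Real.log (x i) ≤ Real.log X + (x i / X - 1) := by
    intro i hi
    have := Real.log_le_sub_one_of_pos (div_pos (hx i hi) hX)
    rw [Real.log_div (hx i hi).ne' hX.ne'] at this
    linarith
  calc ∑ i ∈ s, Real.log (x i) ≤ ∑ i ∈ s, (Real.log X + (x i / X - 1)) := Finset.sum_le_sum h
    _ = s.card * Real.log X + ((∑ i ∈ s, x i) / X - s.card) := by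
      rw [Finset.sum_add_distrib, Finset.sum_sub_distrib, Finset.sum_div]; simp
    _ ≤ s.card * Real.log X := by
      have : (∑ i ∈ s, x i) / X ≤ s.card := by rw [div_le_iff₀ hX]; exact hsum
      linarith

end HV

open MeasureTheory ProbabilityTheory Real Set Filter

namespace HV

/-- embedding of the lattice into the complex plane -/
noncomputable def toC (x : Z2) : ℂ := ⟨(x.1 : ℝ), (x.2 : ℝ)⟩

lemma eZ_eq (x y : Z2) : eZ x y = ‖toC x - toC y‖ := by
  have h : (‖toC x - toC y‖) ^ 2 = ((x.1 - y.1 : ℤ) : ℝ) ^ 2 + ((x.2 - y.2 : ℤ) : ℝ) ^ 2 := by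
    rw [← Complex.normSq_eq_norm_sq, Complex.normSq_apply]; simp [toC]; ring
  rw [eZ, ← h, Real.sqrt_sq (norm_nonneg _)]

lemma linf_le_norm (x y : Z2) : (linf x y : ℝ) ≤ ‖toC x - toC y‖ := by
  have h1 := Complex.abs_re_le_norm (toC x - toC y)
  have h2 := Complex.abs_im_le_norm (toC x - toC y)
  unfold linf
  push_cast
  exact max_le (by simpa [toC] using h1) (by simpa [toC] using h2)

/-- scales -/
noncomputable def RR (K : ℕ) : ℕ → ℝ
  | 0 => 1
  | j + 1 => K * (RR K j + 1)

lemma RR_ge (K : ℕ) (hK : 4 ≤ K) (j : ℕ) : (K : ℝ) ^ j ≤ RR K j := by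
  induction j with
  | zero => simp [RR]
  | succ j ih =>
    have : (4 : ℝ) ≤ K := by exact_mod_cast hK
    rw [RR, pow_succ]; nlinarith

lemma RR_le (K : ℕ) (hK : 4 ≤ K) (j : ℕ) : RR K j ≤ 3 * (K : ℝ) ^ j - 2 := by
  induction j with
  | zero => norm_num [RR]
  | succ j ih =>
    have : (4 : ℝ) ≤ K := by exact_mod_cast hK
    rw [RR, pow_succ]; nlinarith

lemma RR_succ_ge (K : ℕ) (hK : 4 ≤ K) (j : ℕ) : 2 * (K : ℝ) ^ (j + 1) ≤ RR K (j + 1) := by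
  induction j with
  | zero => norm_num [RR]; linarith
  | succ j ih =>
    have : (4 : ℝ) ≤ K := by exact_mod_cast hK
    rw [RR, pow_succ]; nlinarith

lemma RR_one_le (K : ℕ) (hK : 4 ≤ K) (j : ℕ) : 1 ≤ RR K j := by
  refine le_trans ?_ (RR_ge K hK j)
  exact one_le_pow₀ (by exact_mod_cast (by omega : 1 ≤ K))

/-- rounding -/
def rd (K : ℕ) (j : ℕ) (x : Z2) : Z2 :=
  ((K : ℤ) ^ (j - 1) * (x.1 / (K : ℤ) ^ (j - 1)), (K : ℤ) ^ (j - 1) * (x.2 / (K : ℤ) ^ (j - 1)))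

lemma rd_zero (K : ℕ) (x : Z2) : rd K 0 x = x := by simp [rd]

/-- intermediate points -/
def qpos (K : ℕ) (s : Z2 × Z2) (i : ℕ) : Z2 :=
  (s.1.1 + (i * (s.2.1 - s.1.1)) / (K : ℤ), s.1.2 + (i * (s.2.2 - s.1.2)) / (K : ℤ))

lemma combine (B : ℕ → ℝ) (τ : ℕ → ℕ) (k a b n0 : ℕ) (S : Finset ℕ) (hS : S ⊆ Finset.range k)
    (hn0 : 0 < n0) (hτ : ∀ i < k, τ i < τ (i + 1)) (h0 : τ 0 = a) (hk : τ k ≤ b)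
    (α u : ℕ → ℝ) (α' u' cp X : ℝ) (hcp : 0 ≤ cp) (hX : 0 < X)
    (hZ : ∀ i ∈ S, ∃ Z ⊆ Finset.Ico (τ i) (τ (i + 1)), Z.card = n0 ∧
      ∑ z ∈ Z, |B z - α i| ≤ n0 * (u i + cp * Real.log (((τ (i + 1) : ℝ) - τ i) / n0)))
    (hu : ∑ i ∈ S, (|α i - α'| + u i) ≤ S.card * u')
    (hl : ∑ i ∈ S, ((τ (i + 1) : ℝ) - τ i) ≤ S.card * X) :
    ∃ Z ⊆ Finset.Ico a b, Z.card = S.card * n0 ∧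
      ∑ z ∈ Z, |B z - α'| ≤ (S.card * n0 : ℕ) * (u' + cp * Real.log (X / n0)) := by
  classical
  have hmono : ∀ i j, i ≤ j → j ≤ k → τ i ≤ τ j := by
    intro i j hij
    induction j, hij using Nat.le_induction with
    | base => intro _; exact le_rfl
    | succ j hj ih => intro hk; exact (ih (by omega)).trans (hτ j (by omega)).le
  choose! Z hZ1 hZ2 hZ3 using hZ
  have hdisj : ∀ i ∈ S, ∀ j ∈ S, i ≠ j → Disjoint (Z i) (Z j) := by
    have key : ∀ i ∈ S, ∀ j ∈ S, i < j → Disjoint (Z i) (Z j) := by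
      intro i hi j hj hij
      rw [Finset.disjoint_left]
      intro z h1 h2
      have h1 := Finset.mem_Ico.mp (hZ1 i hi h1)
      have h2 := Finset.mem_Ico.mp (hZ1 j hj h2)
      have := hmono (i + 1) j hij (Finset.mem_range.mp (hS hj)).le
      omega
    intro i hi j hj hij
    rcases lt_or_gt_of_ne hij with h | h
    · exact key i hi j hj h
    · exact (key j hj i hi h).symm
  have hn0r : (0 : ℝ) < n0 := by exact_mod_cast hn0
  refine ⟨S.biUnion Z, ?_, ?_, ?_⟩
  · intro z hz
    obtain ⟨i, hi, hz⟩ := Finset.mem_biUnion.mp hz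
    have h1 := Finset.mem_Ico.mp (hZ1 i hi hz)
    have hik := Finset.mem_range.mp (hS hi)
    have h2 := hmono 0 i (by omega) hik.le
    have h3 := hmono (i + 1) k hik le_rfl
    rw [Finset.mem_Ico]; omega
  · rw [Finset.card_biUnion hdisj, Finset.sum_congr rfl hZ2]; simp
  · rw [Finset.sum_biUnion hdisj]
    have hlog : ∑ i ∈ S, Real.log (((τ (i + 1) : ℝ) - τ i) / n0) ≤ S.card * Real.log (X / n0) := by
      apply sum_log_le _ _ _ (by positivity)
      · intro i hi
        have : (τ i : ℝ) < τ (i + 1) := by exact_mod_cast hτ i (Finset.mem_range.mp (hS hi))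
        exact div_pos (by linarith) hn0r
      · rw [← Finset.sum_div, ← mul_div_assoc]
        exact div_le_div_of_nonneg_right hl hn0r.le
    calc ∑ i ∈ S, ∑ z ∈ Z i, |B z - α'|
        ≤ ∑ i ∈ S, (n0 * (|α i - α'| + u i) + n0 * cp *
            Real.log (((τ (i + 1) : ℝ) - τ i) / n0)) := by
          apply Finset.sum_le_sum
          intro i hi
          have h1 : ∑ z ∈ Z i, |B z - α'| ≤ ∑ z ∈ Z i, (|B z - α i| + |α i - α'|) :=
            Finset.sum_le_sum fun z _ => abs_sub_le _ _ _
          rw [Finset.sum_add_distrib, Finset.sum_const, hZ2 i hi, nsmul_eq_mul] at h1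
          have := hZ3 i hi
          linarith
      _ = n0 * ∑ i ∈ S, (|α i - α'| + u i) + n0 * cp *
            ∑ i ∈ S, Real.log (((τ (i + 1) : ℝ) - τ i) / n0) := by
          rw [Finset.sum_add_distrib, Finset.mul_sum, Finset.mul_sum]
      _ ≤ n0 * (S.card * u') + n0 * cp * (S.card * Real.log (X / n0)) := by
          gcongr
      _ = _ := by push_cast; ring

lemma log_gain (K : ℕ) (hK : 4 ≤ K) (pen : ℝ) (hpen : 0 ≤ pen) :
    2 * pen ≤ 4 * K ^ 2 * pen * Real.log (((K : ℝ) ^ 2 + 1) / K ^ 2) := by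
  have hKr : (4 : ℝ) ≤ K := by exact_mod_cast hK
  have hK2 : (1 : ℝ) ≤ (K : ℝ) ^ 2 := by nlinarith
  have h1 := Real.one_sub_inv_le_log_of_pos (x := ((K : ℝ) ^ 2 + 1) / K ^ 2) (by positivity)
  have h2 : 1 / (2 * (K : ℝ) ^ 2) ≤ 1 - (((K : ℝ) ^ 2 + 1) / K ^ 2)⁻¹ := by
    rw [inv_div, one_sub_div (by positivity), add_sub_cancel_left]
    apply one_div_le_one_div_of_le <;> linarith
  have h3 : 2 * pen = 4 * K ^ 2 * pen * (1 / (2 * (K : ℝ) ^ 2)) := by field_simp; ring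
  rw [h3]
  gcongr
  linarith

section claim

variable (K L q N : ℕ) (A : ℕ → Z2 → ℝ) (U : ℕ → Z2 × Z2 → ℝ) (pen : ℝ)

/-- closeness hypothesis at level `j` -/
def HBad : Prop := ∀ j, ∀ x ∈ VN N, ∀ y ∈ VN N, ∀ x' ∈ VN N, ∀ y' ∈ VN N,
  linf x x' ≤ 4 * (K : ℤ) ^ (j + 1) → linf x y' ≤ 4 * (K : ℤ) ^ (j + 1) →
  |A j (rd K j x') - A (j + 1) (rd K (j + 1) x)| - pen + U j (rd K j x', rd K j y')
    ≤ U (j + 1) (rd K (j + 1) x, rd K (j + 1) y)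

/-- good step hypothesis -/
def HGood : Prop := ∀ j, ∀ x ∈ VN N, ∀ y ∈ VN N, ∀ x' ∈ VN N, ∀ y' ∈ VN N,
  2 * (K : ℝ) ^ (j + 1) ≤ ‖toC y - toC x‖ → ‖toC y - toC x‖ ≤ 4 * (K : ℝ) ^ (j + 1) →
  linf x x' ≤ 4 * (K : ℤ) ^ (j + 1) → linf x y' ≤ 4 * (K : ℤ) ^ (j + 1) →
  ∀ c < q, ∀ i < K,
  ‖toC x' - (toC x + ((i / K : ℝ) : ℂ) * (toC y - toC x))‖ ≤ 30 * (K : ℝ) ^ j →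
  (∑ b ∈ Finset.range L,
      |A j (qpos K (rd K (j + 1) x, rd K (j + 1) y) (c + b * q)) - A (j + 1) (rd K (j + 1) x)|) / L
    + |A j (rd K j x') - A j (qpos K (rd K (j + 1) x, rd K (j + 1) y) i)|
    + U j (rd K j x', rd K j y')
    ≤ U (j + 1) (rd K (j + 1) x, rd K (j + 1) y)

lemma sum_classes (hKL : K = L * q) (F : ℕ → ℝ) :
    ∑ i ∈ Finset.range K, F i = ∑ c ∈ Finset.range q, ∑ b ∈ Finset.range L, F (c + b * q) := by
  rw [Finset.sum_comm, hKL]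
  clear hKL
  induction L with
  | zero => simp
  | succ L ih =>
    rw [Finset.sum_range_succ, ← ih, add_mul, one_mul, Finset.sum_range_add]
    congr 1
    exact Finset.sum_congr rfl fun c _ => by rw [add_comm]

/-- the deterministic claim -/
theorem claim (hK : 4 ≤ K) (hKL : K = L * q) (hpen : 0 ≤ pen)
    (hU0 : ∀ s, 0 ≤ U 0 s) (hbad : HBad K N A U pen) (hgood : HGood K L q N A U)
    (f : ℕ → Z2) (T : ℕ) (hf : ∀ i ≤ T, f i ∈ VN N)
    (hg : ∀ i < T, ‖toC (f (i + 1)) - toC (f i)‖ ≤ 1) :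
    ∀ j a b, b ≤ T → Node (fun i => toC (f i)) (RR K j) a b →
      ∃ Z ⊆ Finset.Ico a b, Z.card = K ^ j ∧
        ∑ z ∈ Z, |A 0 (f z) - A j (rd K j (f a))| ≤ (K ^ j : ℕ) *
          ((U j (rd K j (f a), rd K j (f b)) + if j = 0 then 0 else pen) +
            4 * K ^ 2 * pen * Real.log (((b : ℝ) - a) / (K ^ j : ℕ))) := by
  have hKr : (4 : ℝ) ≤ K := by exact_mod_cast hK
  have hcp : 0 ≤ 4 * (K : ℝ) ^ 2 * pen := by positivity
  have hKj : ∀ j, 0 < K ^ j := fun j => pow_pos (by omega) j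
  have near : ∀ j a b, b ≤ T → Node (fun i => toC (f i)) (RR K (j + 1)) a b → ∀ s, a ≤ s → s ≤ b →
      linf (f a) (f s) ≤ 4 * (K : ℤ) ^ (j + 1) := by
    intro j a b hb hn s h1 h2
    have h3 := hn.lt_add hb hg h1 h2
    have h4 := linf_le_norm (f a) (f s)
    rw [norm_sub_rev] at h4
    have h5 := RR_le K hK (j + 1)
    have h6 : (0 : ℝ) ≤ (K : ℝ) ^ (j + 1) := by positivity
    have : (linf (f a) (f s) : ℝ) ≤ 4 * (K : ℝ) ^ (j + 1) := by linarith
    exact_mod_cast this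
  have near2 : ∀ j a b, b ≤ T → Node (fun i => toC (f i)) (RR K j) a b → ∀ s, a ≤ s → s ≤ b →
      linf (f a) (f s) ≤ 4 * (K : ℤ) ^ (j + 1) := by
    intro j a b hb hn s h1 h2
    have h3 := hn.lt_add hb hg h1 h2
    have h4 := linf_le_norm (f a) (f s)
    rw [norm_sub_rev] at h4
    have h5 := RR_le K hK j
    have h6 : (0 : ℝ) ≤ (K : ℝ) ^ j := by positivity
    have : (linf (f a) (f s) : ℝ) ≤ 4 * (K : ℝ) ^ (j + 1) := by
      rw [pow_succ]; nlinarith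
    exact_mod_cast this
  intro j
  induction j using Nat.strong_induction_on with
  | _ j IH =>
  intro a b hbT hnode
  have hab : a < b := hnode.1
  have habr : (0 : ℝ) < (b : ℝ) - a := by
    have : (a : ℝ) < b := by exact_mod_cast hab
    linarith
  have hgb : ∀ i < b, ‖toC (f (i + 1)) - toC (f i)‖ ≤ 1 := fun i hi => hg i (by omega)
  match j, IH, hnode with
  | 0, _, hnode =>
    refine ⟨{a}, by simpa using hab, by simp, ?_⟩
    have h1 : 0 ≤ Real.log ((b : ℝ) - a) := by
      apply Real.log_nonneg
      have : (a : ℝ) + 1 ≤ b := by exact_mod_cast hab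
      linarith
    have := hU0 (rd K 0 (f a), rd K 0 (f b))
    simp [rd_zero] at this ⊢
    positivity
  | 1, IH, hnode =>
    have hD : (K : ℝ) * (RR K 0 + 1) ≤ ‖toC (f b) - toC (f a)‖ := hnode.2.1
    obtain ⟨τ, h0, hτ, hτb⟩ := exists_nodes (fun i => toC (f i)) (r := RR K 0) (by simp [RR]) a b K
      hab.le hgb hD
    have hmono := tau_mono hτ
    have ha' : ∀ i ≤ K, a ≤ τ i := fun i hi => h0 ▸ hmono 0 i (by omega) hi
    have hb' : ∀ i ≤ K, τ i ≤ b := fun i hi => (hmono i K hi le_rfl).trans hτb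
    obtain ⟨Z, hZ1, hZ2, hZ3⟩ := combine (fun z => A 0 (f z)) τ K a b (K ^ 0) (Finset.range K)
      (Finset.Subset.refl _) (hKj 0) (fun i hi => (hτ i hi).1) h0 hτb
      (fun i => A 0 (rd K 0 (f (τ i)))) (fun i => U 0 (rd K 0 (f (τ i)), rd K 0 (f (τ (i + 1)))))
      (A 1 (rd K 1 (f a))) (U 1 (rd K 1 (f a), rd K 1 (f b)) + pen) (4 * K ^ 2 * pen)
      (((b : ℝ) - a) / K) hcp (by positivity)
      (by
        intro i hi
        have hi := Finset.mem_range.mp hi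
        obtain ⟨Z, h1, h2, h3⟩ := IH 0 (by omega) (τ i) (τ (i + 1)) ((hb' _ hi).trans hbT)
          (hτ i hi)
        refine ⟨Z, h1, h2, ?_⟩
        simpa using h3)
      (by
        have : ∀ i ∈ Finset.range K, |A 0 (rd K 0 (f (τ i))) - A 1 (rd K 1 (f a))| +
            U 0 (rd K 0 (f (τ i)), rd K 0 (f (τ (i + 1))))
            ≤ U 1 (rd K 1 (f a), rd K 1 (f b)) + pen := by
          intro i hi
          have hi := Finset.mem_range.mp hi
          have h1 := hbad 0 (f a) (hf a (by omega)) (f b) (hf b hbT)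
            (f (τ i)) (hf _ ((hb' i hi.le).trans hbT)) (f (τ (i + 1))) (hf _ ((hb' _ hi).trans hbT))
            (near 0 a b hbT hnode _ (ha' i hi.le) (hb' i hi.le))
            (near 0 a b hbT hnode _ (ha' _ hi) (hb' _ hi))
          simp only [zero_add] at h1
          linarith
        refine (Finset.sum_le_sum this).trans (le_of_eq (by simp [mul_add])))
      (by
        rw [Finset.sum_range_sub (fun i => (τ i : ℝ)), h0]
        have : (τ K : ℝ) ≤ b := by exact_mod_cast hτb
        rw [Finset.card_range]; field_simp; linarith)
    refine ⟨Z, hZ1, by simpa using hZ2, hZ3.trans (le_of_eq ?_)⟩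
    simp
  | j + 2, IH, hnode =>
    have hr1 := RR_one_le K hK j
    have hKg : ∀ i ≤ T, f i ∈ VN N := hf
    rcases greedy (fun i => toC (f i)) (r := RR K j) (by linarith) b hgb (K ^ 2 + 1) a hab.le with
      ⟨τ, h0, hτ, hτb⟩ | ⟨m, hm0, hmm, hmb, -, hm⟩
    · -- bad
      have hmono := tau_mono hτ
      have ha' : ∀ i ≤ K ^ 2 + 1, a ≤ τ i := fun i hi => h0 ▸ hmono 0 i (by omega) hi
      have hb' : ∀ i ≤ K ^ 2 + 1, τ i ≤ b := fun i hi => (hmono i _ hi le_rfl).trans hτb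
      obtain ⟨i0, hi0, hmax⟩ := Finset.exists_max_image (Finset.range (K ^ 2 + 1))
        (fun i => (τ (i + 1) : ℝ) - τ i) (by simp)
      set S := (Finset.range (K ^ 2 + 1)).erase i0 with hS
      have hScard : S.card = K ^ 2 := by
        rw [hS, Finset.card_erase_of_mem hi0, Finset.card_range]; rfl
      have hSsub : S ⊆ Finset.range (K ^ 2 + 1) := Finset.erase_subset _ _
      have hsumtot : ∑ i ∈ Finset.range (K ^ 2 + 1), ((τ (i + 1) : ℝ) - τ i) ≤ (b : ℝ) - a := by
        rw [Finset.sum_range_sub (fun i => (τ i : ℝ)), h0]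
        have : (τ (K ^ 2 + 1) : ℝ) ≤ b := by exact_mod_cast hτb
        linarith
      have hsplit : ∑ i ∈ S, ((τ (i + 1) : ℝ) - τ i) + ((τ (i0 + 1) : ℝ) - τ i0)
          = ∑ i ∈ Finset.range (K ^ 2 + 1), ((τ (i + 1) : ℝ) - τ i) :=
        Finset.sum_erase_add _ _ hi0
      have hle : ∑ i ∈ S, ((τ (i + 1) : ℝ) - τ i) ≤ S.card * ((τ (i0 + 1) : ℝ) - τ i0) := by
        rw [← nsmul_eq_mul]
        exact Finset.sum_le_card_nsmul _ _ _ fun i hi => hmax i (hSsub hi)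
      obtain ⟨Z, hZ1, hZ2, hZ3⟩ := combine (fun z => A 0 (f z)) τ (K ^ 2 + 1) a b (K ^ j) S
        hSsub (hKj j)
        (fun i hi => (hτ i hi).1) h0 hτb
        (fun i => A j (rd K j (f (τ i))))
        (fun i => U j (rd K j (f (τ i)), rd K j (f (τ (i + 1)))) + pen)
        (A (j + 2) (rd K (j + 2) (f a))) (U (j + 2) (rd K (j + 2) (f a), rd K (j + 2) (f b)) +
          3 * pen) (4 * K ^ 2 * pen)
        (((b : ℝ) - a) / (K ^ 2 + 1)) hcp (by positivity)
        (by
          intro i hi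
          have hi := Finset.mem_range.mp (hSsub hi)
          obtain ⟨Z, h1, h2, h3⟩ := IH j (by omega) (τ i) (τ (i + 1)) ((hb' _ hi).trans hbT)
            (hτ i hi)
          refine ⟨Z, h1, h2, h3.trans ?_⟩
          have : (if j = 0 then 0 else pen) ≤ pen := by split_ifs <;> simp [hpen]
          gcongr)
        (by
          have : ∀ i ∈ S, |A j (rd K j (f (τ i))) - A (j + 2) (rd K (j + 2) (f a))| +
              (U j (rd K j (f (τ i)), rd K j (f (τ (i + 1)))) + pen)
              ≤ U (j + 2) (rd K (j + 2) (f a), rd K (j + 2) (f b)) + 3 * pen := by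
            intro i hi
            have hi := Finset.mem_range.mp (hSsub hi)
            have hVi := hf _ ((hb' i hi.le).trans hbT)
            have n1 := near (j + 1) a b hbT hnode _ (ha' i hi.le) (hb' i hi.le)
            have h1 := hbad (j + 1) (f a) (hf a (by omega)) (f b) (hf b hbT)
              (f (τ i)) hVi (f (τ i)) hVi n1 n1
            have h2 := hbad j (f (τ i)) hVi (f (τ i)) hVi
              (f (τ i)) hVi (f (τ (i + 1))) (hf _ ((hb' _ hi).trans hbT))
              (by simp [linf]) (near2 j _ _ ((hb' _ hi).trans hbT) (hτ i hi) _ (hτ i hi).1.le le_rfl)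
            have h3 := abs_sub_le (A j (rd K j (f (τ i)))) (A (j + 1) (rd K (j + 1) (f (τ i))))
              (A (j + 2) (rd K (j + 2) (f a)))
            rw [show j + 1 + 1 = j + 2 from rfl] at h1
            linarith
          refine (Finset.sum_le_sum this).trans (le_of_eq (by simp [mul_add])))
        (by
          have hc : (S.card : ℝ) = (K : ℝ) ^ 2 := by rw [hScard]; push_cast; rfl
          rw [hc] at hle ⊢
          rw [mul_div_assoc', le_div_iff₀ (by positivity)]
          nlinarith)
      refine ⟨Z, hZ1, by rw [hZ2, hScard]; ring, hZ3.trans (le_of_le_of_eq ?_ rfl)⟩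
      rw [hScard, show K ^ 2 * K ^ j = K ^ (j + 2) by ring]
      apply mul_le_mul_of_nonneg_left _ (by positivity)
      have hgain := log_gain K hK pen hpen
      have hlog : Real.log (((b : ℝ) - a) / (K ^ (j + 2) : ℕ))
          = Real.log (((b : ℝ) - a) / (K ^ 2 + 1) / (K ^ j : ℕ)) +
            Real.log (((K : ℝ) ^ 2 + 1) / K ^ 2) := by
        rw [← Real.log_mul (by positivity) (by positivity)]
        congr 1
        push_cast
        field_simp
        ring
      rw [hlog]
      simp only [show j + 2 ≠ 0 by omega, if_false]
      linarith
    · -- good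
      have hD : (K : ℝ) * (RR K (j + 1) + 1) ≤ ‖toC (f b) - toC (f a)‖ := hnode.2.1
      obtain ⟨τ, h0, hτ, hτb⟩ := exists_nodes (fun i => toC (f i)) (r := RR K (j + 1))
        (by linarith [RR_one_le K hK (j + 1)]) a b K hab.le hgb hD
      have hmono := tau_mono hτ
      have ha' : ∀ i ≤ K, a ≤ τ i := fun i hi => h0 ▸ hmono 0 i (by omega) hi
      have hb' : ∀ i ≤ K, τ i ≤ b := fun i hi => (hmono i K hi le_rfl).trans hτb
      have hstr := straight (fun i => toC (f i)) hr1 K hK a b hgb hnode m hm0 hmb hmm hm τ h0 hτ hτb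
      have hq : 0 < q := by rcases Nat.eq_zero_or_pos q with h | h; (· subst h; omega); exact h
      have hL : 0 < L := by rcases Nat.eq_zero_or_pos L with h | h; (· subst h; omega); exact h
      have hn2 := hnode.lt_add hbT hg hab.le le_rfl
      have hfa := hf a (by omega)
      have hfb := hf b hbT
      set s : Z2 × Z2 := (rd K (j + 2) (f a), rd K (j + 2) (f b)) with hs
      set W : ℕ → ℝ := fun i => |A (j + 1) (qpos K s i) - A (j + 2) s.1| with hW
      have hgd : ∀ c < q, ∀ i < K, (∑ e ∈ Finset.range L, W (c + e * q)) / L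
          + |A (j + 1) (rd K (j + 1) (f (τ i))) - A (j + 1) (qpos K s i)|
          + U (j + 1) (rd K (j + 1) (f (τ i)), rd K (j + 1) (f (τ (i + 1)))) ≤ U (j + 2) s := by
        intro c hc i hi
        refine hgood (j + 1) (f a) hfa (f b) hfb (f (τ i)) (hf _ ((hb' i hi.le).trans hbT))
          (f (τ (i + 1))) (hf _ ((hb' _ hi).trans hbT)) ?_ ?_
          (near (j + 1) a b hbT hnode _ (ha' i hi.le) (hb' i hi.le))
          (near (j + 1) a b hbT hnode _ (ha' _ hi) (hb' _ hi)) c hc i hi ?_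
        · exact (RR_succ_ge K hK (j + 1)).trans hnode.2.1
        · have := RR_le K hK (j + 2)
          have h6 : (0 : ℝ) ≤ (K : ℝ) ^ (j + 2) := by positivity
          rw [show j + 1 + 1 = j + 2 from rfl]
          linarith
        · refine (hstr i hi).trans ?_
          have := RR_le K hK (j + 1)
          rw [RR] at this
          linarith
      have hKL' : (K : ℝ) = L * q := by exact_mod_cast hKL
      have hqr : (0 : ℝ) < q := by exact_mod_cast hq
      have hLr : (0 : ℝ) < L := by exact_mod_cast hL
      have hgd2 : ∀ i < K, (∑ e ∈ Finset.range K, W e) / K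
          + |A (j + 1) (rd K (j + 1) (f (τ i))) - A (j + 1) (qpos K s i)|
          + U (j + 1) (rd K (j + 1) (f (τ i)), rd K (j + 1) (f (τ (i + 1)))) ≤ U (j + 2) s := by
        intro i hi
        have h1 := Finset.sum_le_sum (s := Finset.range q) fun c hc =>
          hgd c (Finset.mem_range.mp hc) i hi
        rw [Finset.sum_add_distrib, Finset.sum_add_distrib, ← Finset.sum_div,
          ← sum_classes K L q hKL W] at h1
        simp only [Finset.sum_const, Finset.card_range, nsmul_eq_mul] at h1
        have h2 : (∑ e ∈ Finset.range K, W e) / L = q * ((∑ e ∈ Finset.range K, W e) / K) := by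
          rw [hKL']; field_simp
        rw [h2, ← mul_add, ← mul_add] at h1
        exact le_of_mul_le_mul_left h1 hqr
      obtain ⟨Z, hZ1, hZ2, hZ3⟩ := combine (fun z => A 0 (f z)) τ K a b (K ^ (j + 1))
        (Finset.range K)
        (Finset.Subset.refl _) (hKj _) (fun i hi => (hτ i hi).1) h0 hτb
        (fun i => A (j + 1) (rd K (j + 1) (f (τ i))))
        (fun i => U (j + 1) (rd K (j + 1) (f (τ i)), rd K (j + 1) (f (τ (i + 1)))) + pen)
        (A (j + 2) (rd K (j + 2) (f a))) (U (j + 2) s + pen) (4 * K ^ 2 * pen)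
        (((b : ℝ) - a) / K) hcp (by positivity)
        (by
          intro i hi
          have hi := Finset.mem_range.mp hi
          obtain ⟨Z, h1, h2, h3⟩ := IH (j + 1) (by omega) (τ i) (τ (i + 1)) ((hb' _ hi).trans hbT)
            (hτ i hi)
          refine ⟨Z, h1, h2, ?_⟩
          simpa using h3)
        (by
          have h1 : ∀ i ∈ Finset.range K,
              |A (j + 1) (rd K (j + 1) (f (τ i))) - A (j + 2) (rd K (j + 2) (f a))| +
              (U (j + 1) (rd K (j + 1) (f (τ i)), rd K (j + 1) (f (τ (i + 1)))) + pen)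
              ≤ U (j + 2) s + pen + (W i - (∑ e ∈ Finset.range K, W e) / K) := by
            intro i hi
            have hi := Finset.mem_range.mp hi
            have h2 := hgd2 i hi
            have h3 := abs_sub_le (A (j + 1) (rd K (j + 1) (f (τ i)))) (A (j + 1) (qpos K s i))
              (A (j + 2) (rd K (j + 2) (f a)))
            have h4 : W i = |A (j + 1) (qpos K s i) - A (j + 2) (rd K (j + 2) (f a))| := rfl
            linarith
          refine (Finset.sum_le_sum h1).trans (le_of_eq ?_)
          rw [Finset.sum_add_distrib, Finset.sum_sub_distrib]
          simp only [Finset.sum_const, Finset.card_range, nsmul_eq_mul]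
          field_simp
          ring)
        (by
          rw [Finset.sum_range_sub (fun i => (τ i : ℝ)), h0]
          have : (τ K : ℝ) ≤ b := by exact_mod_cast hτb
          rw [Finset.card_range]; field_simp; linarith)
      have e : K * K ^ (j + 1) = K ^ (j + 2) := by ring
      refine ⟨Z, hZ1, by rw [hZ2, Finset.card_range, e], hZ3.trans (le_of_eq ?_)⟩
      rw [Finset.card_range, e]
      have e2 : ((b : ℝ) - a) / K / (K ^ (j + 1) : ℕ) = ((b : ℝ) - a) / (K ^ (j + 2) : ℕ) := by
        rw [div_div, ← e]; push_cast; rfl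
      rw [e2]
      simp
end claim

end HV

open MeasureTheory ProbabilityTheory Real Set Filter

namespace HV

/-- side length -/
def Mx (N : ℕ) : ℕ := 5 * N - 1

/-- the Fourier modes -/
def modes (N : ℕ) : Finset (ℕ × ℕ) := Finset.Ioo 0 (Mx N) ×ˢ Finset.Ioo 0 (Mx N)

/-- sine modes -/
noncomputable def sn (N k : ℕ) (u : ℤ) : ℝ := Real.sin (π * k * ((u : ℝ) + 2 * N) / Mx N)

/-- product modes -/
noncomputable def ss (N : ℕ) (κ : ℕ × ℕ) (x : Z2) : ℝ := sn N κ.1 x.1 * sn N κ.2 x.2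

/-- eigenvalues -/
noncomputable def lam (N : ℕ) (κ : ℕ × ℕ) : ℝ :=
  Real.sin (π * κ.1 / (2 * Mx N)) ^ 2 + Real.sin (π * κ.2 / (2 * Mx N)) ^ 2

/-- variances -/
noncomputable def ww (N : ℕ) (κ : ℕ × ℕ) : ℝ := 4 / ((Mx N : ℝ) ^ 2 * lam N κ)

/-- quadratic form -/
noncomputable def QQ (N : ℕ) (C : ℕ × ℕ → ℝ) : ℝ := ∑ κ ∈ modes N, ww N κ * C κ ^ 2

/-- bilinear form -/
noncomputable def BB (N : ℕ) (C D : ℕ × ℕ → ℝ) : ℝ := ∑ κ ∈ modes N, ww N κ * (C κ * D κ)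

lemma mem_modes {N : ℕ} {κ : ℕ × ℕ} : κ ∈ modes N ↔
    (0 < κ.1 ∧ κ.1 < Mx N) ∧ (0 < κ.2 ∧ κ.2 < Mx N) := by
  simp [modes, Finset.mem_product]

lemma sin_half_ge (M : ℕ) (k : ℕ) (hk : k ≤ M) (hM : 0 < M) :
    (k : ℝ) / M ≤ Real.sin (π * k / (2 * M)) := by
  have hMr : (0 : ℝ) < M := by exact_mod_cast hM
  have hkr : (k : ℝ) ≤ M := by exact_mod_cast hk
  have h := Real.mul_le_sin (x := π * k / (2 * M)) (by positivity) (by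
    rw [div_le_div_iff₀ (by positivity) (by positivity)]
    nlinarith [Real.pi_pos])
  convert h using 1
  field_simp

lemma lam_ge {N : ℕ} {κ : ℕ × ℕ} (hκ : κ ∈ modes N) :
    ((κ.1 : ℝ) ^ 2 + (κ.2 : ℝ) ^ 2) / (Mx N : ℝ) ^ 2 ≤ lam N κ := by
  obtain ⟨⟨h1, h2⟩, h3, h4⟩ := mem_modes.mp hκ
  rw [lam, add_div, ← div_pow, ← div_pow]
  gcongr
  · exact sin_half_ge _ _ h2.le (by omega)
  · exact sin_half_ge _ _ h4.le (by omega)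

lemma sq_pos_modes {N : ℕ} {κ : ℕ × ℕ} (hκ : κ ∈ modes N) :
    0 < (κ.1 : ℝ) ^ 2 + (κ.2 : ℝ) ^ 2 := by
  obtain ⟨⟨h1, h2⟩, h3, h4⟩ := mem_modes.mp hκ
  positivity

lemma lam_pos {N : ℕ} {κ : ℕ × ℕ} (hκ : κ ∈ modes N) : 0 < lam N κ := by
  refine lt_of_lt_of_le ?_ (lam_ge hκ)
  have := sq_pos_modes hκ
  obtain ⟨⟨h1, h2⟩, h3, h4⟩ := mem_modes.mp hκ
  have : 0 < Mx N := by omega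
  positivity

lemma ww_nonneg {N : ℕ} (κ : ℕ × ℕ) : 0 ≤ ww N κ := by
  unfold ww lam; positivity

lemma ww_le {N : ℕ} {κ : ℕ × ℕ} (hκ : κ ∈ modes N) :
    ww N κ ≤ 4 / ((κ.1 : ℝ) ^ 2 + (κ.2 : ℝ) ^ 2) := by
  have h := lam_ge hκ
  have h0 := sq_pos_modes hκ
  obtain ⟨⟨h1, h2⟩, h3, h4⟩ := mem_modes.mp hκ
  have hM : 0 < (Mx N : ℝ) := by exact_mod_cast (by omega : 0 < Mx N)
  rw [div_le_iff₀ (by positivity)] at h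
  unfold ww
  apply div_le_div_of_nonneg_left (by norm_num) h0
  linarith

lemma QQ_nonneg (N : ℕ) (C : ℕ × ℕ → ℝ) : 0 ≤ QQ N C :=
  Finset.sum_nonneg fun κ _ => mul_nonneg (ww_nonneg κ) (sq_nonneg _)

lemma abs_ss_le (N : ℕ) (κ : ℕ × ℕ) (x : Z2) : |ss N κ x| ≤ 1 := by
  rw [ss, abs_mul]
  exact mul_le_one₀ (Real.abs_sin_le_one _) (abs_nonneg _) (Real.abs_sin_le_one _)

lemma sum_mx (N : ℕ) (I : Finset ℕ) (h : ℕ × ℕ → ℝ) (φ : ℕ → ℝ) (hφ : ∀ m, 0 ≤ φ m)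
    (hh : ∀ κ ∈ modes N, h κ ≤ if max κ.1 κ.2 ∈ I then φ (max κ.1 κ.2) else 0) :
    ∑ κ ∈ modes N, h κ ≤ ∑ m ∈ I, 2 * m * φ m := by
  refine (Finset.sum_le_sum hh).trans ?_
  rw [← Finset.sum_filter]
  rw [← Finset.sum_fiberwise_of_maps_to (s := (modes N).filter fun κ => max κ.1 κ.2 ∈ I)
    (t := I) (g := fun κ => max κ.1 κ.2) (fun κ hκ => (Finset.mem_filter.mp hκ).2)]
  apply Finset.sum_le_sum
  intro m hm
  rw [Finset.sum_congr rfl (g := fun _ => φ m) (fun κ hκ => by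
    rw [(Finset.mem_filter.mp hκ).2]), Finset.sum_const, nsmul_eq_mul]
  apply mul_le_mul_of_nonneg_right _ (hφ m)
  have hsub : (((modes N).filter fun κ => max κ.1 κ.2 ∈ I).filter fun κ => max κ.1 κ.2 = m) ⊆
      (({m} : Finset ℕ) ×ˢ Finset.Icc 1 m) ∪ (Finset.Icc 1 m ×ˢ ({m} : Finset ℕ)) := by
    intro κ hκ
    obtain ⟨h1, h2⟩ := Finset.mem_filter.mp hκ
    obtain ⟨⟨h3, _⟩, h4, _⟩ := mem_modes.mp (Finset.mem_filter.mp h1).1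
    simp only [Finset.mem_union, Finset.mem_product, Finset.mem_singleton, Finset.mem_Icc]
    omega
  have := (Finset.card_le_card hsub).trans (Finset.card_union_le _ _)
  simp only [Finset.card_product, Finset.card_singleton, Nat.card_Icc] at this
  have h2 : _ ≤ 2 * m := this.trans (by omega)
  exact_mod_cast h2

lemma max_bounds {N : ℕ} {κ : ℕ × ℕ} (hκ : κ ∈ modes N) :
    1 ≤ max κ.1 κ.2 ∧ ((max κ.1 κ.2 : ℕ) : ℝ) ^ 2 ≤ (κ.1 : ℝ) ^ 2 + (κ.2 : ℝ) ^ 2 ∧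
      (κ.1 : ℝ) + κ.2 ≤ 2 * (max κ.1 κ.2 : ℕ) := by
  obtain ⟨⟨h1, h2⟩, h3, h4⟩ := mem_modes.mp hκ
  refine ⟨by omega, ?_, ?_⟩
  · rcases le_total κ.1 κ.2 with h | h
    · rw [max_eq_right h]; nlinarith [sq_nonneg (κ.1 : ℝ)]
    · rw [max_eq_left h]; nlinarith [sq_nonneg (κ.2 : ℝ)]
  · exact_mod_cast (by omega : κ.1 + κ.2 ≤ 2 * max κ.1 κ.2)

lemma ww_le_max {N : ℕ} {κ : ℕ × ℕ} (hκ : κ ∈ modes N) :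
    ww N κ ≤ 4 / ((max κ.1 κ.2 : ℕ) : ℝ) ^ 2 := by
  obtain ⟨h1, h2, _⟩ := max_bounds hκ
  refine (ww_le hκ).trans (div_le_div_of_nonneg_left (by norm_num) ?_ h2)
  have : (0 : ℝ) < (max κ.1 κ.2 : ℕ) := by exact_mod_cast h1
  positivity

lemma Q_low (N : ℕ) (C : ℕ × ℕ → ℝ) (a Y : ℝ) (hY : 0 < Y)
    (h1 : ∀ κ ∈ modes N, ((max κ.1 κ.2 : ℕ) : ℝ) ≤ Y → |C κ| ≤ a * (κ.1 + κ.2) / Y)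
    (h2 : ∀ κ ∈ modes N, Y < ((max κ.1 κ.2 : ℕ) : ℝ) → C κ = 0) : QQ N C ≤ 16 * a ^ 2 := by
  refine (sum_mx N (Finset.Icc 1 ⌊Y⌋₊) _ (fun m => 8 * a ^ 2 / Y ^ 2) (fun m => by positivity)
    ?_).trans ?_
  · intro κ hκ
    by_cases hm : ((max κ.1 κ.2 : ℕ) : ℝ) ≤ Y
    · rw [if_pos (Finset.mem_Icc.mpr ⟨(max_bounds hκ).1, Nat.le_floor hm⟩)]
      have e1 := h1 κ hκ hm
      have e2 := ww_le hκ
      have e3 := sq_pos_modes hκ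
      have e4 : C κ ^ 2 ≤ (a * (κ.1 + κ.2) / Y) ^ 2 := by
        rw [← sq_abs]; exact pow_le_pow_left₀ (abs_nonneg _) e1 2
      calc ww N κ * C κ ^ 2 ≤ 4 / ((κ.1 : ℝ) ^ 2 + (κ.2 : ℝ) ^ 2) * (a * (κ.1 + κ.2) / Y) ^ 2 :=
            mul_le_mul e2 e4 (sq_nonneg _) (by positivity)
        _ = 4 * a ^ 2 / Y ^ 2 * (((κ.1 : ℝ) + κ.2) ^ 2 / ((κ.1 : ℝ) ^ 2 + (κ.2 : ℝ) ^ 2)) := by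
            field_simp
        _ ≤ 4 * a ^ 2 / Y ^ 2 * 2 := by
            apply mul_le_mul_of_nonneg_left _ (by positivity)
            rw [div_le_iff₀ e3]; nlinarith [sq_nonneg ((κ.1 : ℝ) - κ.2)]
        _ = _ := by ring
    · rw [h2 κ hκ (not_le.mp hm)]
      split_ifs
      · simp; positivity
      · simp
  · have hfl : (⌊Y⌋₊ : ℝ) ≤ Y := Nat.floor_le hY.le
    calc ∑ m ∈ Finset.Icc 1 ⌊Y⌋₊, 2 * (m : ℝ) * (8 * a ^ 2 / Y ^ 2)
        ≤ ∑ m ∈ Finset.Icc 1 ⌊Y⌋₊, 2 * Y * (8 * a ^ 2 / Y ^ 2) := by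
          apply Finset.sum_le_sum
          intro m hm
          have : (m : ℝ) ≤ Y := by
            have := (Finset.mem_Icc.mp hm).2
            have : (m : ℝ) ≤ ⌊Y⌋₊ := by exact_mod_cast this
            linarith
          gcongr
      _ = ⌊Y⌋₊ * (2 * Y * (8 * a ^ 2 / Y ^ 2)) := by simp
      _ ≤ Y * (2 * Y * (8 * a ^ 2 / Y ^ 2)) := by gcongr
      _ = _ := by field_simp; ring

lemma B_cross (N : ℕ) (C D : ℕ × ℕ → ℝ) (a b Y : ℝ) (ha : 0 ≤ a) (hb : 0 ≤ b) (hY : 0 < Y)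
    (h1 : ∀ κ ∈ modes N, |C κ| ≤ a)
    (h2 : ∀ κ ∈ modes N, Y < ((max κ.1 κ.2 : ℕ) : ℝ) → C κ = 0)
    (h3 : ∀ κ ∈ modes N, |D κ| ≤ b * (κ.1 + κ.2) / Y) : |BB N C D| ≤ 16 * a * b := by
  refine (Finset.abs_sum_le_sum_abs _ _).trans ?_
  refine (sum_mx N (Finset.Icc 1 ⌊Y⌋₊) _ (fun m => 8 * a * b / (Y * m)) (fun m => by positivity)
    ?_).trans ?_
  · intro κ hκ
    by_cases hm : ((max κ.1 κ.2 : ℕ) : ℝ) ≤ Y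
    · rw [if_pos (Finset.mem_Icc.mpr ⟨(max_bounds hκ).1, Nat.le_floor hm⟩)]
      have e1 := h1 κ hκ
      have e2 := ww_le_max hκ
      have e3 := h3 κ hκ
      obtain ⟨m1, _, m3⟩ := max_bounds hκ
      have m1 : (0 : ℝ) < (max κ.1 κ.2 : ℕ) := by exact_mod_cast m1
      set m : ℕ := max κ.1 κ.2
      rw [abs_mul, abs_mul, abs_of_nonneg (ww_nonneg κ)]
      calc ww N κ * (|C κ| * |D κ|) ≤ 4 / (m : ℝ) ^ 2 * (a * (b * (2 * m) / Y)) := by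
            apply mul_le_mul e2 _ (by positivity) (by positivity)
            apply mul_le_mul e1 (e3.trans _) (abs_nonneg _) ha
            gcongr
        _ = _ := by field_simp; ring
    · rw [h2 κ hκ (not_le.mp hm)]
      split_ifs
      · simp; positivity
      · simp
  · have hfl : (⌊Y⌋₊ : ℝ) ≤ Y := Nat.floor_le hY.le
    calc ∑ m ∈ Finset.Icc 1 ⌊Y⌋₊, 2 * (m : ℝ) * (8 * a * b / (Y * m))
        = ∑ m ∈ Finset.Icc 1 ⌊Y⌋₊, 16 * a * b / Y := by
          apply Finset.sum_congr rfl
          intro m hm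
          have : (0 : ℝ) < m := by exact_mod_cast (Finset.mem_Icc.mp hm).1
          field_simp; ring
      _ = ⌊Y⌋₊ * (16 * a * b / Y) := by simp
      _ ≤ Y * (16 * a * b / Y) := by gcongr
      _ = _ := by field_simp

lemma sum_inv_le (a b : ℕ) (hab : a + 1 ≤ b) :
    ∑ m ∈ Finset.Ioc a b, (1 : ℝ) / m ≤ 1 + Real.log (b / (a + 1)) := by
  induction b, hab using Nat.le_induction with
  | base =>
    have h1 : Finset.Ioc a (a + 1) = {a + 1} := by ext; simp
    rw [h1]
    have : (0 : ℝ) < (a : ℝ) + 1 := by positivity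
    simp [this.ne']
    rw [inv_le_one₀ this]; linarith [(Nat.cast_nonneg a : (0 : ℝ) ≤ a)]
  | succ b hb ih =>
    rw [← Finset.insert_Ioc_right_eq_Ioc_add_one (by omega), Finset.sum_insert (by simp)]
    have hb0 : (0 : ℝ) < b := by exact_mod_cast (by omega : 0 < b)
    have h1 := Real.one_sub_inv_le_log_of_pos (x := ((b : ℝ) + 1) / b) (by positivity)
    have h2 : 1 - (((b : ℝ) + 1) / b)⁻¹ = 1 / (b + 1) := by field_simp; ring
    have h3 : Real.log (((b + 1 : ℕ) : ℝ) / (a + 1)) = Real.log (b / (a + 1)) +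
        Real.log (((b : ℝ) + 1) / b) := by
      rw [← Real.log_mul (by positivity) (by positivity)]
      congr 1; push_cast; field_simp
    rw [h3]; push_cast; linarith

lemma sum_inv_le' (X Y : ℝ) (hX : 0 < X) (hXY : X ≤ Y) :
    ∑ m ∈ Finset.Ioc ⌊X⌋₊ ⌊Y⌋₊, (1 : ℝ) / m ≤ 1 + Real.log (Y / X) := by
  have hlog : 0 ≤ Real.log (Y / X) := Real.log_nonneg (by rwa [le_div_iff₀ hX, one_mul])
  by_cases h : ⌊X⌋₊ + 1 ≤ ⌊Y⌋₊
  · refine (sum_inv_le _ _ h).trans ?_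
    have h1 : (⌊Y⌋₊ : ℝ) ≤ Y := Nat.floor_le (by linarith)
    have h2 : X < ⌊X⌋₊ + 1 := Nat.lt_floor_add_one X
    have h3 : (0 : ℝ) < ⌊Y⌋₊ := by exact_mod_cast (by omega : 0 < ⌊Y⌋₊)
    have : Real.log (⌊Y⌋₊ / (⌊X⌋₊ + 1)) ≤ Real.log (Y / X) := by
      apply Real.log_le_log (by positivity)
      gcongr
      linarith
    linarith
  · rw [Finset.Ioc_eq_empty (by omega)]; simp; linarith

lemma Q_mid (N : ℕ) (C : ℕ × ℕ → ℝ) (a X Y : ℝ) (hX : 0 < X) (hXY : X ≤ Y)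
    (h1 : ∀ κ ∈ modes N, |C κ| ≤ a)
    (h2 : ∀ κ ∈ modes N, Y < ((max κ.1 κ.2 : ℕ) : ℝ) → C κ = 0)
    (h3 : ∀ κ ∈ modes N, ((max κ.1 κ.2 : ℕ) : ℝ) ≤ X → C κ = 0) :
    QQ N C ≤ 8 * a ^ 2 * (1 + Real.log (Y / X)) := by
  refine (sum_mx N (Finset.Ioc ⌊X⌋₊ ⌊Y⌋₊) _ (fun m => 4 * a ^ 2 / m ^ 2) (fun m => by positivity)
    ?_).trans ?_
  · intro κ hκ
    by_cases hm : ((max κ.1 κ.2 : ℕ) : ℝ) ≤ X ∨ Y < ((max κ.1 κ.2 : ℕ) : ℝ)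
    · have : C κ = 0 := by
        rcases hm with h | h
        · exact h3 κ hκ h
        · exact h2 κ hκ h
      rw [this]
      split_ifs
      · simp; positivity
      · simp
    · push Not at hm
      rw [if_pos (Finset.mem_Ioc.mpr ⟨(Nat.floor_lt hX.le).mpr hm.1, Nat.le_floor hm.2⟩)]
      have e2 := ww_le_max hκ
      have e4 : C κ ^ 2 ≤ a ^ 2 := by
        rw [← sq_abs]; exact pow_le_pow_left₀ (abs_nonneg _) (h1 κ hκ) 2
      refine (mul_le_mul e2 e4 (sq_nonneg _) (by positivity)).trans (le_of_eq ?_)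
      ring
  · have := sum_inv_le' X Y hX hXY
    calc ∑ m ∈ Finset.Ioc ⌊X⌋₊ ⌊Y⌋₊, 2 * (m : ℝ) * (4 * a ^ 2 / m ^ 2)
        = ∑ m ∈ Finset.Ioc ⌊X⌋₊ ⌊Y⌋₊, 8 * a ^ 2 * (1 / m) := by
          apply Finset.sum_congr rfl
          intro m hm
          have : (0 : ℝ) < m := by
            have := (Finset.mem_Ioc.mp hm).1
            exact_mod_cast (by omega : 0 < m)
          field_simp; ring
      _ = 8 * a ^ 2 * ∑ m ∈ Finset.Ioc ⌊X⌋₊ ⌊Y⌋₊, 1 / (m : ℝ) := by rw [Finset.mul_sum]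
      _ ≤ _ := by gcongr

/-- Abel summation -/
lemma abel (a f : ℕ → ℝ) (k0 k1 : ℕ) (B : ℝ) (hB : 0 ≤ B)
    (ha : ∀ i j, k0 ≤ i → i ≤ j → j < k1 → a j ≤ a i) (ha0 : ∀ i, 0 ≤ a i)
    (hf : ∀ n, k0 ≤ n → n ≤ k1 → |∑ k ∈ Finset.Ico k0 n, f k| ≤ B) :
    |∑ k ∈ Finset.Ico k0 k1, a k * f k| ≤ a k0 * B := by
  rcases le_or_gt k1 k0 with h | h
  · rw [Finset.Ico_eq_empty (by omega)]; simpa using mul_nonneg (ha0 _) hB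
  have key : ∀ n, k0 + 1 ≤ n → n ≤ k1 →
      |∑ k ∈ Finset.Ico k0 n, a k * f k - a (n - 1) * ∑ k ∈ Finset.Ico k0 n, f k|
        ≤ (a k0 - a (n - 1)) * B := by
    intro n hn
    induction n, hn using Nat.le_induction with
    | base => intro _; simp
    | succ n hn ih =>
      intro hk
      rw [Finset.sum_Ico_succ_top (by omega), Finset.sum_Ico_succ_top (by omega)]
      have h1 := ih (by omega)
      have h2 := hf n (by omega) (by omega)
      have h3 := ha (n - 1) n (by omega) (by omega) (by omega)
      simp only [Nat.add_sub_cancel]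
      set S := ∑ k ∈ Finset.Ico k0 n, f k
      set T := ∑ k ∈ Finset.Ico k0 n, a k * f k
      have e : T + a n * f n - a n * (S + f n) = (T - a (n - 1) * S) + (a (n - 1) - a n) * S := by
        ring
      rw [e]
      refine (abs_add_le _ _).trans ?_
      rw [abs_mul (a (n - 1) - a n), abs_of_nonneg (by linarith : 0 ≤ a (n - 1) - a n)]
      have := mul_le_mul_of_nonneg_left h2 (by linarith : 0 ≤ a (n - 1) - a n)
      linarith
  have h1 := key k1 h le_rfl
  have h2 := hf k1 h.le le_rfl
  set S := ∑ k ∈ Finset.Ico k0 k1, f k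
  set T := ∑ k ∈ Finset.Ico k0 k1, a k * f k
  have e : T = (T - a (k1 - 1) * S) + a (k1 - 1) * S := by ring
  rw [e]
  refine (abs_add_le _ _).trans ?_
  rw [abs_mul (a (k1 - 1)), abs_of_nonneg (ha0 (k1 - 1))]
  have := mul_le_mul_of_nonneg_left h2 (ha0 (k1 - 1))
  linarith

lemma cos_sum (θ : ℝ) (k0 k1 : ℕ) :
    |∑ k ∈ Finset.Ico k0 k1, Real.cos (k * θ)| * |Real.sin (θ / 2)| ≤ 1 := by
  rcases le_or_gt k1 k0 with h | h
  · rw [Finset.Ico_eq_empty (by omega)]; simp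
  rw [← abs_mul]
  have e : (∑ k ∈ Finset.Ico k0 k1, Real.cos (k * θ)) * Real.sin (θ / 2)
      = (Real.sin ((k1 - 1 / 2) * θ) - Real.sin ((k0 - 1 / 2) * θ)) / 2 := by
    rw [← Finset.sum_Ico_sub (fun k : ℕ => Real.sin ((k - 1 / 2) * θ)) h.le, Finset.sum_mul,
      Finset.sum_div]
    apply Finset.sum_congr rfl
    intro k _
    push_cast
    have h1 : ((k : ℝ) + 1 - 1 / 2) * θ = k * θ + θ / 2 := by ring
    have h2 : ((k : ℝ) - 1 / 2) * θ = k * θ - θ / 2 := by ring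
    rw [h1, h2, Real.sin_add, Real.sin_sub]; ring
  rw [e]
  have h1 := Real.abs_sin_le_one ((k1 - 1 / 2) * θ)
  have h2 := Real.abs_sin_le_one ((k0 - 1 / 2) * θ)
  rw [abs_le] at h1 h2 ⊢
  constructor <;> linarith

end HV

open MeasureTheory ProbabilityTheory Real Set Filter

namespace HV

lemma Mx_cast {N : ℕ} (hN : 1 ≤ N) : (Mx N : ℝ) = 5 * N - 1 := by
  unfold Mx; rw [Nat.cast_sub (by omega)]; push_cast; ring

lemma Mx_pos {N : ℕ} (hN : 1 ≤ N) : (0 : ℝ) < Mx N := by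
  rw [Mx_cast hN]
  have : (1 : ℝ) ≤ N := by exact_mod_cast hN
  linarith

lemma sn_sub_le {N : ℕ} (hN : 1 ≤ N) (k : ℕ) (u v : ℤ) (D : ℝ) (h : |(u : ℝ) - v| ≤ D) :
    |sn N k u - sn N k v| ≤ 4 * k * D / Mx N := by
  have hM := Mx_pos hN
  unfold sn
  refine (Real.abs_sin_sub_sin_le _ _).trans ?_
  have e : π * k * ((u : ℝ) + 2 * N) / Mx N - π * k * ((v : ℝ) + 2 * N) / Mx N
      = π * k * ((u : ℝ) - v) / Mx N := by ring
  rw [e, abs_div, abs_mul, abs_of_pos hM, abs_of_nonneg (by positivity : 0 ≤ π * (k : ℝ))]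
  have := Real.pi_le_four
  gcongr

lemma ss_sub_le {N : ℕ} (hN : 1 ≤ N) (κ : ℕ × ℕ) (x y : Z2) (D : ℝ) (h : (linf x y : ℝ) ≤ D) :
    |ss N κ x - ss N κ y| ≤ 4 * D * (κ.1 + κ.2) / Mx N := by
  have hM := Mx_pos hN
  have h' := h
  unfold linf at h'
  push_cast at h'
  have h1 : |(x.1 : ℝ) - y.1| ≤ D := (le_max_left _ _).trans h'
  have h2 : |(x.2 : ℝ) - y.2| ≤ D := (le_max_right _ _).trans h'
  have e1 := sn_sub_le hN κ.1 x.1 y.1 D h1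
  have e2 := sn_sub_le hN κ.2 x.2 y.2 D h2
  have e3 : |sn N κ.2 x.2| ≤ 1 := Real.abs_sin_le_one _
  have e4 : |sn N κ.1 y.1| ≤ 1 := Real.abs_sin_le_one _
  have e : ss N κ x - ss N κ y = (sn N κ.1 x.1 - sn N κ.1 y.1) * sn N κ.2 x.2
      + sn N κ.1 y.1 * (sn N κ.2 x.2 - sn N κ.2 y.2) := by unfold ss; ring
  rw [e]
  refine (abs_add_le _ _).trans ?_
  rw [abs_mul, abs_mul]
  have e5 := mul_le_mul e1 e3 (abs_nonneg _) ((abs_nonneg _).trans e1)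
  have e6 := mul_le_mul e4 e2 (abs_nonneg _) zero_le_one
  calc _ ≤ 4 * κ.1 * D / Mx N * 1 + 1 * (4 * κ.2 * D / Mx N) := add_le_add e5 e6
    _ = _ := by ring

/-- coefficient vectors of the truncated fields -/
noncomputable def psi (N K j : ℕ) (x : Z2) (κ : ℕ × ℕ) : ℝ :=
  if max κ.1 κ.2 * K ^ j ≤ Mx N then ss N κ x else 0

lemma abs_psi_le (N K j : ℕ) (x : Z2) (κ : ℕ × ℕ) : |psi N K j x κ| ≤ 1 := by
  unfold psi; split_ifs
  · exact abs_ss_le _ _ _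
  · simp

lemma supp_iff {N K j : ℕ} (hK : 0 < K) (m : ℕ) :
    m * K ^ j ≤ Mx N ↔ (m : ℝ) ≤ (Mx N : ℝ) / (K : ℝ) ^ j := by
  have : (0 : ℝ) < (K : ℝ) ^ j := by positivity
  rw [le_div_iff₀ this]
  exact_mod_cast Iff.rfl

lemma psi_eq_zero {N K j : ℕ} (hK : 0 < K) (x : Z2) {κ : ℕ × ℕ}
    (h : (Mx N : ℝ) / (K : ℝ) ^ j < (max κ.1 κ.2 : ℕ)) : psi N K j x κ = 0 := by
  unfold psi
  rw [if_neg]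
  rw [supp_iff hK]
  exact not_le.mpr h

lemma psi_sub_le {N K : ℕ} (hN : 1 ≤ N) (j : ℕ) (κ : ℕ × ℕ) (x y : Z2) (D : ℝ)
    (h : (linf x y : ℝ) ≤ D) (hD : 0 ≤ D) :
    |psi N K j x κ - psi N K j y κ| ≤ 4 * D * (κ.1 + κ.2) / Mx N := by
  have hM := Mx_pos hN
  unfold psi
  split_ifs
  · exact ss_sub_le hN κ x y D h
  · simp; positivity

/-- consecutive levels -/
lemma psi_sub_succ_le {N K : ℕ} (hN : 1 ≤ N) (hK : 4 ≤ K) (j : ℕ) (κ : ℕ × ℕ) (x y : Z2)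
    (h : (linf x y : ℝ) ≤ 5 * (K : ℝ) ^ (j + 1)) :
    |psi N K j x κ - psi N K (j + 1) y κ| ≤ 20 * (κ.1 + κ.2) * (K : ℝ) ^ (j + 1) / Mx N := by
  have hM := Mx_pos hN
  unfold psi
  have hKj : K ^ j ≤ K ^ (j + 1) := Nat.pow_le_pow_right (by omega) (by omega)
  by_cases h1 : max κ.1 κ.2 * K ^ (j + 1) ≤ Mx N
  · have h2 : max κ.1 κ.2 * K ^ j ≤ Mx N := (Nat.mul_le_mul_left _ hKj).trans h1
    rw [if_pos h1, if_pos h2]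
    refine (ss_sub_le hN κ x y _ h).trans (le_of_eq ?_)
    ring
  · rw [if_neg h1, sub_zero]
    have e : |if max κ.1 κ.2 * K ^ j ≤ Mx N then ss N κ x else 0| ≤ 1 := abs_psi_le N K j x κ
    refine e.trans ?_
    rw [le_div_iff₀ hM, one_mul]
    have h3 : Mx N < (κ.1 + κ.2) * K ^ (j + 1) :=
      lt_of_lt_of_le (not_le.mp h1) (Nat.mul_le_mul_right _ (by omega))
    have h4 : (Mx N : ℝ) < (κ.1 + κ.2) * (K : ℝ) ^ (j + 1) := by exact_mod_cast h3
    have h5 : (0 : ℝ) ≤ (κ.1 + κ.2) * (K : ℝ) ^ (j + 1) := by positivity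
    linarith

/-- partial sums of products of sines of separated points. -/
lemma sn_sum {N : ℕ} (hN : 1 ≤ N) (u v : ℤ) (hu : 0 ≤ u) (hu' : u < N) (hv : 0 ≤ v) (hv' : v < N)
    (d : ℝ) (hd : 0 < d) (huv : d ≤ |(u : ℝ) - v|) (k0 k1 : ℕ) :
    |∑ k ∈ Finset.Ico k0 k1, sn N k u * sn N k v| ≤ Mx N / d := by
  have hM := Mx_pos hN
  have hMc := Mx_cast hN
  have hNr : (1 : ℝ) ≤ N := by exact_mod_cast hN
  have hu1 : (0 : ℝ) ≤ u := by exact_mod_cast hu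
  have hv1 : (0 : ℝ) ≤ v := by exact_mod_cast hv
  have hu2 : (u : ℝ) + 1 ≤ N := by exact_mod_cast hu'
  have hv2 : (v : ℝ) + 1 ≤ N := by exact_mod_cast hv'
  set M : ℝ := (Mx N : ℝ) with hMdef
  set θ := π * ((u : ℝ) - v) / M with hθ
  set φ := π * ((u : ℝ) + v + 4 * N) / M with hφ
  have e : ∑ k ∈ Finset.Ico k0 k1, sn N k u * sn N k v
      = (∑ k ∈ Finset.Ico k0 k1, Real.cos (k * θ)) / 2
        - (∑ k ∈ Finset.Ico k0 k1, Real.cos (k * φ)) / 2 := by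
    rw [Finset.sum_div, Finset.sum_div, ← Finset.sum_sub_distrib]
    apply Finset.sum_congr rfl
    intro k _
    unfold sn
    set A := π * k * ((u : ℝ) + 2 * N) / M with hA
    set B := π * k * ((v : ℝ) + 2 * N) / M with hB
    have h1 : (k : ℝ) * θ = A - B := by rw [hA, hB, hθ]; ring
    have h2 : (k : ℝ) * φ = A + B := by rw [hA, hB, hφ]; ring
    rw [h1, h2, Real.cos_sub, Real.cos_add]; ring
  have s1 : d / M ≤ |Real.sin (θ / 2)| := by
    have h1 : |Real.sin (θ / 2)| = Real.sin (|θ / 2|) := by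
      rw [Real.abs_sin_eq_sin_abs_of_abs_le_pi]
      rw [abs_le]
      have : θ / 2 = π * (((u : ℝ) - v) / (2 * M)) := by rw [hθ]; ring
      rw [this]
      have h3 : ((u : ℝ) - v) / (2 * M) ≤ 1 := by rw [div_le_one (by positivity)]; linarith
      have h4 : -1 ≤ ((u : ℝ) - v) / (2 * M) := by rw [le_div_iff₀ (by positivity)]; linarith
      constructor <;> nlinarith [Real.pi_pos]
    rw [h1]
    have h5 : |θ / 2| = π * |(u : ℝ) - v| / (2 * M) := by
      rw [hθ, div_div, abs_div, abs_mul, abs_of_pos Real.pi_pos,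
        abs_of_pos (by positivity : 0 < M * 2), mul_comm M 2]
    have h6 : |(u : ℝ) - v| ≤ M := by rw [abs_le]; constructor <;> linarith
    have h7 := Real.mul_le_sin (x := |θ / 2|) (abs_nonneg _) (by
      rw [h5, div_le_div_iff₀ (by positivity) (by positivity)]
      nlinarith [Real.pi_pos])
    refine le_trans ?_ h7
    rw [h5]
    have : 2 / π * (π * |(u : ℝ) - v| / (2 * M)) = |(u : ℝ) - v| / M := by
      field_simp
    rw [this]; gcongr
  have s2 : d / M ≤ |Real.sin (φ / 2)| := by
    have hdN : d ≤ N := huv.trans (by rw [abs_le]; constructor <;> linarith)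
    have h1 : Real.cos (φ / 2 - π / 2) = Real.sin (φ / 2) := Real.cos_sub_pi_div_two _
    rw [← h1]
    have h2 : |φ / 2 - π / 2| ≤ π / 3 := by
      have : φ / 2 - π / 2 = π * (((u : ℝ) + v + 4 * N) / (2 * M) - 1 / 2) := by rw [hφ]; ring
      rw [this, abs_mul, abs_of_pos Real.pi_pos]
      have h3 : ((u : ℝ) + v + 4 * N) / (2 * M) ≤ 5 / 6 := by
        rw [div_le_iff₀ (by positivity)]; linarith
      have h4 : 1 / 6 ≤ ((u : ℝ) + v + 4 * N) / (2 * M) := by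
        rw [le_div_iff₀ (by positivity)]; linarith
      have h5 : |((u : ℝ) + v + 4 * N) / (2 * M) - 1 / 2| ≤ 1 / 3 := by
        rw [abs_le]; constructor <;> linarith
      nlinarith [Real.pi_pos]
    have h3 : 1 / 2 ≤ Real.cos (φ / 2 - π / 2) := by
      rw [← Real.cos_abs, ← Real.cos_pi_div_three]
      apply Real.cos_le_cos_of_nonneg_of_le_pi (abs_nonneg _) _ h2
      linarith [Real.pi_pos]
    refine le_trans ?_ (h3.trans (le_abs_self _))
    rw [div_le_div_iff₀ hM (by norm_num)]
    linarith
  have hb : ∀ t : ℝ, d / M ≤ |Real.sin (t / 2)| →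
      |∑ k ∈ Finset.Ico k0 k1, Real.cos (k * t)| ≤ M / d := by
    intro t ht
    have h1 := cos_sum t k0 k1
    have h2 : |∑ k ∈ Finset.Ico k0 k1, Real.cos (k * t)| * (d / M) ≤ 1 :=
      (mul_le_mul_of_nonneg_left ht (abs_nonneg _)).trans h1
    rw [← le_div_iff₀ (by positivity)] at h2
    simpa using h2
  have b1 := hb θ s1
  have b2 := hb φ s2
  rw [e]
  rw [abs_le] at b1 b2 ⊢
  constructor <;> linarith

lemma ww_anti {N : ℕ} (k k' l : ℕ) (h0 : 0 < k) (hk : k ≤ k') (hk' : k' < Mx N) :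
    ww N (k', l) ≤ ww N (k, l) := by
  have hM : (0 : ℝ) < Mx N := by exact_mod_cast (by omega : 0 < Mx N)
  have hkr : (k : ℝ) ≤ k' := by exact_mod_cast hk
  have hkM : (k' : ℝ) ≤ Mx N := by exact_mod_cast hk'.le
  have h0r : (0 : ℝ) < k := by exact_mod_cast h0
  have hs : ∀ i : ℕ, 0 < i → i < Mx N → 0 < Real.sin (π * i / (2 * Mx N)) := by
    intro i h1 h2
    refine lt_of_lt_of_le ?_ (sin_half_ge (Mx N) i h2.le (by omega))
    positivity
  have hp := hs k h0 (by omega)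
  have hle : Real.sin (π * k / (2 * Mx N)) ≤ Real.sin (π * k' / (2 * Mx N)) := by
    apply Real.sin_le_sin_of_le_of_le_pi_div_two
    · have : 0 ≤ π * k / (2 * (Mx N : ℝ)) := by positivity
      linarith [Real.pi_pos]
    · rw [div_le_div_iff₀ (by positivity) (by positivity)]
      nlinarith [Real.pi_pos]
    · gcongr
  unfold ww lam
  apply div_le_div_of_nonneg_left (by norm_num)
  · have : 0 < Real.sin (π * k / (2 * Mx N)) ^ 2 := by positivity
    positivity
  · simp only
    gcongr

lemma ww_symm (N k l : ℕ) : ww N (k, l) = ww N (l, k) := by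
  unfold ww lam; simp only; rw [add_comm]

/-- off-diagonal covariance, first coordinate separated -/
lemma offdiag {N : ℕ} (hN : 1 ≤ N) (u v : ℤ) (hu : 0 ≤ u) (hu' : u < N) (hv : 0 ≤ v) (hv' : v < N)
    (d : ℝ) (hd : 0 < d) (huv : d ≤ |(u : ℝ) - v|) (g F : ℕ) (hg : 1 ≤ g) (c : ℕ → ℝ)
    (hc : ∀ l, |c l| ≤ 1) :
    |∑ l ∈ Finset.Ioo 0 (Mx N), ∑ k ∈ Finset.Ioo 0 (Mx N),
      (if g < max k l ∧ max k l ≤ F then ww N (k, l) * (sn N k u * sn N k v * c l) else 0)|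
      ≤ 8 / g * (Mx N / d) := by
  have hM := Mx_pos hN
  have hB : 0 ≤ Mx N / d := by positivity
  have hgr : (1 : ℝ) ≤ g := by exact_mod_cast hg
  -- per row
  have hrow : ∀ l ∈ Finset.Ioo 0 (Mx N),
      |∑ k ∈ Finset.Ioo 0 (Mx N),
        (if g < max k l ∧ max k l ≤ F then ww N (k, l) * (sn N k u * sn N k v * c l) else 0)|
      ≤ (if l ≤ g then 4 / (g : ℝ) ^ 2 else 4 / (l : ℝ) ^ 2) * (Mx N / d) := by
    intro l hl
    have hl := Finset.mem_Ioo.mp hl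
    have hlr : (0 : ℝ) < l := by exact_mod_cast hl.1
    -- interval form
    have gen : ∀ k0 k1, 0 < k0 → k1 ≤ Mx N →
        |∑ k ∈ Finset.Ico k0 k1, ww N (k, l) * (sn N k u * sn N k v * c l)|
          ≤ (if k0 < k1 then ww N (k0, l) else 0) * (Mx N / d) := by
      intro k0 k1 h0 h1
      rcases le_or_gt k1 k0 with h | h
      · rw [Finset.Ico_eq_empty (by omega), if_neg (by omega)]; simp
      rw [if_pos h]
      have e : ∑ k ∈ Finset.Ico k0 k1, ww N (k, l) * (sn N k u * sn N k v * c l)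
          = c l * ∑ k ∈ Finset.Ico k0 k1, ww N (k, l) * (sn N k u * sn N k v) := by
        rw [Finset.mul_sum]; exact Finset.sum_congr rfl fun k _ => by ring
      rw [e, abs_mul]
      have := abel (fun k => ww N (k, l)) (fun k => sn N k u * sn N k v) k0 k1 (Mx N / d) hB
        (fun i j hi hij hj => ww_anti i j l (by omega) hij (by omega)) (fun i => ww_nonneg _)
        (fun n _ _ => sn_sum hN u v hu hu' hv hv' d hd huv k0 n)
      calc _ ≤ 1 * _ := mul_le_mul (hc l) this (abs_nonneg _) zero_le_one
        _ = _ := one_mul _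
    rw [← Finset.sum_filter]
    by_cases hlF : l ≤ F
    · by_cases hlg : l ≤ g
      · have hset : (Finset.Ioo 0 (Mx N)).filter (fun k => g < max k l ∧ max k l ≤ F)
            = Finset.Ico (g + 1) (min (Mx N) (F + 1)) := by
          ext k; simp only [Finset.mem_filter, Finset.mem_Ioo, Finset.mem_Ico]; omega
        rw [hset, if_pos hlg]
        refine (gen _ _ (by omega) (by omega)).trans (mul_le_mul_of_nonneg_right ?_ hB)
        split_ifs with h
        · refine (ww_le (mem_modes.mpr ⟨⟨by simp, by simp; omega⟩, hl.1, hl.2⟩)).trans ?_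
          apply div_le_div_of_nonneg_left (by norm_num) (by positivity)
          push_cast
          nlinarith [sq_nonneg (l : ℝ)]
        · positivity
      · have hset : (Finset.Ioo 0 (Mx N)).filter (fun k => g < max k l ∧ max k l ≤ F)
            = Finset.Ico 1 (min (Mx N) (F + 1)) := by
          ext k; simp only [Finset.mem_filter, Finset.mem_Ioo, Finset.mem_Ico]; omega
        rw [hset, if_neg hlg]
        refine (gen _ _ (by omega) (by omega)).trans (mul_le_mul_of_nonneg_right ?_ hB)
        split_ifs with h
        · refine (ww_le (mem_modes.mpr ⟨⟨by simp, by simp; omega⟩, hl.1, hl.2⟩)).trans ?_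
          apply div_le_div_of_nonneg_left (by norm_num) (by positivity)
          push_cast
          linarith
        · positivity
    · have hset : (Finset.Ioo 0 (Mx N)).filter (fun k => g < max k l ∧ max k l ≤ F) = ∅ := by
        ext k; simp only [Finset.mem_filter, Finset.mem_Ioo, Finset.notMem_empty, iff_false]; omega
      rw [hset]; simp; split_ifs <;> positivity
  refine (Finset.abs_sum_le_sum_abs _ _).trans ((Finset.sum_le_sum hrow).trans ?_)
  rw [← Finset.sum_mul]
  apply mul_le_mul_of_nonneg_right _ hB
  -- Σ_l ≤ 8/g
  rw [Finset.sum_ite, Finset.sum_const, nsmul_eq_mul]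
  have c1 : (((Finset.Ioo 0 (Mx N)).filter (fun l => l ≤ g)).card : ℝ) ≤ g := by
    have : ((Finset.Ioo 0 (Mx N)).filter (fun l => l ≤ g)) ⊆ Finset.Icc 1 g := by
      intro k; simp only [Finset.mem_filter, Finset.mem_Ioo, Finset.mem_Icc]; omega
    have := Finset.card_le_card this
    rw [Nat.card_Icc] at this
    exact_mod_cast (by omega : _ ≤ g)
  have c2 : ∑ l ∈ (Finset.Ioo 0 (Mx N)).filter (fun l => ¬ l ≤ g), 4 / (l : ℝ) ^ 2 ≤ 4 / (g : ℝ) := by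
    have hsub : ∀ n, g ≤ n → ∑ l ∈ Finset.Ioc g n, 4 / (l : ℝ) ^ 2 ≤ 4 / (g : ℝ) - 4 / (n : ℝ) := by
      intro n hn
      induction n, hn using Nat.le_induction with
      | base => simp
      | succ n hn ih =>
        rw [← Finset.insert_Ioc_right_eq_Ioc_add_one (by omega), Finset.sum_insert (by simp)]
        have hn0 : (0 : ℝ) < n := by exact_mod_cast (by omega : 0 < n)
        have : 4 / ((n + 1 : ℕ) : ℝ) ^ 2 ≤ 4 / (n : ℝ) - 4 / ((n + 1 : ℕ) : ℝ) := by
          push_cast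
          rw [div_sub_div _ _ (by positivity) (by positivity), div_le_div_iff₀ (by positivity)
            (by positivity)]
          nlinarith
        linarith
    have h1 : ((Finset.Ioo 0 (Mx N)).filter (fun l => ¬ l ≤ g)) ⊆ Finset.Ioc g (max g (Mx N)) := by
      intro k; simp only [Finset.mem_filter, Finset.mem_Ioo, Finset.mem_Ioc]; omega
    refine (Finset.sum_le_sum_of_subset_of_nonneg h1 (fun _ _ _ => by positivity)).trans
      ((hsub _ (le_max_left _ _)).trans ?_)
    have : 0 ≤ 4 / ((max g (Mx N) : ℕ) : ℝ) := by positivity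
    linarith
  have c3 := mul_le_mul_of_nonneg_right c1 (by positivity : 0 ≤ 4 / (g : ℝ) ^ 2)
  have c4 : (g : ℝ) * (4 / (g : ℝ) ^ 2) = 4 / g := by field_simp
  have c5 : (8 : ℝ) / g = 4 / g + 4 / g := by ring
  linarith

end HV

open MeasureTheory ProbabilityTheory Real Set Filter

namespace HV

lemma QQ_add (N : ℕ) (C D : ℕ × ℕ → ℝ) :
    QQ N (fun κ => C κ + D κ) = QQ N C + 2 * BB N C D + QQ N D := by
  unfold QQ BB
  rw [Finset.mul_sum, ← Finset.sum_add_distrib, ← Finset.sum_add_distrib]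
  exact Finset.sum_congr rfl fun κ _ => by ring

lemma QQ_add_le (N : ℕ) (C D : ℕ × ℕ → ℝ) :
    QQ N (fun κ => C κ + D κ) ≤ 2 * QQ N C + 2 * QQ N D := by
  unfold QQ
  rw [Finset.mul_sum, Finset.mul_sum, ← Finset.sum_add_distrib]
  apply Finset.sum_le_sum
  intro κ _
  have : (C κ + D κ) ^ 2 ≤ 2 * C κ ^ 2 + 2 * D κ ^ 2 := by nlinarith [sq_nonneg (C κ - D κ)]
  have := mul_le_mul_of_nonneg_left this (ww_nonneg (N := N) κ)
  linarith

/-- high frequency part -/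
noncomputable def hi (N g F : ℕ) (x : Z2) (κ : ℕ × ℕ) : ℝ :=
  if g < max κ.1 κ.2 ∧ max κ.1 κ.2 ≤ F then ss N κ x else 0

lemma hi_off {N : ℕ} (hN : 1 ≤ N) (g F : ℕ) (hg : 1 ≤ g) (x y : Z2) (hx : x ∈ VN N)
    (hy : y ∈ VN N) (d : ℝ) (hd : 0 < d) (hxy : d ≤ linf x y) :
    |BB N (hi N g F x) (hi N g F y)| ≤ 8 / g * (Mx N / d) := by
  obtain ⟨x1, x2, x3, x4⟩ := hx
  obtain ⟨y1, y2, y3, y4⟩ := hy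
  have hxy' := hxy
  unfold linf at hxy'
  push_cast at hxy'
  have hab : ∀ l : ℕ, ∀ u v : ℤ, |sn N l u * sn N l v| ≤ 1 := by
    intro l u v
    rw [abs_mul]
    exact mul_le_one₀ (Real.abs_sin_le_one _) (abs_nonneg _) (Real.abs_sin_le_one _)
  rcases le_max_iff.mp hxy' with h | h
  · have := offdiag hN x.1 y.1 x1 x2 y1 y2 d hd h g F hg (fun l => sn N l x.2 * sn N l y.2)
      (fun l => hab l _ _)
    refine le_of_eq_of_le ?_ this
    unfold BB modes
    rw [Finset.sum_product_right]
    congr 1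
    apply Finset.sum_congr rfl; intro l _
    apply Finset.sum_congr rfl; intro k _
    unfold hi ss
    simp only
    split_ifs <;> ring
  · have := offdiag hN x.2 y.2 x3 x4 y3 y4 d hd h g F hg (fun l => sn N l x.1 * sn N l y.1)
      (fun l => hab l _ _)
    refine le_of_eq_of_le ?_ this
    unfold BB modes
    rw [Finset.sum_product]
    congr 1
    apply Finset.sum_congr rfl; intro l _
    apply Finset.sum_congr rfl; intro k _
    unfold hi ss
    simp only [max_comm k l, ww_symm N k l]
    split_ifs <;> ring

lemma QQ_sum (N L : ℕ) (s : Fin L → ℝ) (V : Fin L → ℕ × ℕ → ℝ) :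
    QQ N (fun κ => ∑ b, s b * V b κ) = ∑ b, ∑ b', s b * s b' * BB N (V b) (V b') := by
  unfold QQ BB
  simp_rw [Finset.mul_sum]
  rw [Finset.sum_congr rfl (fun b _ => Finset.sum_comm), Finset.sum_comm]
  apply Finset.sum_congr rfl; intro κ _
  rw [sq, Finset.sum_mul_sum, Finset.mul_sum]
  apply Finset.sum_congr rfl; intro b _
  rw [Finset.mul_sum]
  apply Finset.sum_congr rfl; intro b' _
  ring

lemma spacer_a : (0 : ℝ) ≤ 1 := zero_le_one

/-- the averaged step -/
noncomputable def WW (N K j L : ℕ) (s : Fin L → ℝ) (x : Fin L → Z2) (y : Z2) (κ : ℕ × ℕ) : ℝ :=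
  (∑ b, s b * (psi N K j (x b) κ - psi N K (j + 1) y κ)) / L

lemma WW_abs {N K j L : ℕ} (hL : 0 < L) (s : Fin L → ℝ) (hs : ∀ b, |s b| ≤ 1) (x : Fin L → Z2)
    (y : Z2) (κ : ℕ × ℕ) (B : ℝ) (h : ∀ b, |psi N K j (x b) κ - psi N K (j + 1) y κ| ≤ B) :
    |WW N K j L s x y κ| ≤ B := by
  have hLr : (0 : ℝ) < L := by exact_mod_cast hL
  unfold WW
  rw [abs_div, abs_of_pos hLr, div_le_iff₀ hLr]
  refine (Finset.abs_sum_le_sum_abs _ _).trans ?_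
  calc _ ≤ ∑ _b : Fin L, B := by
        apply Finset.sum_le_sum; intro b _
        rw [abs_mul]
        calc _ ≤ 1 * B := mul_le_mul (hs b) (h b) (abs_nonneg _) zero_le_one
          _ = B := one_mul B
    _ = _ := by simp [mul_comm]

lemma WW_abs1 {N K j L : ℕ} (hN : 1 ≤ N) (hK : 4 ≤ K) (hL : 0 < L) (s : Fin L → ℝ)
    (hs : ∀ b, |s b| ≤ 1) (x : Fin L → Z2)
    (y : Z2) (κ : ℕ × ℕ) (hx : ∀ b, (linf (x b) y : ℝ) ≤ 5 * (K : ℝ) ^ (j + 1)) :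
    |WW N K j L s x y κ| ≤ 20 * (κ.1 + κ.2) * (K : ℝ) ^ (j + 1) / Mx N :=
  WW_abs hL s hs x y κ _ fun b => psi_sub_succ_le hN hK j κ _ _ (hx b)

lemma WW_abs2 {N K j L : ℕ} (hL : 0 < L) (s : Fin L → ℝ)
    (hs : ∀ b, |s b| ≤ 1) (x : Fin L → Z2) (y : Z2) (κ : ℕ × ℕ) :
    |WW N K j L s x y κ| ≤ 2 := by
  apply WW_abs hL s hs x y κ
  intro b
  have h1 := abs_psi_le N K j (x b) κ
  have h2 := abs_psi_le N K (j + 1) y κ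
  rw [abs_le] at *
  constructor <;> linarith

lemma WW_supp {N K j L : ℕ} (hK : 4 ≤ K) (s : Fin L → ℝ) (x : Fin L → Z2) (y : Z2) {κ : ℕ × ℕ}
    (h : (Mx N : ℝ) / (K : ℝ) ^ j < (max κ.1 κ.2 : ℕ)) : WW N K j L s x y κ = 0 := by
  unfold WW
  have h2 : (Mx N : ℝ) / (K : ℝ) ^ (j + 1) < (max κ.1 κ.2 : ℕ) := by
    refine lt_of_le_of_lt ?_ h
    have hK1 : (1 : ℝ) ≤ K := by exact_mod_cast (by omega : 1 ≤ K)
    gcongr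
    omega
  simp [psi_eq_zero (by omega : 0 < K) _ h, psi_eq_zero (by omega : 0 < K) _ h2]

/-- low and mid frequencies -/
lemma QQ_split (N : ℕ) (C : ℕ × ℕ → ℝ) (P : ℕ × ℕ → Prop) [DecidablePred P] :
    QQ N C = QQ N (fun κ => if P κ then C κ else 0) + QQ N (fun κ => if P κ then 0 else C κ) := by
  unfold QQ
  rw [← Finset.sum_add_distrib]
  apply Finset.sum_congr rfl; intro κ _
  by_cases h : P κ <;> simp [h]

/-- crude bound -/
lemma WW_Q_crude {N K j L : ℕ} (hN : 1 ≤ N) (hK : 4 ≤ K) (hL : 0 < L) (s : Fin L → ℝ)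
    (hs : ∀ b, |s b| ≤ 1) (x : Fin L → Z2)
    (y : Z2) (hx : ∀ b, (linf (x b) y : ℝ) ≤ 5 * (K : ℝ) ^ (j + 1)) :
    QQ N (WW N K j L s x y) ≤ 6400 + 32 * (1 + Real.log K) := by
  have hM := Mx_pos hN
  have hKr : (4 : ℝ) ≤ K := by exact_mod_cast hK
  set X := (Mx N : ℝ) / (K : ℝ) ^ (j + 1) with hX
  have hXp : 0 < X := by positivity
  rw [QQ_split N _ (fun κ => ((max κ.1 κ.2 : ℕ) : ℝ) ≤ X)]
  apply add_le_add
  · refine (Q_low N _ 20 X hXp ?_ ?_).trans (by norm_num)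
    · intro κ _ h
      rw [if_pos h]
      refine (WW_abs1 hN hK hL s hs x y κ hx).trans (le_of_eq ?_)
      rw [hX]; field_simp
    · intro κ _ h
      rw [if_neg (not_le.mpr h)]
  · have hY : (Mx N : ℝ) / (K : ℝ) ^ j = K * X := by rw [hX, pow_succ]; field_simp
    refine (Q_mid N _ 2 X (K * X) hXp (by nlinarith) ?_ ?_ ?_).trans (le_of_eq ?_)
    · intro κ _
      split_ifs
      · simp
      · exact WW_abs2 hL s hs x y κ
    · intro κ _ h
      rw [WW_supp hK s x y (by rw [hY]; exact h)]; simp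
    · intro κ _ h
      rw [if_pos h]
    · rw [mul_div_assoc, div_self hXp.ne']; ring_nf

lemma spacer_b : (0 : ℝ) ≤ 1 := zero_le_one

/-- refined bound -/
lemma WW_Q {N K j L : ℕ} (hN : 1 ≤ N) (hK : 4 ≤ K) (hL : 0 < L) (hLK : L ≤ K) (s : Fin L → ℝ)
    (hs : ∀ b, |s b| ≤ 1) (x : Fin L → Z2) (hxV : ∀ b, x b ∈ VN N)
    (y : Z2) (hx : ∀ b, (linf (x b) y : ℝ) ≤ 5 * (K : ℝ) ^ (j + 1))
    (hKN : K ^ (j + 1) ≤ N)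
    (hsep : ∀ b b', b ≠ b' → (K : ℝ) ^ (j + 1) / (2 * L) ≤ linf (x b) (x b')) :
    QQ N (WW N K j L s x y) ≤
      6400 + (8 * (1 + Real.log L) + (8 / L * (1 + Real.log K) + 32)) := by
  have hM := Mx_pos hN
  have hKr : (4 : ℝ) ≤ K := by exact_mod_cast hK
  have hLr : (1 : ℝ) ≤ L := by exact_mod_cast hL
  have hLKr : (L : ℝ) ≤ K := by exact_mod_cast hLK
  set X := (Mx N : ℝ) / (K : ℝ) ^ (j + 1) with hX
  have hXp : 0 < X := by positivity
  have hX1 : 1 ≤ X := by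
    rw [hX, le_div_iff₀ (by positivity), one_mul]
    have h1 : (K : ℝ) ^ (j + 1) ≤ N := by exact_mod_cast hKN
    have h2 := Mx_cast hN
    have h3 : (1 : ℝ) ≤ N := by exact_mod_cast hN
    linarith
  have hY : (Mx N : ℝ) / (K : ℝ) ^ j = K * X := by rw [hX, pow_succ]; field_simp
  set G := L * X with hG
  have hG1 : 1 ≤ G := by nlinarith
  set g := ⌊G⌋₊ with hg
  have hg1 : 1 ≤ g := Nat.le_floor (by simpa using hG1)
  have hgG : G / 2 ≤ g := by
    have := Nat.lt_floor_add_one G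
    have h1 : (1 : ℝ) ≤ g := by exact_mod_cast hg1
    linarith
  rw [QQ_split N _ (fun κ => ((max κ.1 κ.2 : ℕ) : ℝ) ≤ X)]
  apply add_le_add
  · refine (Q_low N _ 20 X hXp ?_ ?_).trans (by norm_num)
    · intro κ _ h
      rw [if_pos h]
      refine (WW_abs1 hN hK hL s hs x y κ hx).trans (le_of_eq ?_)
      rw [hX]; field_simp
    · intro κ _ h
      rw [if_neg (not_le.mpr h)]
  rw [QQ_split N _ (fun κ => ((max κ.1 κ.2 : ℕ) : ℝ) ≤ G)]
  have hmidabs : ∀ κ, X < ((max κ.1 κ.2 : ℕ) : ℝ) → |WW N K j L s x y κ| ≤ 1 := by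
    intro κ h
    apply WW_abs hL s hs
    intro b
    rw [psi_eq_zero (j := j + 1) (by omega : 0 < K) y h, sub_zero]
    exact abs_psi_le _ _ _ _ _
  apply add_le_add
  · refine (Q_mid N _ 1 X G hXp (by rw [hG]; nlinarith) ?_ ?_ ?_).trans (le_of_eq ?_)
    · intro κ _
      split_ifs with h1 h2
      · simp
      · exact hmidabs κ (not_le.mp h2)
      · simp
    · intro κ _ h
      rw [if_neg (not_le.mpr h)]
    · intro κ _ h
      rw [if_pos h, ite_self]
    · rw [hG, mul_div_assoc, div_self hXp.ne']; ring_nf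
  · set F := Mx N / K ^ j with hF
    have hKj : 0 < K ^ j := by positivity
    have e : ∀ κ, (if ((max κ.1 κ.2 : ℕ) : ℝ) ≤ G then 0 else
        (if ((max κ.1 κ.2 : ℕ) : ℝ) ≤ X then 0 else WW N K j L s x y κ))
        = ∑ b, (s b / L) * hi N g F (x b) κ := by
      intro κ
      by_cases h1 : ((max κ.1 κ.2 : ℕ) : ℝ) ≤ G
      · rw [if_pos h1]
        have : max κ.1 κ.2 ≤ g := Nat.le_floor h1
        unfold hi
        simp [show ¬ (g < max κ.1 κ.2) by omega]
      · rw [if_neg h1]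
        have h2 : ¬ ((max κ.1 κ.2 : ℕ) : ℝ) ≤ X := by
          intro h; apply h1; rw [hG]; nlinarith
        rw [if_neg h2]
        have h3 : g < max κ.1 κ.2 := (Nat.floor_lt (by linarith)).mpr (not_le.mp h1)
        unfold WW
        rw [Finset.sum_div]
        apply Finset.sum_congr rfl
        intro b _
        rw [psi_eq_zero (j := j + 1) (by omega : 0 < K) y (not_le.mp h2), sub_zero]
        unfold hi psi
        rw [hF]
        simp only [h3, true_and, Nat.le_div_iff_mul_le hKj]
        ring
    rw [show (fun κ : ℕ × ℕ => (if ((max κ.1 κ.2 : ℕ) : ℝ) ≤ G then (0 : ℝ) else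
        (if ((max κ.1 κ.2 : ℕ) : ℝ) ≤ X then 0 else WW N K j L s x y κ))) = _ from funext e, QQ_sum]
    have hdiag : ∀ b, BB N (hi N g F (x b)) (hi N g F (x b)) ≤ 8 * (1 + Real.log K) := by
      intro b
      have h0 : BB N (hi N g F (x b)) (hi N g F (x b)) = QQ N (hi N g F (x b)) := by
        unfold BB QQ; exact Finset.sum_congr rfl fun κ _ => by ring
      rw [h0]
      have hGp : 0 < G := by linarith
      refine (Q_mid N _ 1 G (K * X) hGp (by rw [hG]; gcongr) ?_ ?_ ?_).trans ?_
      · intro κ _; unfold hi; split_ifs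
        · exact abs_ss_le _ _ _
        · simp
      · intro κ _ h
        unfold hi
        rw [if_neg]
        rintro ⟨_, h2⟩
        rw [hF, Nat.le_div_iff_mul_le hKj, supp_iff (by omega), hY] at h2
        linarith
      · intro κ _ h
        unfold hi
        rw [if_neg]
        rintro ⟨h2, _⟩
        exact absurd (Nat.le_floor h) (not_le.mpr h2)
      · have : Real.log (K * X / G) ≤ Real.log K := by
          apply Real.log_le_log (by positivity)
          rw [div_le_iff₀ hGp, hG]
          nlinarith [mul_nonneg (by linarith : (0 : ℝ) ≤ K) hXp.le]
        nlinarith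
    have hoff : ∀ b b', b ≠ b' → |BB N (hi N g F (x b)) (hi N g F (x b'))| ≤ 32 := by
      intro b b' hbb
      refine (hi_off hN g F hg1 (x b) (x b') (hxV b) (hxV b') _ (by positivity)
        (hsep b b' hbb)).trans ?_
      calc (8 : ℝ) / g * (Mx N / ((K : ℝ) ^ (j + 1) / (2 * L)))
          ≤ 8 / (G / 2) * (Mx N / ((K : ℝ) ^ (j + 1) / (2 * L))) := by gcongr
        _ = 32 := by rw [hG, hX]; field_simp; norm_num
    have hlogK : 0 ≤ Real.log K := Real.log_nonneg (by linarith)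
    calc ∑ b, ∑ b', s b / L * (s b' / L) * BB N (hi N g F (x b)) (hi N g F (x b'))
        ≤ ∑ b : Fin L, ∑ b' : Fin L, (1 / (L : ℝ) ^ 2) *
            ((if b = b' then 8 * (1 + Real.log K) else 0) + 32) := by
          apply Finset.sum_le_sum; intro b _
          apply Finset.sum_le_sum; intro b' _
          have h1 : |s b / L * (s b' / L)| ≤ 1 / (L : ℝ) ^ 2 := by
            rw [abs_mul, abs_div, abs_div, abs_of_pos (by linarith : (0 : ℝ) < L), div_mul_div_comm,
              ← sq]
            gcongr
            exact mul_le_one₀ (hs b) (abs_nonneg _) (hs b')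
          have h2 : |BB N (hi N g F (x b)) (hi N g F (x b'))| ≤
              (if b = b' then 8 * (1 + Real.log K) else 0) + 32 := by
            by_cases hb : b = b'
            · subst hb
              rw [if_pos rfl, abs_of_nonneg]
              · linarith [hdiag b]
              · unfold BB
                exact Finset.sum_nonneg fun κ _ => mul_nonneg (ww_nonneg _) (mul_self_nonneg _)
            · rw [if_neg hb]; linarith [hoff b b' hb]
          refine (le_abs_self _).trans ?_
          rw [abs_mul]
          exact mul_le_mul h1 h2 (abs_nonneg _) (by positivity)
      _ = _ := by
          simp_rw [← Finset.mul_sum, Finset.sum_add_distrib]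
          simp
          field_simp

/-- Q for displacement at the same level -/
lemma DD_Q {N K : ℕ} (hN : 1 ≤ N) (hK : 4 ≤ K) (j : ℕ) (x y : Z2) (s : ℝ) (hs : |s| ≤ 1)
    (h : (linf x y : ℝ) ≤ 35 * (K : ℝ) ^ j) :
    QQ N (fun κ => s * (psi N K j x κ - psi N K j y κ)) ≤ 313600 := by
  have hM := Mx_pos hN
  have hKr : (4 : ℝ) ≤ K := by exact_mod_cast hK
  refine (Q_low N _ 140 ((Mx N : ℝ) / (K : ℝ) ^ j) (by positivity) ?_ ?_).trans (by norm_num)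
  · intro κ _ _
    rw [abs_mul]
    have := psi_sub_le (K := K) hN j κ x y _ h (by positivity)
    calc _ ≤ 1 * _ := mul_le_mul hs this (abs_nonneg _) zero_le_one
      _ = _ := by field_simp; ring
  · intro κ _ h'
    simp [psi_eq_zero (by omega : 0 < K) _ h']

end HV

open MeasureTheory ProbabilityTheory Real Set Filter

namespace HV

lemma rd_coord (m x : ℤ) (hm : 0 < m) : x - m < m * (x / m) ∧ m * (x / m) ≤ x := by
  have h1 := Int.mul_ediv_self_le (x := x) hm.ne'
  have h2 := Int.lt_mul_ediv_self_add (x := x) hm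
  exact ⟨by linarith, h1⟩

lemma rd_mem {K N j : ℕ} (hK : 4 ≤ K) {x : Z2} (hx : x ∈ VN N) : rd K j x ∈ VN N := by
  have hm : (0 : ℤ) < (K : ℤ) ^ (j - 1) := by positivity
  obtain ⟨h1, h2, h3, h4⟩ := hx
  have a1 := rd_coord _ x.1 hm
  have a2 := rd_coord _ x.2 hm
  refine ⟨?_, lt_of_le_of_lt a1.2 h2, ?_, lt_of_le_of_lt a2.2 h4⟩
  · exact mul_nonneg hm.le (Int.ediv_nonneg h1 hm.le)
  · exact mul_nonneg hm.le (Int.ediv_nonneg h3 hm.le)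

lemma linf_le_iff (x y : Z2) (D : ℤ) : linf x y ≤ D ↔ |x.1 - y.1| ≤ D ∧ |x.2 - y.2| ≤ D := by
  unfold linf; exact max_le_iff

lemma linf_symm (x y : Z2) : linf x y = linf y x := by
  unfold linf; rw [abs_sub_comm, abs_sub_comm x.2]

lemma linf_tri (x y z : Z2) : linf x z ≤ linf x y + linf y z := by
  rw [linf_le_iff]
  have h1 := (linf_le_iff x y _).mp le_rfl
  have h2 := (linf_le_iff y z _).mp le_rfl
  constructor
  · exact (abs_sub_le _ y.1 _).trans (add_le_add h1.1 h2.1)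
  · exact (abs_sub_le _ y.2 _).trans (add_le_add h1.2 h2.2)

lemma linf_rd {K j : ℕ} (hK : 4 ≤ K) (x : Z2) : linf (rd K j x) x ≤ (K : ℤ) ^ (j - 1) := by
  have hm : (0 : ℤ) < (K : ℤ) ^ (j - 1) := by positivity
  have a1 := rd_coord _ x.1 hm
  have a2 := rd_coord _ x.2 hm
  rw [linf_le_iff]
  unfold rd
  constructor <;> rw [abs_le] <;> constructor <;> simp only <;> linarith

lemma pow_pred_le {K j : ℕ} (hK : 4 ≤ K) : (K : ℤ) ^ (j - 1) ≤ (K : ℤ) ^ j :=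
  pow_le_pow_right₀ (by exact_mod_cast (by omega : 1 ≤ K)) (by omega)

/-- the rounded points are close -/
lemma linf_rd_rd {K j : ℕ} (hK : 4 ≤ K) (x x' : Z2) (h : linf x x' ≤ 4 * (K : ℤ) ^ (j + 1)) :
    linf (rd K j x') (rd K (j + 1) x) ≤ 5 * (K : ℤ) ^ (j + 1) := by
  have h1 := linf_rd (j := j) hK x'
  have h2 := linf_rd (j := j + 1) hK x
  have h3 := pow_pred_le (j := j) hK
  rw [Nat.add_sub_cancel] at h2
  have h4 := linf_tri (rd K j x') x' x
  have h5 := linf_tri (rd K j x') x (rd K (j + 1) x)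
  rw [linf_symm] at h
  rw [linf_symm x] at h5
  have : (4 : ℤ) ≤ K := by exact_mod_cast hK
  have h6 : (K : ℤ) ^ (j + 1) = K * (K : ℤ) ^ j := by rw [pow_succ]; ring
  have h7 : (0 : ℤ) < (K : ℤ) ^ j := by positivity
  nlinarith

/-- offsets box -/
noncomputable def box (K : ℕ) : Finset Z2 :=
  Finset.Icc (-(5 * (K : ℤ) ^ 2)) (5 * (K : ℤ) ^ 2) ×ˢ Finset.Icc (-(5 * (K : ℤ) ^ 2)) (5 * (K : ℤ) ^ 2)

/-- shifted point -/
def shift (K j : ℕ) (p o : Z2) : Z2 :=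
  (p.1 + (K : ℤ) ^ (j - 1) * o.1, p.2 + (K : ℤ) ^ (j - 1) * o.2)

lemma exists_off1 {K j : ℕ} (hK : 4 ≤ K) (x x' : ℤ)
    (h : |(K : ℤ) ^ (j - 1) * (x' / (K : ℤ) ^ (j - 1)) - (K : ℤ) ^ j * (x / (K : ℤ) ^ j)|
      ≤ 5 * (K : ℤ) ^ (j + 1)) :
    ∃ o ∈ Finset.Icc (-(5 * (K : ℤ) ^ 2)) (5 * (K : ℤ) ^ 2),
      (K : ℤ) ^ (j - 1) * (x' / (K : ℤ) ^ (j - 1)) =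
        (K : ℤ) ^ j * (x / (K : ℤ) ^ j) + (K : ℤ) ^ (j - 1) * o := by
  have hm : (0 : ℤ) < (K : ℤ) ^ (j - 1) := by positivity
  have hKi : (4 : ℤ) ≤ K := by exact_mod_cast hK
  obtain ⟨e, he⟩ : (K : ℤ) ^ (j - 1) ∣ (K : ℤ) ^ j := pow_dvd_pow _ (by omega)
  have h1 : (K : ℤ) ^ (j + 1) ≤ (K : ℤ) ^ (j - 1) * (K : ℤ) ^ 2 := by
    rw [← pow_add]; exact pow_le_pow_right₀ (by omega) (by omega)
  refine ⟨x' / (K : ℤ) ^ (j - 1) - e * (x / (K : ℤ) ^ j), ?_, ?_⟩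
  · rw [Finset.mem_Icc, ← abs_le]
    have h2 : (K : ℤ) ^ (j - 1) * (x' / (K : ℤ) ^ (j - 1)) - (K : ℤ) ^ j * (x / (K : ℤ) ^ j)
        = (K : ℤ) ^ (j - 1) * (x' / (K : ℤ) ^ (j - 1) - e * (x / (K : ℤ) ^ j)) := by
      generalize x / (K : ℤ) ^ j = y; rw [he]; ring
    rw [h2, abs_mul, abs_of_pos hm] at h
    refine le_of_mul_le_mul_left (h.trans ?_) hm
    linarith
  · generalize x / (K : ℤ) ^ j = y; rw [he]; ring

lemma exists_off {K j : ℕ} (hK : 4 ≤ K) (x x' : Z2) (h : linf x x' ≤ 4 * (K : ℤ) ^ (j + 1)) :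
    ∃ o ∈ box K, rd K j x' = shift K j (rd K (j + 1) x) o := by
  have h1 := linf_rd_rd hK x x' h
  rw [linf_le_iff] at h1
  obtain ⟨o1, ho1, e1⟩ := exists_off1 hK x.1 x'.1 h1.1
  obtain ⟨o2, ho2, e2⟩ := exists_off1 hK x.2 x'.2 h1.2
  exact ⟨(o1, o2), Finset.mem_product.mpr ⟨ho1, ho2⟩, Prod.ext e1 e2⟩

/-- one coordinate of `qpos` -/
lemma qcoord (K : ℕ) (hK : 0 < K) (i : ℕ) (hi : i < K) (a b : ℤ) :
    min a b ≤ a + (i * (b - a)) / (K : ℤ) ∧ a + (i * (b - a)) / (K : ℤ) ≤ max a b := by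
  have hKi : (0 : ℤ) < K := by exact_mod_cast hK
  have hii : (i : ℤ) < K := by exact_mod_cast hi
  have hi0 : (0 : ℤ) ≤ i := by positivity
  rcases le_total a b with h | h
  · rw [min_eq_left h, max_eq_right h]
    have h1 : 0 ≤ (i * (b - a)) / (K : ℤ) := Int.ediv_nonneg (by nlinarith) hKi.le
    have h2 : (i * (b - a)) / (K : ℤ) ≤ b - a := by
      apply Int.ediv_le_of_le_mul hKi; nlinarith
    constructor <;> linarith
  · rw [min_eq_right h, max_eq_left h]
    have h1 : (i * (b - a)) / (K : ℤ) ≤ 0 := by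
      apply Int.ediv_le_of_le_mul hKi; nlinarith
    have h2 : b - a ≤ (i * (b - a)) / (K : ℤ) := by
      rw [Int.le_ediv_iff_mul_le hKi]; nlinarith
    constructor <;> linarith

lemma qpos_mem {K N : ℕ} (hK : 0 < K) (s : Z2 × Z2) (h1 : s.1 ∈ VN N) (h2 : s.2 ∈ VN N) (i : ℕ)
    (hi : i < K) : qpos K s i ∈ VN N := by
  obtain ⟨a1, a2, a3, a4⟩ := h1
  obtain ⟨b1, b2, b3, b4⟩ := h2
  have c1 := qcoord K hK i hi s.1.1 s.2.1
  have c2 := qcoord K hK i hi s.1.2 s.2.2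
  exact ⟨(le_min a1 b1).trans c1.1, lt_of_le_of_lt c1.2 (max_lt a2 b2),
    (le_min a3 b3).trans c2.1, lt_of_le_of_lt c2.2 (max_lt a4 b4)⟩

lemma qpos_linf {K : ℕ} (hK : 0 < K) (s : Z2 × Z2) (i : ℕ)
    (hi : i < K) : linf (qpos K s i) s.1 ≤ linf s.1 s.2 := by
  have h1 := (linf_le_iff s.1 s.2 _).mp le_rfl
  have c1 := qcoord K hK i hi s.1.1 s.2.1
  have c2 := qcoord K hK i hi s.1.2 s.2.2
  have key : ∀ a b c D : ℤ, |a - b| ≤ D → min a b ≤ c → c ≤ max a b → |c - a| ≤ D := by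
    intro a b c D h1 h2 h3
    rw [abs_le] at *
    rcases le_total a b with h | h
    · rw [min_eq_left h] at h2; rw [max_eq_right h] at h3; constructor <;> linarith
    · rw [min_eq_right h] at h2; rw [max_eq_left h] at h3; constructor <;> linarith
  rw [linf_le_iff]
  exact ⟨key _ _ _ _ h1.1 c1.1 c1.2, key _ _ _ _ h1.2 c2.1 c2.2⟩

lemma floor_real (a K : ℤ) (hK : 0 < K) :
    ((a / K : ℤ) : ℝ) ≤ (a : ℝ) / K ∧ (a : ℝ) / K < ((a / K : ℤ) : ℝ) + 1 := by
  have hKr : (0 : ℝ) < K := by exact_mod_cast hK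
  constructor
  · rw [le_div_iff₀ hKr]; exact_mod_cast Int.ediv_mul_le a hK.ne'
  · rw [div_lt_iff₀ hKr]; exact_mod_cast Int.lt_ediv_add_one_mul_self a hK

/-- separation in one coordinate -/
lemma qsep1 (K L q : ℕ) (hKL : K = L * q) (hK : 0 < K) (R : ℝ) (hR : 2 * L ≤ R) (d : ℤ)
    (hd : R ≤ |(d : ℝ)|) (c b b' : ℕ) (hb : b ≠ b') :
    R / (2 * L) ≤ |((((c + b * q : ℕ) : ℤ) * d / (K : ℤ) : ℤ) : ℝ)
      - ((((c + b' * q : ℕ) : ℤ) * d / (K : ℤ) : ℤ) : ℝ)| := by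
  have hKi : (0 : ℤ) < K := by exact_mod_cast hK
  have hL : 0 < L := by
    rcases Nat.eq_zero_or_pos L with h | h
    · subst h; simp at hKL; omega
    · exact h
  have hq : 0 < q := by
    rcases Nat.eq_zero_or_pos q with h | h
    · subst h; simp at hKL; omega
    · exact h
  have hLr : (0 : ℝ) < L := by exact_mod_cast hL
  have hqr : (0 : ℝ) < q := by exact_mod_cast hq
  obtain ⟨f1, f2⟩ := floor_real (((c + b * q : ℕ) : ℤ) * d) K hKi
  obtain ⟨f3, f4⟩ := floor_real (((c + b' * q : ℕ) : ℤ) * d) K hKi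
  set F : ℝ := ((((c + b * q : ℕ) : ℤ) * d / (K : ℤ) : ℤ) : ℝ)
  set F' : ℝ := ((((c + b' * q : ℕ) : ℤ) * d / (K : ℤ) : ℤ) : ℝ)
  have hKr : (K : ℝ) = L * q := by exact_mod_cast hKL
  push_cast at f1 f2 f3 f4
  have e : ((c : ℝ) + b * q) * d / K - ((c : ℝ) + b' * q) * d / K = ((b : ℝ) - b') * d / L := by
    rw [hKr]; field_simp; ring
  have h1 : (1 : ℝ) ≤ |(b : ℝ) - b'| := by
    have : (1 : ℤ) ≤ |(b : ℤ) - b'| := Int.one_le_abs (by omega)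
    exact_mod_cast this
  have h2 : R / L ≤ |((b : ℝ) - b') * d / L| := by
    rw [abs_div, abs_mul, abs_of_pos hLr]
    gcongr
    nlinarith [abs_nonneg (d : ℝ)]
  have h3 : |((b : ℝ) - b') * d / L| ≤ |F - F'| + 1 := by
    rw [← e]
    have e1 : ((c : ℝ) + b * q) * d / K - ((c : ℝ) + b' * q) * d / K
      = (F - F') + ((((c : ℝ) + b * q) * d / K - F) - (((c : ℝ) + b' * q) * d / K - F')) := by ring
    rw [e1]
    refine (abs_add_le _ _).trans ?_
    gcongr
    rw [abs_le]; constructor <;> linarith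
  have h4 : 1 ≤ R / (2 * L) := by rw [le_div_iff₀ (by positivity)]; linarith
  have h5 : R / L = 2 * (R / (2 * L)) := by field_simp
  linarith

lemma qsep (K L q : ℕ) (hKL : K = L * q) (hK : 0 < K) (R : ℝ) (hR : 2 * L ≤ R) (s : Z2 × Z2)
    (hd : R ≤ linf s.1 s.2) (c b b' : ℕ) (hb : b ≠ b') :
    R / (2 * L) ≤ linf (qpos K s (c + b * q)) (qpos K s (c + b' * q)) := by
  unfold linf at *
  push_cast at hd ⊢
  rw [abs_sub_comm, abs_sub_comm (s.1.2 : ℝ)] at hd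
  rcases le_max_iff.mp hd with h | h
  · refine le_trans ?_ (le_max_left _ _)
    have := qsep1 K L q hKL hK R hR (s.2.1 - s.1.1) (by push_cast; exact h) c b b' hb
    unfold qpos
    refine this.trans (le_of_eq ?_)
    congr 1
    push_cast
    ring
  · refine le_trans ?_ (le_max_right _ _)
    have := qsep1 K L q hKL hK R hR (s.2.2 - s.1.2) (by push_cast; exact h) c b b' hb
    unfold qpos
    refine this.trans (le_of_eq ?_)
    congr 1
    push_cast
    ring

lemma norm_le_linf (x y : Z2) : ‖toC x - toC y‖ ^ 2 ≤ 2 * (linf x y : ℝ) ^ 2 := by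
  have h : (‖toC x - toC y‖) ^ 2 = ((x.1 : ℝ) - y.1) ^ 2 + ((x.2 : ℝ) - y.2) ^ 2 := by
    rw [← Complex.normSq_eq_norm_sq, Complex.normSq_apply]; simp [toC]; ring
  have h1 : |(x.1 : ℝ) - y.1| ≤ linf x y := by unfold linf; push_cast; exact le_max_left _ _
  have h2 : |(x.2 : ℝ) - y.2| ≤ linf x y := by unfold linf; push_cast; exact le_max_right _ _
  rw [h]
  have := sq_le_sq' (by linarith [neg_abs_le ((x.1 : ℝ) - y.1)]) ((le_abs_self _).trans h1)
  have := sq_le_sq' (by linarith [neg_abs_le ((x.2 : ℝ) - y.2)]) ((le_abs_self _).trans h2)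
  linarith

/-- good pairs of rounded points are far -/
lemma good_far {K j : ℕ} (hK : 16 ≤ K) (x y : Z2) (h : 2 * (K : ℝ) ^ (j + 1) ≤ ‖toC y - toC x‖) :
    (K : ℝ) ^ (j + 1) ≤ linf (rd K (j + 1) x) (rd K (j + 1) y) := by
  have hKr : (16 : ℝ) ≤ K := by exact_mod_cast hK
  have h1 := norm_le_linf y x
  have h2 := linf_rd (j := j + 1) (by omega : 4 ≤ K) x
  have h3 := linf_rd (j := j + 1) (by omega : 4 ≤ K) y
  rw [Nat.add_sub_cancel] at h2 h3
  have h4 := linf_tri y (rd K (j + 1) y) x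
  have h5 := linf_tri (rd K (j + 1) y) (rd K (j + 1) x) x
  rw [linf_symm y (rd K (j + 1) y)] at h4
  rw [linf_symm (rd K (j + 1) y) (rd K (j + 1) x)] at h5
  have h6 : linf y x ≤ linf (rd K (j + 1) x) (rd K (j + 1) y) + 2 * (K : ℤ) ^ j := by linarith
  have h6' : (linf y x : ℝ) ≤ linf (rd K (j + 1) x) (rd K (j + 1) y) + 2 * (K : ℝ) ^ j := by
    exact_mod_cast h6
  have h7 : (K : ℝ) ^ (j + 1) = K * (K : ℝ) ^ j := by rw [pow_succ]; ring
  have h8 : (0 : ℝ) < (K : ℝ) ^ j := by positivity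
  have h9 : 8 * (2 * (K : ℝ) ^ j) ≤ (K : ℝ) ^ (j + 1) := by rw [h7]; nlinarith
  have h10 : (0 : ℝ) ≤ linf y x := by
    have : 0 ≤ linf y x := by unfold linf; exact le_max_of_le_left (abs_nonneg _)
    exact_mod_cast this
  by_contra hc
  push Not at hc
  have h11 : (linf y x : ℝ) < 9 / 8 * (K : ℝ) ^ (j + 1) := by linarith
  have h12 : (0 : ℝ) < (K : ℝ) ^ (j + 1) := by positivity
  nlinarith

lemma good_close {K j : ℕ} (hK : 16 ≤ K) (x y : Z2) (h : ‖toC y - toC x‖ ≤ 4 * (K : ℝ) ^ (j + 1)) :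
    linf (rd K (j + 1) x) (rd K (j + 1) y) ≤ 5 * (K : ℤ) ^ (j + 1) := by
  have h1 := (linf_le_norm y x).trans h
  have h1' : linf y x ≤ 4 * (K : ℤ) ^ (j + 1) := by exact_mod_cast h1
  have h2 := linf_rd (j := j + 1) (by omega : 4 ≤ K) x
  have h3 := linf_rd (j := j + 1) (by omega : 4 ≤ K) y
  rw [Nat.add_sub_cancel] at h2 h3
  have h4 := linf_tri (rd K (j + 1) x) x (rd K (j + 1) y)
  have h5 := linf_tri x y (rd K (j + 1) y)
  rw [linf_symm y (rd K (j + 1) y)] at h5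
  rw [linf_symm] at h1'
  have h7 : (K : ℤ) ^ (j + 1) = K * (K : ℤ) ^ j := by rw [pow_succ]; ring
  have h8 : (0 : ℤ) < (K : ℤ) ^ j := by positivity
  have hKi : (16 : ℤ) ≤ K := by exact_mod_cast hK
  nlinarith

lemma tube1 {K j : ℕ} (hK : 16 ≤ K) (i : ℕ) (hi : i < K) (x y x' : ℤ)
    (h : |(x' : ℝ) - (x + (i / K : ℝ) * (y - x))| ≤ 30 * (K : ℝ) ^ j) :
    |(K : ℤ) ^ (j - 1) * (x' / (K : ℤ) ^ (j - 1)) - ((K : ℤ) ^ j * (x / (K : ℤ) ^ j) +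
      (i * ((K : ℤ) ^ j * (y / (K : ℤ) ^ j) - (K : ℤ) ^ j * (x / (K : ℤ) ^ j))) / (K : ℤ))|
      ≤ 35 * (K : ℤ) ^ j := by
  have hm : (0 : ℤ) < (K : ℤ) ^ (j - 1) := by positivity
  have hm' : (0 : ℤ) < (K : ℤ) ^ j := by positivity
  have hKi : (0 : ℤ) < K := by exact_mod_cast (by omega : 0 < K)
  have hKr : (16 : ℝ) ≤ K := by exact_mod_cast hK
  have a1 := rd_coord _ x' hm
  have a2 := rd_coord _ x hm'
  have a3 := rd_coord _ y hm'
  have a4 := pow_pred_le (j := j) (by omega : 4 ≤ K)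
  set X' := (K : ℤ) ^ (j - 1) * (x' / (K : ℤ) ^ (j - 1))
  set X := (K : ℤ) ^ j * (x / (K : ℤ) ^ j)
  set Y := (K : ℤ) ^ j * (y / (K : ℤ) ^ j)
  have a5 := floor_real (i * (Y - X)) K hKi
  set F := (i * (Y - X)) / (K : ℤ)
  have hm1 : (1 : ℝ) ≤ (K : ℝ) ^ j := one_le_pow₀ (by linarith)
  have b1 : (x' : ℝ) - (K : ℝ) ^ j ≤ X' := by exact_mod_cast (by linarith : x' - (K : ℤ) ^ j ≤ X')
  have b2 : (X' : ℝ) ≤ x' := by exact_mod_cast a1.2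
  have b3 : (x : ℝ) - (K : ℝ) ^ j ≤ X := by exact_mod_cast a2.1.le
  have b4 : (X : ℝ) ≤ x := by exact_mod_cast a2.2
  have b5 : (y : ℝ) - (K : ℝ) ^ j ≤ Y := by exact_mod_cast a3.1.le
  have b6 : (Y : ℝ) ≤ y := by exact_mod_cast a3.2
  push_cast at a5
  obtain ⟨c1, c2⟩ := a5
  set t : ℝ := (i : ℝ) / K with ht
  have t0 : 0 ≤ t := by positivity
  have t1 : t ≤ 1 := by
    rw [ht, div_le_one (by linarith)]; exact_mod_cast hi.le
  have e : (i : ℝ) * ((Y : ℝ) - X) / K = t * (Y - X) := by rw [ht]; ring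
  rw [e] at c1 c2
  have key : |(X' : ℝ) - (X + F)| ≤ 35 * (K : ℝ) ^ j := by
    rw [abs_le] at h ⊢
    have d1 : t * Y ≤ t * y := by gcongr
    have d2 : t * (y - (K : ℝ) ^ j) ≤ t * Y := by gcongr
    have d3 : (1 - t) * X ≤ (1 - t) * x := mul_le_mul_of_nonneg_left b4 (by linarith)
    have d4 : (1 - t) * (x - (K : ℝ) ^ j) ≤ (1 - t) * X :=
      mul_le_mul_of_nonneg_left b3 (by linarith)
    constructor <;> nlinarith
  exact_mod_cast key

lemma tube_q {K j : ℕ} (hK : 16 ≤ K) (i : ℕ) (hi : i < K) (x y x' : Z2)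
    (h : ‖toC x' - (toC x + ((i / K : ℝ) : ℂ) * (toC y - toC x))‖ ≤ 30 * (K : ℝ) ^ j) :
    linf (rd K j x') (qpos K (rd K (j + 1) x, rd K (j + 1) y) i) ≤ 35 * (K : ℤ) ^ j := by
  have h1 := (Complex.abs_re_le_norm _).trans h
  have h2 := (Complex.abs_im_le_norm _).trans h
  rw [Complex.sub_re, Complex.add_re, Complex.re_ofReal_mul] at h1
  rw [Complex.sub_im, Complex.add_im, Complex.im_ofReal_mul] at h2
  rw [linf_le_iff]
  constructor
  · exact tube1 hK i hi x.1 y.1 x'.1 (by simpa [toC] using h1)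
  · exact tube1 hK i hi x.2 y.2 x'.2 (by simpa [toC] using h2)

end HV

open MeasureTheory ProbabilityTheory Real Set Filter

namespace HV

/-- sign -/
def sg (b : Bool) : ℝ := if b then 1 else -1

lemma abs_sg (b : Bool) : |sg b| = 1 := by cases b <;> simp [sg]

lemma exists_sg (a : ℝ) : ∃ b, sg b * a = |a| := by
  rcases le_total 0 a with h | h
  · exact ⟨true, by simp [sg, abs_of_nonneg h]⟩
  · exact ⟨false, by simp [sg, abs_of_nonpos h]⟩

/-- steps of a chain -/
abbrev St (L : ℕ) := (Bool × Bool) × (Z2 × Z2) × (ℕ × ℕ) × (Fin L → Bool)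

/-- the finite set of steps -/
noncomputable def steps (K L : ℕ) : Finset (St L) :=
  Finset.univ ×ˢ ((box K ×ˢ box K) ×ˢ ((Finset.range K ×ˢ Finset.range K) ×ˢ Finset.univ))

lemma steps_card (K L : ℕ) (hK : 16 ≤ K) (hL : 2 ^ L ≤ K) : (steps K L).card ≤ K ^ 16 := by
  have hb : (box K).card ≤ K ^ 6 := by
    unfold box
    rw [Finset.card_product, Int.card_Icc]
    have e : (5 * (K : ℤ) ^ 2 + 1 - -(5 * (K : ℤ) ^ 2)).toNat = 10 * K ^ 2 + 1 := by
      have : (5 * (K : ℤ) ^ 2 + 1 - -(5 * (K : ℤ) ^ 2)) = ((10 * K ^ 2 + 1 : ℕ) : ℤ) := by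
        push_cast; ring
      rw [this, Int.toNat_natCast]
    rw [e]
    have h1 : 10 * K ^ 2 + 1 ≤ K ^ 3 := by nlinarith [Nat.pos_of_ne_zero (by positivity : K ^ 2 ≠ 0)]
    calc _ ≤ K ^ 3 * K ^ 3 := Nat.mul_le_mul h1 h1
      _ = _ := by ring
  unfold steps
  simp only [Finset.card_product, Finset.card_range, Finset.card_univ, Fintype.card_prod,
    Fintype.card_bool, Fintype.card_fun, Fintype.card_fin]
  calc 2 * 2 * ((box K).card * (box K).card * (K * K * 2 ^ L))
      ≤ K * (K ^ 6 * K ^ 6 * (K * K * K)) := by gcongr; omega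
    _ = _ := by ring

/-- child -/
def child (K j : ℕ) {L : ℕ} (s : Z2 × Z2) (σ : St L) : Z2 × Z2 :=
  (shift K j s.1 σ.2.1.1, shift K j s.1 σ.2.1.2)

/-- validity of good steps -/
def GV (N K q j : ℕ) {L : ℕ} (s : Z2 × Z2) (σ : St L) : Prop :=
  s.1 ∈ VN N ∧ s.2 ∈ VN N ∧ (K : ℝ) ^ (j + 1) ≤ linf s.1 s.2 ∧
    linf s.1 s.2 ≤ 5 * (K : ℤ) ^ (j + 1) ∧ σ.2.2.1.1 < q ∧ σ.2.2.1.2 < K ∧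
    linf (child K j s σ).1 (qpos K s σ.2.2.1.2) ≤ 35 * (K : ℤ) ^ j

open Classical in
/-- increment of the coefficient vector -/
noncomputable def inc (N K q j : ℕ) {L : ℕ} (s : Z2 × Z2) (σ : St L) (κ : ℕ × ℕ) : ℝ :=
  if σ.1.1 = true then
    (if GV N K q j s σ then
      WW N K j L (fun b => sg (σ.2.2.2 b)) (fun b => qpos K s (σ.2.2.1.1 + b * q)) s.1 κ +
        sg σ.1.2 * (psi N K j (child K j s σ).1 κ - psi N K j (qpos K s σ.2.2.1.2) κ)
    else 0)
  else
    (if linf (child K j s σ).1 s.1 ≤ 5 * (K : ℤ) ^ (j + 1) then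
      WW N K j 1 (fun _ => sg σ.1.2) (fun _ => (child K j s σ).1) s.1 κ
    else 0)

/-- penalty count -/
def pk {L : ℕ} (σ : St L) : ℕ := if σ.1.1 = true then 0 else 1

open Classical in
/-- coefficient sets -/
noncomputable def CS (N K L q : ℕ) : ℕ → Z2 × Z2 → Finset ((ℕ × ℕ → ℝ) × ℕ)
  | 0, _ => {(fun _ => 0, 0)}
  | j + 1, s => (steps K L).biUnion fun σ =>
      (CS N K L q j (child K j s σ)).image
        fun p => (fun κ => inc N K q j s σ κ + p.1 κ, p.2 + pk σ)

lemma mem_CS_succ {N K L q j : ℕ} {s : Z2 × Z2} {p : (ℕ × ℕ → ℝ) × ℕ} :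
    p ∈ CS N K L q (j + 1) s ↔ ∃ σ ∈ steps K L, ∃ p' ∈ CS N K L q j (child K j s σ),
      (fun κ => inc N K q j s σ κ + p'.1 κ, p'.2 + pk σ) = p := by
  rw [CS]; simp only [Finset.mem_biUnion, Finset.mem_image]

lemma steps_nonempty (K L : ℕ) (hK : 0 < K) : (steps K L).Nonempty := by
  refine ⟨((true, true), (0, 0), (0, 0), fun _ => true), ?_⟩
  have h0 : (0 : Z2) ∈ box K := by
    unfold box; simp only [Finset.mem_product, Finset.mem_Icc, Prod.fst_zero, Prod.snd_zero]
    have : (0 : ℤ) ≤ 5 * (K : ℤ) ^ 2 := by positivity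
    refine ⟨⟨?_, ?_⟩, ?_, ?_⟩ <;> linarith
  unfold steps
  simp [h0, hK]

lemma CS_nonempty (N K L q : ℕ) (hK : 0 < K) : ∀ j s, (CS N K L q j s).Nonempty := by
  intro j
  induction j with
  | zero => intro s; exact ⟨_, by rw [CS]; exact Finset.mem_singleton_self _⟩
  | succ j ih =>
    intro s
    obtain ⟨σ, hσ⟩ := steps_nonempty K L hK
    obtain ⟨p, hp⟩ := ih (child K j s σ)
    exact ⟨_, mem_CS_succ.mpr ⟨σ, hσ, p, hp, rfl⟩⟩

lemma CS_card (N K L q : ℕ) (hK : 16 ≤ K) (hL : 2 ^ L ≤ K) :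
    ∀ j s, (CS N K L q j s).card ≤ (K ^ 16) ^ j := by
  intro j
  induction j with
  | zero => intro s; rw [CS]; simp
  | succ j ih =>
    intro s
    classical
    rw [CS]
    refine Finset.card_biUnion_le.trans ?_
    calc _ ≤ ∑ _σ ∈ steps K L, (K ^ 16) ^ j :=
          Finset.sum_le_sum fun σ _ => Finset.card_image_le.trans (ih _)
      _ = (steps K L).card * (K ^ 16) ^ j := by simp
      _ ≤ K ^ 16 * (K ^ 16) ^ j := Nat.mul_le_mul_right _ (steps_card K L hK hL)
      _ = _ := by rw [pow_succ (K ^ 16)]; ring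

/-- pairing -/
noncomputable def ip (N : ℕ) (C b : ℕ × ℕ → ℝ) : ℝ := ∑ κ ∈ modes N, C κ * b κ

/-- truncated field -/
noncomputable def AF (N K : ℕ) (b : ℕ × ℕ → ℝ) (j : ℕ) (x : Z2) : ℝ := ip N (psi N K j x) b

/-- value of a chain -/
noncomputable def cval (N : ℕ) (pen : ℝ) (b : ℕ × ℕ → ℝ) (p : (ℕ × ℕ → ℝ) × ℕ) : ℝ :=
  ip N p.1 b - pen * p.2

open Classical in
/-- the max over chains -/
noncomputable def UF (N K L q : ℕ) (pen : ℝ) (b : ℕ × ℕ → ℝ) (j : ℕ) (s : Z2 × Z2) : ℝ :=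
  if hK : 0 < K then
    (CS N K L q j s).sup' (CS_nonempty N K L q hK j s) (cval N pen b)
  else 0

lemma ip_add (N : ℕ) (C D b : ℕ × ℕ → ℝ) : ip N (fun κ => C κ + D κ) b = ip N C b + ip N D b := by
  unfold ip; rw [← Finset.sum_add_distrib]; exact Finset.sum_congr rfl fun _ _ => by ring

lemma ip_sub (N : ℕ) (C D b : ℕ × ℕ → ℝ) : ip N (fun κ => C κ - D κ) b = ip N C b - ip N D b := by
  unfold ip; rw [← Finset.sum_sub_distrib]; exact Finset.sum_congr rfl fun _ _ => by ring

lemma ip_smul (N : ℕ) (c : ℝ) (C b : ℕ × ℕ → ℝ) : ip N (fun κ => c * C κ) b = c * ip N C b := by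
  unfold ip; rw [Finset.mul_sum]; exact Finset.sum_congr rfl fun _ _ => by ring

lemma ip_WW (N K j L : ℕ) (s : Fin L → ℝ) (x : Fin L → Z2) (y : Z2) (b : ℕ × ℕ → ℝ) :
    ip N (WW N K j L s x y) b = (∑ i, s i * (AF N K b j (x i) - AF N K b (j + 1) y)) / L := by
  unfold AF
  simp_rw [← ip_sub, ← ip_smul]
  unfold ip WW
  rw [Finset.sum_comm, Finset.sum_div]
  apply Finset.sum_congr rfl; intro κ _
  rw [← Finset.sum_mul]
  ring

lemma UF_step {N K L q : ℕ} (hK : 0 < K) (pen : ℝ) (b : ℕ × ℕ → ℝ) (j : ℕ) (s : Z2 × Z2)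
    (σ : St L) (hσ : σ ∈ steps K L) :
    ip N (inc N K q j s σ) b - pen * pk σ + UF N K L q pen b j (child K j s σ)
      ≤ UF N K L q pen b (j + 1) s := by
  unfold UF
  rw [dif_pos hK, dif_pos hK]
  obtain ⟨p, hp, e⟩ := Finset.exists_mem_eq_sup' (CS_nonempty N K L q hK j (child K j s σ))
    (cval N pen b)
  rw [e]
  have hm : (fun κ => inc N K q j s σ κ + p.1 κ, p.2 + pk σ) ∈ CS N K L q (j + 1) s :=
    mem_CS_succ.mpr ⟨σ, hσ, p, hp, rfl⟩
  refine le_trans (le_of_eq ?_) (Finset.le_sup' (cval N pen b) hm)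
  unfold cval
  simp only
  rw [ip_add]; push_cast; ring

lemma UF_zero {N K L q : ℕ} (pen : ℝ) (b : ℕ × ℕ → ℝ) (s : Z2 × Z2) :
    0 ≤ UF N K L q pen b 0 s := by
  unfold UF
  split_ifs with h
  · have hm : ((fun _ => 0, 0) : (ℕ × ℕ → ℝ) × ℕ) ∈ CS N K L q 0 s := by
      rw [CS]; exact Finset.mem_singleton_self _
    refine le_trans (le_of_eq ?_) (Finset.le_sup' (cval N pen b) hm)
    simp [ip, cval]
  · exact le_rfl

lemma UF_gt {N K L q : ℕ} (hK : 0 < K) (pen : ℝ) (b : ℕ × ℕ → ℝ) (j : ℕ) (s : Z2 × Z2) (T : ℝ)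
    (h : T < UF N K L q pen b j s) : ∃ p ∈ CS N K L q j s, T < ip N p.1 b - pen * p.2 := by
  unfold UF at h
  rw [dif_pos hK] at h
  exact (Finset.lt_sup'_iff _).mp h

lemma mem_steps {K L : ℕ} (σ : St L) (h1 : σ.2.1.1 ∈ box K) (h2 : σ.2.1.2 ∈ box K)
    (h3 : σ.2.2.1.1 < K) (h4 : σ.2.2.1.2 < K) : σ ∈ steps K L := by
  unfold steps
  simp [h1, h2, h3, h4]

lemma hbad_UF {N K L q : ℕ} (hK : 16 ≤ K) (pen : ℝ) (b : ℕ × ℕ → ℝ) :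
    HBad K N (AF N K b) (UF N K L q pen b) pen := by
  intro j x hx y hy x' hx' y' hy' h1 h2
  obtain ⟨o, ho, e⟩ := exists_off (by omega : 4 ≤ K) x x' h1
  obtain ⟨o2, ho2, e2⟩ := exists_off (by omega : 4 ≤ K) x y' h2
  obtain ⟨sb, hsb⟩ := exists_sg (AF N K b j (rd K j x') - AF N K b (j + 1) (rd K (j + 1) x))
  let σ : St L := ((false, sb), (o, o2), (0, 0), fun _ => true)
  have hσ : σ ∈ steps K L := mem_steps σ ho ho2 (by simp [σ]; omega) (by simp [σ]; omega)
  have h := UF_step (N := N) (q := q) (by omega : 0 < K) pen b j (rd K (j + 1) x, rd K (j + 1) y) σ hσ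
  have hc : child K j (rd K (j + 1) x, rd K (j + 1) y) σ = (rd K j x', rd K j y') := by
    rw [e, e2]; rfl
  rw [hc] at h
  have hi : inc N K q j (rd K (j + 1) x, rd K (j + 1) y) σ
      = WW N K j 1 (fun _ => sg sb) (fun _ => rd K j x') (rd K (j + 1) x) := by
    funext κ
    unfold inc
    rw [if_neg (by simp [σ]), hc, if_pos]
    exact linf_rd_rd (by omega) x x' h1
  rw [hi, ip_WW] at h
  have hp : pk σ = 1 := by simp [pk, σ]
  rw [hp] at h
  simp only [Finset.univ_unique, Finset.sum_const, Finset.card_singleton, one_smul, Nat.cast_one,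
    div_one, mul_one] at h
  rw [hsb] at h
  exact h

lemma hgood_UF {N K L q : ℕ} (hK : 16 ≤ K) (hKL : K = L * q) (pen : ℝ) (b : ℕ × ℕ → ℝ) :
    HGood K L q N (AF N K b) (UF N K L q pen b) := by
  intro j x hx y hy x' hx' y' hy' g1 g2 h1 h2 c hc i hi ht
  obtain ⟨o, ho, e⟩ := exists_off (by omega : 4 ≤ K) x x' h1
  obtain ⟨o2, ho2, e2⟩ := exists_off (by omega : 4 ≤ K) x y' h2
  set s := (rd K (j + 1) x, rd K (j + 1) y) with hs
  obtain ⟨sb, hsb⟩ := exists_sg (AF N K b j (rd K j x') - AF N K b j (qpos K s i))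
  choose sv hsv using fun d : Fin L =>
    exists_sg (AF N K b j (qpos K s (c + d * q)) - AF N K b (j + 1) (rd K (j + 1) x))
  let σ : St L := ((true, sb), (o, o2), (c, i), sv)
  have hLp : 0 < L := by
    rcases Nat.eq_zero_or_pos L with h | h
    · subst h; simp at hKL; omega
    · exact h
  have hqK : q ≤ K := by rw [hKL]; exact Nat.le_mul_of_pos_left q hLp
  have hσ : σ ∈ steps K L := mem_steps σ ho ho2 (by simp only [σ]; omega) hi
  have h := UF_step (N := N) (q := q) (by omega : 0 < K) pen b j s σ hσ
  have hch : child K j s σ = (rd K j x', rd K j y') := by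
    rw [e, e2]; rfl
  have hGV : GV N K q j s σ := by
    refine ⟨rd_mem (by omega) hx, rd_mem (by omega) hy, good_far hK x y g1, good_close hK x y g2,
      hc, hi, ?_⟩
    rw [hch]
    exact tube_q hK i hi x y x' ht
  have hinc : inc N K q j s σ = fun κ =>
      WW N K j L (fun d => sg (sv d)) (fun d => qpos K s (c + d * q)) s.1 κ +
        sg sb * (psi N K j (rd K j x') κ - psi N K j (qpos K s i) κ) := by
    funext κ
    unfold inc
    rw [if_pos (by simp [σ]), if_pos hGV, hch]
  rw [hch, hinc, ip_add, ip_WW, ip_smul, ip_sub] at h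
  have hp : pk σ = 0 := by simp [pk, σ]
  rw [hp] at h
  change (∑ d : Fin L, sg (sv d) * (AF N K b j (qpos K s (c + d * q)) -
    AF N K b (j + 1) (rd K (j + 1) x))) / L + sg sb * (AF N K b j (rd K j x') -
    AF N K b j (qpos K s i)) - pen * ((0 : ℕ) : ℝ) + _ ≤ _ at h
  rw [hsb, Finset.sum_congr rfl (fun d _ => hsv d)] at h
  rw [Finset.sum_range]
  simpa using h

/-- variance per good step -/
noncomputable def vv (K L : ℕ) : ℝ := 647760 + 16 * Real.log L + 16 / L * (1 + Real.log K)

/-- variance per bad step -/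
noncomputable def wv (K : ℕ) : ℝ := 20000 + 32 * (1 + Real.log K)

lemma inc_zero {N K L q j : ℕ} {s : Z2 × Z2} {σ : St L}
    (h : ¬ ((σ.1.1 = true → GV N K q j s σ) ∧
      (σ.1.1 ≠ true → linf (child K j s σ).1 s.1 ≤ 5 * (K : ℤ) ^ (j + 1)))) (κ : ℕ × ℕ) :
    inc N K q j s σ κ = 0 := by
  unfold inc
  split_ifs with h1 h2 h2
  · exact absurd ⟨fun _ => h2, fun h => absurd h1 h⟩ h
  · rfl
  · exact absurd ⟨fun h => absurd h h1, fun _ => h2⟩ h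
  · rfl

lemma two_vals (a b : ℝ) (ha : |a| ≤ 1) (hb : |b| ≤ 1) : |a - b| ≤ 2 := by
  rw [abs_le] at *; constructor <;> linarith

lemma inc_bounds {N K L q j : ℕ} (hN : 1 ≤ N) (hK : 16 ≤ K) (hKL : K = L * q) (hq : 2 ≤ q)
    (hKN : K ^ (j + 1) ≤ N) (s : Z2 × Z2) (σ : St L) :
    (∀ κ, |inc N K q j s σ κ| ≤ 4) ∧
    (∀ κ, |inc N K q j s σ κ| ≤ 30 * (κ.1 + κ.2) * (K : ℝ) ^ (j + 1) / Mx N) ∧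
    (∀ κ : ℕ × ℕ, (Mx N : ℝ) / (K : ℝ) ^ j < (max κ.1 κ.2 : ℕ) → inc N K q j s σ κ = 0) ∧
    QQ N (inc N K q j s σ) + 7680 ≤ vv K L + pk σ * wv K := by
  have hM := Mx_pos hN
  have hKr : (16 : ℝ) ≤ K := by exact_mod_cast hK
  have hLp : 0 < L := by
    rcases Nat.eq_zero_or_pos L with h | h
    · subst h; simp at hKL; omega
    · exact h
  have hLr : (1 : ℝ) ≤ L := by exact_mod_cast hLp
  have hlogK : 0 ≤ Real.log K := Real.log_nonneg (by linarith)
  have hlogL : 0 ≤ Real.log L := Real.log_nonneg hLr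
  have hvv : 647760 ≤ vv K L := by
    unfold vv
    have : 0 ≤ 16 / (L : ℝ) * (1 + Real.log K) := by positivity
    linarith
  have hwv : 20000 ≤ wv K := by unfold wv; linarith
  by_cases hv : ((σ.1.1 = true → GV N K q j s σ) ∧
      (σ.1.1 ≠ true → linf (child K j s σ).1 s.1 ≤ 5 * (K : ℤ) ^ (j + 1)))
  swap
  · have h0 := inc_zero hv
    refine ⟨fun κ => by rw [h0]; norm_num, fun κ => by rw [h0, abs_zero]; positivity,
      fun κ _ => h0 κ, ?_⟩
    have : QQ N (inc N K q j s σ) = 0 := by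
      unfold QQ; exact Finset.sum_eq_zero fun κ _ => by rw [h0]; ring
    rw [this]
    have : 0 ≤ (pk σ : ℝ) * wv K := by positivity
    linarith
  by_cases hσ : σ.1.1 = true
  · obtain ⟨v1, v2, v3, v4, v5, v6, v7⟩ := hv.1 hσ
    have hi : inc N K q j s σ = fun κ =>
        WW N K j L (fun b => sg (σ.2.2.2 b)) (fun b => qpos K s (σ.2.2.1.1 + b * q)) s.1 κ +
        sg σ.1.2 * (psi N K j (child K j s σ).1 κ - psi N K j (qpos K s σ.2.2.1.2) κ) := by
      funext κ; unfold inc; rw [if_pos hσ, if_pos (hv.1 hσ)]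
    have hlt : ∀ b : Fin L, σ.2.2.1.1 + b * q < K := by
      intro b
      have : (b : ℕ) + 1 ≤ L := b.2
      have := Nat.mul_le_mul_right q this
      rw [hKL]; rw [add_mul] at this; omega
    have hs : ∀ b : Fin L, |sg (σ.2.2.2 b)| ≤ 1 := fun b => (abs_sg _).le
    have hlin : ∀ b : Fin L, (linf (qpos K s (σ.2.2.1.1 + b * q)) s.1 : ℝ) ≤ 5 * (K : ℝ) ^ (j + 1) := by
      intro b
      have := (qpos_linf (by omega : 0 < K) s _ (hlt b)).trans v4
      exact_mod_cast this
    have v7' : (linf (child K j s σ).1 (qpos K s σ.2.2.1.2) : ℝ) ≤ 35 * (K : ℝ) ^ j := by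
      exact_mod_cast v7
    have w1 := fun κ => WW_abs1 hN (by omega) hLp _ hs _ s.1 κ hlin
    have w2 := fun κ => WW_abs2 (N := N) (K := K) (j := j) hLp _ hs
      (fun b : Fin L => qpos K s (σ.2.2.1.1 + b * q)) s.1 κ
    have d2 : ∀ κ, |sg σ.1.2 * (psi N K j (child K j s σ).1 κ - psi N K j (qpos K s σ.2.2.1.2) κ)| ≤ 2 := by
      intro κ; rw [abs_mul, abs_sg, one_mul]
      exact two_vals _ _ (abs_psi_le _ _ _ _ _) (abs_psi_le _ _ _ _ _)
    have d1 : ∀ κ, |sg σ.1.2 * (psi N K j (child K j s σ).1 κ - psi N K j (qpos K s σ.2.2.1.2) κ)|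
        ≤ 10 * (κ.1 + κ.2) * (K : ℝ) ^ (j + 1) / Mx N := by
      intro κ; rw [abs_mul, abs_sg, one_mul]
      refine (psi_sub_le hN j κ _ _ _ v7' (by positivity)).trans ?_
      rw [pow_succ]
      apply div_le_div_of_nonneg_right _ hM.le
      have : 0 ≤ ((κ.1 : ℝ) + κ.2) * (K : ℝ) ^ j := by positivity
      nlinarith
    have wQ := WW_Q hN (by omega) hLp (by rw [hKL]; exact Nat.le_mul_of_pos_right L (by omega)) _ hs
      (fun b : Fin L => qpos K s (σ.2.2.1.1 + b * q))
      (fun b => qpos_mem (by omega) s v1 v2 _ (hlt b)) s.1 hlin hKN (by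
        intro b b' hb
        apply qsep K L q hKL (by omega) _ _ s v3 _ _ _ (fun h => hb (Fin.ext h))
        have h1 : 2 * L ≤ K := by rw [hKL]; nlinarith
        have h2 : (2 : ℝ) * L ≤ K := by exact_mod_cast h1
        have h3 : (1 : ℝ) ≤ (K : ℝ) ^ j := one_le_pow₀ (by linarith)
        rw [pow_succ]; nlinarith)
    have dQ := DD_Q hN (by omega) j _ _ (sg σ.1.2) (abs_sg _).le v7'
    refine ⟨?_, ?_, ?_, ?_⟩
    · intro κ; rw [hi]
      exact (abs_add_le _ _).trans (by linarith [w2 κ, d2 κ])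
    · intro κ; rw [hi]
      refine (abs_add_le _ _).trans ((add_le_add (w1 κ) (d1 κ)).trans (le_of_eq ?_))
      ring
    · intro κ hκ; rw [hi]
      simp only
      rw [WW_supp (by omega) _ _ _ hκ, psi_eq_zero (by omega) _ hκ, psi_eq_zero (by omega) _ hκ]
      ring
    · rw [hi]
      have := QQ_add_le N (WW N K j L (fun b => sg (σ.2.2.2 b))
        (fun b => qpos K s (σ.2.2.1.1 + b * q)) s.1)
        (fun κ => sg σ.1.2 * (psi N K j (child K j s σ).1 κ - psi N K j (qpos K s σ.2.2.1.2) κ))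
      have hp : pk σ = 0 := by simp [pk, hσ]
      rw [hp]
      unfold vv
      have e : (16 : ℝ) / L * (1 + Real.log K) = 2 * (8 / L * (1 + Real.log K)) := by ring
      rw [e]
      push_cast
      linarith
  · have v := hv.2 hσ
    have hi : inc N K q j s σ =
        WW N K j 1 (fun _ => sg σ.1.2) (fun _ => (child K j s σ).1) s.1 := by
      funext κ; unfold inc; rw [if_neg hσ, if_pos v]
    have hs : ∀ b : Fin 1, |sg σ.1.2| ≤ 1 := fun b => (abs_sg _).le
    have hlin : ∀ b : Fin 1, (linf (child K j s σ).1 s.1 : ℝ) ≤ 5 * (K : ℝ) ^ (j + 1) := by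
      intro b; exact_mod_cast v
    rw [hi]
    refine ⟨?_, ?_, ?_, ?_⟩
    · intro κ
      exact (WW_abs2 (by norm_num) _ hs _ _ κ).trans (by norm_num)
    · intro κ
      refine (WW_abs1 hN (by omega) (by norm_num) _ hs _ _ κ hlin).trans ?_
      apply div_le_div_of_nonneg_right _ hM.le
      have : 0 ≤ ((κ.1 : ℝ) + κ.2) * (K : ℝ) ^ (j + 1) := by positivity
      nlinarith
    · intro κ hκ
      exact WW_supp (by omega) _ _ _ hκ
    · have := WW_Q_crude hN (by omega) (by norm_num) _ hs _ _ hlin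
      have hp : pk σ = 1 := by simp [pk, hσ]
      rw [hp]
      unfold wv
      push_cast
      linarith

lemma CS_inv {N K L q : ℕ} (hN : 1 ≤ N) (hK : 16 ≤ K) (hKL : K = L * q) (hq : 2 ≤ q) :
    ∀ n, K ^ n ≤ N → ∀ s, ∀ p ∈ CS N K L q n s,
      (∀ κ, |p.1 κ| ≤ 60 * (κ.1 + κ.2) * (K : ℝ) ^ n / Mx N) ∧
      QQ N p.1 ≤ n * vv K L + p.2 * wv K := by
  have hM := Mx_pos hN
  have hKr : (16 : ℝ) ≤ K := by exact_mod_cast hK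
  intro n
  induction n with
  | zero =>
    intro _ s p hp
    rw [CS, Finset.mem_singleton] at hp
    subst hp
    refine ⟨fun κ => by simp only [abs_zero]; positivity, ?_⟩
    simp [QQ]
  | succ n ih =>
    intro hKN s p hp
    obtain ⟨σ, hσ, p', hp', rfl⟩ := mem_CS_succ.mp hp
    have hKN' : K ^ n ≤ N := (Nat.pow_le_pow_right (by omega) (by omega)).trans hKN
    obtain ⟨i1, i2⟩ := ih hKN' _ p' hp'
    obtain ⟨b1, b2, b3, b4⟩ := inc_bounds hN hK hKL hq hKN s σ
    constructor
    · intro κ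
      refine (abs_add_le _ _).trans ((add_le_add (b2 κ) (i1 κ)).trans ?_)
      rw [← add_div]
      apply div_le_div_of_nonneg_right _ hM.le
      have : 0 ≤ ((κ.1 : ℝ) + κ.2) * (K : ℝ) ^ n := by positivity
      rw [pow_succ]
      nlinarith
    · simp only
      rw [QQ_add]
      have hc := B_cross N (inc N K q n s σ) p'.1 4 60 ((Mx N : ℝ) / (K : ℝ) ^ n) (by norm_num)
        (by norm_num) (by positivity) (fun κ _ => b1 κ) (fun κ _ => b3 κ) (fun κ _ => by
          refine (i1 κ).trans (le_of_eq ?_)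
          field_simp)
      have hc' := (abs_le.mp hc).2
      push_cast
      nlinarith

end HV

open MeasureTheory ProbabilityTheory Real Set Filter

namespace HV

lemma csum (M : ℕ) (hM : 1 ≤ M) (θ : ℝ) (h : Real.sin (θ / 2) ≠ 0) (hs : Real.sin (M * θ) = 0) :
    ∑ k ∈ Finset.Ico 1 M, Real.cos (k * θ) = (-Real.cos (M * θ) - 1) / 2 := by
  have e : (∑ k ∈ Finset.Ico 1 M, Real.cos (k * θ)) * Real.sin (θ / 2)
      = (Real.sin ((M - 1 / 2) * θ) - Real.sin (((1 : ℕ) - 1 / 2) * θ)) / 2 := by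
    rw [← Finset.sum_Ico_sub (fun k : ℕ => Real.sin ((k - 1 / 2) * θ)) hM, Finset.sum_mul,
      Finset.sum_div]
    apply Finset.sum_congr rfl
    intro k _
    push_cast
    have h1 : ((k : ℝ) + 1 - 1 / 2) * θ = k * θ + θ / 2 := by ring
    have h2 : ((k : ℝ) - 1 / 2) * θ = k * θ - θ / 2 := by ring
    rw [h1, h2, Real.sin_add, Real.sin_sub]; ring
  have h1 : ((M : ℝ) - 1 / 2) * θ = M * θ - θ / 2 := by ring
  have h2 : (((1 : ℕ) : ℝ) - 1 / 2) * θ = θ / 2 := by push_cast; ring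
  rw [h1, h2, Real.sin_sub, hs] at e
  apply mul_right_cancel₀ h
  rw [e]; ring

lemma orth (M : ℕ) (a b : ℕ) (ha : a ≤ M) (hb : 0 < b) (hbM : b < M) :
    ∑ k ∈ Finset.Ioo 0 M, Real.sin (π * k * a / M) * Real.sin (π * k * b / M)
      = if a = b then (M : ℝ) / 2 else 0 := by
  have hM : (0 : ℝ) < M := by exact_mod_cast (by omega : 0 < M)
  have hI : Finset.Ioo 0 M = Finset.Ico 1 M := by ext; simp [Finset.mem_Ioo]; omega
  have har : (a : ℝ) ≤ M := by exact_mod_cast ha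
  have hbr : (b : ℝ) < M := by exact_mod_cast hbM
  have hb0 : (0 : ℝ) < b := by exact_mod_cast hb
  have ha0 : (0 : ℝ) ≤ a := by positivity
  set θ := π * ((a : ℝ) - b) / M with hθ
  set φ := π * ((a : ℝ) + b) / M with hφ
  have e : ∑ k ∈ Finset.Ioo 0 M, Real.sin (π * k * a / M) * Real.sin (π * k * b / M)
      = (∑ k ∈ Finset.Ico 1 M, Real.cos (k * θ)) / 2
        - (∑ k ∈ Finset.Ico 1 M, Real.cos (k * φ)) / 2 := by
    rw [hI, Finset.sum_div, Finset.sum_div, ← Finset.sum_sub_distrib]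
    apply Finset.sum_congr rfl
    intro k _
    have h1 : (k : ℝ) * θ = π * k * a / M - π * k * b / M := by rw [hθ]; ring
    have h2 : (k : ℝ) * φ = π * k * a / M + π * k * b / M := by rw [hφ]; ring
    rw [h1, h2, Real.cos_sub, Real.cos_add]; ring
  have hMθ : (M : ℝ) * θ = a * π - b * π := by rw [hθ]; field_simp
  have hMφ : (M : ℝ) * φ = a * π + b * π := by rw [hφ]; field_simp
  have sb : Real.sin (b * π) = 0 := Real.sin_nat_mul_pi b
  have sa : Real.sin (a * π) = 0 := Real.sin_nat_mul_pi a
  have s1 : Real.sin (M * θ) = 0 := by rw [hMθ, Real.sin_sub, sa, sb]; ring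
  have s2 : Real.sin (M * φ) = 0 := by rw [hMφ, Real.sin_add, sa, sb]; ring
  have c12 : Real.cos (M * θ) = Real.cos (M * φ) := by
    rw [hMθ, hMφ, Real.cos_sub, Real.cos_add, sb]; ring
  have hpi := Real.pi_pos
  have n2 : Real.sin (φ / 2) ≠ 0 := by
    apply ne_of_gt
    apply Real.sin_pos_of_pos_of_lt_pi
    · rw [hφ]; positivity
    · rw [hφ, div_div, div_lt_iff₀ (by positivity)]; nlinarith
  rw [e, csum M (by omega) φ n2 s2]
  split_ifs with hab
  · have : θ = 0 := by rw [hθ, hab]; simp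
    have hc : Real.cos (M * φ) = 1 := by rw [← c12, this]; simp
    rw [hc, this]
    simp
    rw [Nat.cast_sub (by omega)]
    push_cast; ring
  · have n1 : Real.sin (θ / 2) ≠ 0 := by
      have hne : (a : ℝ) ≠ b := by exact_mod_cast hab
      rcases lt_or_gt_of_ne hne with h | h
      · apply ne_of_lt
        apply Real.sin_neg_of_neg_of_neg_pi_lt
        · rw [hθ]
          apply div_neg_of_neg_of_pos _ two_pos
          apply div_neg_of_neg_of_pos _ hM
          nlinarith
        · rw [hθ, div_div, lt_div_iff₀ (by positivity)]; nlinarith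
      · apply ne_of_gt
        apply Real.sin_pos_of_pos_of_lt_pi
        · rw [hθ]
          have : 0 < (a : ℝ) - b := by linarith
          positivity
        · rw [hθ, div_div, div_lt_iff₀ (by positivity)]; nlinarith
    rw [csum M (by omega) θ n1 s1, c12]; ring

/-- lattice points from shifted coordinates -/
def pt (N : ℕ) (a : ℕ × ℕ) : Z2 := ((a.1 : ℤ) - 2 * N, (a.2 : ℤ) - 2 * N)

lemma pt_inj (N : ℕ) : Function.Injective (pt N) := by
  intro a b h
  unfold pt at h
  rw [Prod.mk.injEq] at h
  apply Prod.ext <;> omega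

lemma sn_pt (N k a : ℕ) : sn N k ((a : ℤ) - 2 * N) = Real.sin (π * k * a / Mx N) := by
  unfold sn; push_cast; ring_nf

lemma orth_modes (N : ℕ) (a b : ℕ × ℕ) (ha : a.1 ≤ Mx N ∧ a.2 ≤ Mx N) (hb : b ∈ modes N) :
    ∑ κ ∈ modes N, 4 / (Mx N : ℝ) ^ 2 * (ss N κ (pt N a) * ss N κ (pt N b))
      = if a = b then 1 else 0 := by
  obtain ⟨⟨h1, h2⟩, h3, h4⟩ := mem_modes.mp hb
  have hM : (0 : ℝ) < Mx N := by exact_mod_cast (by omega : 0 < Mx N)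
  have e : ∑ κ ∈ modes N, 4 / (Mx N : ℝ) ^ 2 * (ss N κ (pt N a) * ss N κ (pt N b))
      = 4 / (Mx N : ℝ) ^ 2 * ((if a.1 = b.1 then (Mx N : ℝ) / 2 else 0) *
        (if a.2 = b.2 then (Mx N : ℝ) / 2 else 0)) := by
    rw [← orth (Mx N) a.1 b.1 ha.1 h1 h2, ← orth (Mx N) a.2 b.2 ha.2 h3 h4, Finset.sum_mul_sum,
      ← Finset.mul_sum]
    unfold modes
    rw [Finset.sum_product]
    congr 1
    apply Finset.sum_congr rfl; intro k _
    apply Finset.sum_congr rfl; intro l _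
    unfold ss pt
    simp only [sn_pt]
    ring
  rw [e]
  by_cases h : a = b
  · subst h; simp; field_simp; norm_num
  · rw [if_neg h]
    by_cases h' : a.1 = b.1
    · have : a.2 ≠ b.2 := fun h'' => h (Prod.ext h' h'')
      simp [this]
    · simp [h']

lemma orth_dual (N : ℕ) (κ κ' : ℕ × ℕ) (hκ : κ ∈ modes N) (hκ' : κ' ∈ modes N) :
    ∑ a ∈ modes N, 4 / (Mx N : ℝ) ^ 2 * (ss N κ (pt N a) * ss N κ' (pt N a))
      = if κ = κ' then 1 else 0 := by
  obtain ⟨⟨h1, h2⟩, h3, h4⟩ := mem_modes.mp hκ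
  rw [← orth_modes N κ κ' ⟨h2.le, h4.le⟩ hκ']
  apply Finset.sum_congr rfl; intro a _
  have : ∀ κ a, ss N κ (pt N a) = ss N a (pt N κ) := by
    intro κ a
    unfold ss pt
    simp only [sn_pt]
    congr 2 <;> ring
  rw [this κ a, this κ' a]

lemma spacer_c : (0 : ℝ) ≤ 1 := zero_le_one

/-- neighbors -/
def nbrs (x : Z2) : Finset Z2 :=
  {(x.1 + 1, x.2), (x.1 - 1, x.2), (x.1, x.2 + 1), (x.1, x.2 - 1)}

lemma mem_nbrs (x w : Z2) : w ∈ nbrs x ↔ Adj x w := by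
  obtain ⟨a, b⟩ := x
  obtain ⟨c, d⟩ := w
  unfold nbrs Adj
  simp only [Finset.mem_insert, Finset.mem_singleton, Prod.mk.injEq]
  constructor
  · rintro (⟨rfl, rfl⟩ | ⟨rfl, rfl⟩ | ⟨rfl, rfl⟩ | ⟨rfl, rfl⟩) <;> simp
  · intro h
    rcases abs_cases (a - c) with ⟨h1, _⟩ | ⟨h1, _⟩ <;>
    rcases abs_cases (b - d) with ⟨h2, _⟩ | ⟨h2, _⟩ <;> omega

lemma sum_nbrs (x : Z2) (F : Z2 → ℝ) : ∑ w ∈ nbrs x, F w =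
    F (x.1 + 1, x.2) + F (x.1 - 1, x.2) + F (x.1, x.2 + 1) + F (x.1, x.2 - 1) := by
  unfold nbrs
  rw [Finset.sum_insert, Finset.sum_insert, Finset.sum_insert, Finset.sum_singleton]
  · ring
  · simp only [Finset.mem_singleton, Prod.mk.injEq]; omega
  · simp only [Finset.mem_insert, Finset.mem_singleton, Prod.mk.injEq]; omega
  · simp only [Finset.mem_insert, Finset.mem_singleton, Prod.mk.injEq]; omega

open Classical in
/-- finite sets of walks -/
noncomputable def Wf (B : Set Z2) (y : Z2) : (t : ℕ) → Z2 → Finset (Fin (t + 1) → Z2)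
  | 0, x => if x = y ∧ x ∉ bdry B then {fun _ => x} else ∅
  | t + 1, x => if x ∈ bdry B then ∅ else
      (nbrs x).biUnion fun x' => (Wf B y t x').image (fun g => Fin.cons (α := fun _ => Z2) x g)

lemma mem_Wf (B : Set Z2) (y : Z2) : ∀ t x (f : Fin (t + 1) → Z2), f ∈ Wf B y t x ↔
    (f 0 = x ∧ f (Fin.last t) = y ∧ (∀ i, f i ∉ bdry B) ∧
    ∀ i : Fin t, Adj (f i.castSucc) (f i.succ)) := by
  intro t
  induction t with
  | zero =>
    intro x f
    rw [Wf]
    have hl : (Fin.last 0) = 0 := rfl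
    split_ifs with h
    · rw [Finset.mem_singleton]
      constructor
      · rintro rfl
        exact ⟨rfl, h.1, fun _ => h.2, fun i => i.elim0⟩
      · rintro ⟨h1, -⟩
        funext i
        rw [Fin.fin_one_eq_zero i]; exact h1
    · simp only [Finset.notMem_empty, false_iff]
      rintro ⟨h1, h2, h3, -⟩
      rw [hl] at h2
      exact h ⟨by rw [← h1, h2], by rw [← h1]; exact h3 0⟩
  | succ t ih =>
    intro x f
    rw [Wf]
    split_ifs with h
    · simp only [Finset.notMem_empty, false_iff]
      rintro ⟨h1, -, h3, -⟩
      exact h3 0 (by rw [h1]; exact h)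
    · simp only [Finset.mem_biUnion, Finset.mem_image]
      constructor
      · rintro ⟨x', hx', g, hg, rfl⟩
        obtain ⟨g1, g2, g3, g4⟩ := (ih x' g).mp hg
        refine ⟨rfl, ?_, ?_, ?_⟩
        · rw [← Fin.succ_last, Fin.cons_succ]; exact g2
        · intro i
          refine Fin.cases ?_ (fun i => ?_) i
          · exact h
          · rw [Fin.cons_succ]; exact g3 i
        · intro i
          refine Fin.cases ?_ (fun i => ?_) i
          · rw [Fin.cons_succ, g1]
            exact (mem_nbrs _ _).mp hx'
          · rw [Fin.castSucc_succ, Fin.cons_succ, Fin.cons_succ]; exact g4 i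
      · rintro ⟨h1, h2, h3, h4⟩
        refine ⟨f 1, ?_, Fin.tail f, ?_, ?_⟩
        · rw [mem_nbrs, ← h1]; exact h4 0
        · rw [ih]
          refine ⟨rfl, ?_, fun i => h3 _, fun i => ?_⟩
          · unfold Fin.tail; rw [Fin.succ_last]; exact h2
          · unfold Fin.tail
            rw [Fin.succ_castSucc]; exact h4 i.succ
        · rw [← h1]; exact Fin.cons_self_tail f

lemma nWalks_eq (B : Set Z2) (t : ℕ) (x y : Z2) : nWalks B t x y = (Wf B y t x).card := by
  unfold nWalks
  exact Nat.subtype_card _ (fun f => mem_Wf B y t x f)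

lemma nWalks_zero (B : Set Z2) (x y : Z2) (hy : y ∉ bdry B) :
    nWalks B 0 x y = if x = y then 1 else 0 := by
  rw [nWalks_eq, Wf]
  by_cases h : x = y
  · subst h; simp [hy]
  · simp [h]

lemma nWalks_bdry (B : Set Z2) (t : ℕ) (x y : Z2) (hx : x ∈ bdry B) : nWalks B (t + 1) x y = 0 := by
  rw [nWalks_eq, Wf]; simp [hx]

lemma nWalks_succ (B : Set Z2) (t : ℕ) (x y : Z2) (hx : x ∉ bdry B) :
    (nWalks B (t + 1) x y : ℝ) = ∑ w ∈ nbrs x, (nWalks B t w y : ℝ) := by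
  classical
  have : nWalks B (t + 1) x y = ∑ w ∈ nbrs x, nWalks B t w y := by
    rw [nWalks_eq, Wf, if_neg hx, Finset.card_biUnion]
    · apply Finset.sum_congr rfl
      intro w _
      rw [nWalks_eq, Finset.card_image_of_injective]
      exact Fin.cons_right_injective (α := fun _ => Z2) x
    · intro w _ w' _ hww
      refine Finset.disjoint_left.mpr ?_
      intro f hf hf'
      obtain ⟨g, hg, rfl⟩ := Finset.mem_image.mp hf
      obtain ⟨g', hg', e⟩ := Finset.mem_image.mp hf'
      have e2 := Fin.cons_right_injective (α := fun _ => Z2) x e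
      subst e2
      exact hww (((mem_Wf B y t w g').mp hg).1.symm.trans ((mem_Wf B y t w' g').mp hg').1)
  rw [this]; push_cast; rfl

lemma mem_V5N_iff {N : ℕ} (hN : 1 ≤ N) (x : Z2) :
    x ∈ V5N N ↔ ∃ a : ℕ × ℕ, (a.1 ≤ Mx N ∧ a.2 ≤ Mx N) ∧ x = pt N a := by
  unfold V5N Mx pt
  simp only [Set.mem_ofPred_eq]
  constructor
  · rintro ⟨h1, h2, h3, h4⟩
    refine ⟨((x.1 + 2 * N).toNat, (x.2 + 2 * N).toNat), ⟨by dsimp only; omega, by dsimp only; omega⟩, ?_⟩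
    apply Prod.ext <;> dsimp only <;> omega
  · rintro ⟨a, ⟨h1, h2⟩, rfl⟩
    dsimp only
    omega

lemma bdry_iff {N : ℕ} (hN : 1 ≤ N) (a : ℕ × ℕ) (ha : a.1 ≤ Mx N ∧ a.2 ≤ Mx N) :
    pt N a ∈ bdry (V5N N) ↔ a ∉ modes N := by
  rw [mem_modes]
  unfold Mx at *
  constructor
  · rintro ⟨h1, w, hw, hw'⟩ h
    rw [← mem_nbrs] at hw
    unfold nbrs pt at hw
    apply hw'
    unfold V5N
    simp only [Finset.mem_insert, Finset.mem_singleton] at hw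
    simp only [Set.mem_ofPred_eq]
    rcases hw with rfl | rfl | rfl | rfl <;> dsimp only <;> omega
  · intro h
    refine ⟨(mem_V5N_iff hN _).mpr ⟨a, by unfold Mx; exact ha, rfl⟩, ?_⟩
    have h' : a.1 = 0 ∨ a.1 = 5 * N - 1 ∨ a.2 = 0 ∨ a.2 = 5 * N - 1 := by omega
    rcases h' with h | h | h | h
    · refine ⟨((pt N a).1 - 1, (pt N a).2), by simp [Adj], ?_⟩
      unfold V5N pt; simp only [Set.mem_ofPred_eq]; omega
    · refine ⟨((pt N a).1 + 1, (pt N a).2), by simp [Adj], ?_⟩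
      unfold V5N pt; simp only [Set.mem_ofPred_eq]; omega
    · refine ⟨((pt N a).1, (pt N a).2 - 1), by simp [Adj], ?_⟩
      unfold V5N pt; simp only [Set.mem_ofPred_eq]; omega
    · refine ⟨((pt N a).1, (pt N a).2 + 1), by simp [Adj], ?_⟩
      unfold V5N pt; simp only [Set.mem_ofPred_eq]; omega

lemma ss_bdry {N : ℕ} (hN : 1 ≤ N) (κ a : ℕ × ℕ) (ha : a.1 ≤ Mx N ∧ a.2 ≤ Mx N) (h : a ∉ modes N) :
    ss N κ (pt N a) = 0 := by
  have hM := Mx_pos hN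
  rw [mem_modes] at h
  have h' : a.1 = 0 ∨ a.1 = Mx N ∨ a.2 = 0 ∨ a.2 = Mx N := by omega
  have e : ∀ k : ℕ, Real.sin (π * k * (Mx N : ℕ) / Mx N) = 0 := by
    intro k
    rw [mul_div_assoc, div_self hM.ne', mul_one, mul_comm]; exact Real.sin_nat_mul_pi k
  unfold ss pt
  simp only [sn_pt]
  rcases h' with h | h | h | h <;> rw [h] <;> simp [e]

lemma sn_nbr (N k : ℕ) (u : ℤ) : sn N k (u + 1) + sn N k (u - 1) =
    2 * Real.cos (π * k / Mx N) * sn N k u := by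
  unfold sn
  have h1 : π * k * (((u + 1 : ℤ) : ℝ) + 2 * N) / Mx N = π * k * ((u : ℝ) + 2 * N) / Mx N + π * k / Mx N := by
    push_cast; ring
  have h2 : π * k * (((u - 1 : ℤ) : ℝ) + 2 * N) / Mx N = π * k * ((u : ℝ) + 2 * N) / Mx N - π * k / Mx N := by
    push_cast; ring
  rw [h1, h2, Real.sin_add, Real.sin_sub]; ring

lemma lam_cos (N : ℕ) (κ : ℕ × ℕ) :
    1 - lam N κ = (Real.cos (π * κ.1 / Mx N) + Real.cos (π * κ.2 / Mx N)) / 2 := by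
  unfold lam
  have h : ∀ k : ℕ, Real.cos (π * k / Mx N) = 1 - 2 * Real.sin (π * k / (2 * Mx N)) ^ 2 := by
    intro k
    have e : π * k / Mx N = 2 * (π * k / (2 * Mx N)) := by ring
    rw [e, Real.cos_two_mul, Real.cos_sq']; ring
  rw [h, h]; ring

lemma ss_nbr (N : ℕ) (κ : ℕ × ℕ) (x : Z2) :
    ∑ w ∈ nbrs x, ss N κ w = 4 * (1 - lam N κ) * ss N κ x := by
  rw [sum_nbrs, lam_cos]
  unfold ss
  have h1 := sn_nbr N κ.1 x.1
  have h2 := sn_nbr N κ.2 x.2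
  simp only
  linear_combination sn N κ.2 x.2 * h1 + sn N κ.1 x.1 * h2

lemma walks_fourier {N : ℕ} (hN : 1 ≤ N) (b : ℕ × ℕ) (hb : b ∈ modes N) : ∀ t, ∀ a : ℕ × ℕ,
    a.1 ≤ Mx N ∧ a.2 ≤ Mx N →
    (1 / 4 : ℝ) ^ t * nWalks (V5N N) t (pt N a) (pt N b) = ∑ κ ∈ modes N,
      4 / (Mx N : ℝ) ^ 2 * ((1 - lam N κ) ^ t * (ss N κ (pt N a) * ss N κ (pt N b))) := by
  obtain ⟨⟨b1, b2⟩, b3, b4⟩ := mem_modes.mp hb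
  intro t
  induction t with
  | zero =>
    intro a ha
    have hbb : pt N b ∉ bdry (V5N N) := by
      rw [bdry_iff hN b ⟨b2.le, b4.le⟩]; exact not_not.mpr hb
    rw [nWalks_zero _ _ _ hbb]
    simp only [pow_zero, one_mul]
    rw [orth_modes N a b ha hb]
    by_cases h : a = b
    · simp [h]
    · simp [h, (pt_inj N).ne h]
  | succ t ih =>
    intro a ha
    by_cases hab : a ∈ modes N
    · have hx : pt N a ∉ bdry (V5N N) := by
        rw [bdry_iff hN a ha]; exact not_not.mpr hab
      rw [nWalks_succ _ _ _ _ hx]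
      have hnb : ∀ w ∈ nbrs (pt N a), ∃ a' : ℕ × ℕ, (a'.1 ≤ Mx N ∧ a'.2 ≤ Mx N) ∧ w = pt N a' := by
        intro w hw
        rw [← mem_V5N_iff hN]
        by_contra hc
        apply hx
        exact ⟨(mem_V5N_iff hN _).mpr ⟨a, ha, rfl⟩, w, (mem_nbrs _ _).mp hw, hc⟩
      have h1 : ∀ w ∈ nbrs (pt N a), (1 / 4 : ℝ) ^ t * nWalks (V5N N) t w (pt N b) = ∑ κ ∈ modes N,
          4 / (Mx N : ℝ) ^ 2 * ((1 - lam N κ) ^ t * (ss N κ w * ss N κ (pt N b))) := by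
        intro w hw
        obtain ⟨a', ha', rfl⟩ := hnb w hw
        exact ih a' ha'
      rw [pow_succ, mul_comm ((1 / 4 : ℝ) ^ t), mul_assoc, Finset.mul_sum, Finset.sum_congr rfl h1,
        Finset.sum_comm, Finset.mul_sum]
      apply Finset.sum_congr rfl
      intro κ _
      have h2 := ss_nbr N κ (pt N a)
      calc _ = 1 / 4 * (4 / (Mx N : ℝ) ^ 2 * ((1 - lam N κ) ^ t * ((∑ w ∈ nbrs (pt N a), ss N κ w) *
              ss N κ (pt N b)))) := by
            rw [Finset.sum_mul]; simp only [Finset.mul_sum]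
        _ = _ := by rw [h2, pow_succ]; ring
    · have hx : pt N a ∈ bdry (V5N N) := (bdry_iff hN a ha).mpr hab
      rw [nWalks_bdry _ _ _ _ hx]
      simp [ss_bdry hN _ a ha hab]

lemma lam_lt_two {N : ℕ} {κ : ℕ × ℕ} (hκ : κ ∈ modes N) : lam N κ < 2 := by
  obtain ⟨⟨h1, h2⟩, h3, h4⟩ := mem_modes.mp hκ
  have hM : (0 : ℝ) < Mx N := by exact_mod_cast (by omega : 0 < Mx N)
  unfold lam
  have hs := Real.sin_sq_add_cos_sq (π * κ.1 / (2 * Mx N))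
  have hs2 := Real.sin_sq_le_one (π * κ.2 / (2 * Mx N))
  have hc : 0 < Real.cos (π * κ.1 / (2 * Mx N)) := by
    apply Real.cos_pos_of_mem_Ioo
    have hpi := Real.pi_pos
    have hk : (κ.1 : ℝ) < Mx N := by exact_mod_cast h2
    constructor
    · have : 0 ≤ π * κ.1 / (2 * Mx N) := by positivity
      linarith
    · rw [div_lt_div_iff₀ (by positivity) two_pos]; nlinarith
  nlinarith

theorem green_fourier {N : ℕ} (hN : 1 ≤ N) (a b : ℕ × ℕ) (ha : a ∈ modes N) (hb : b ∈ modes N) :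
    greenFn (V5N N) (pt N a) (pt N b) = ∑ κ ∈ modes N, ww N κ * (ss N κ (pt N a) * ss N κ (pt N b)) := by
  obtain ⟨⟨h1, h2⟩, h3, h4⟩ := mem_modes.mp ha
  unfold greenFn
  simp_rw [walks_fourier hN b hb _ a ⟨h2.le, h4.le⟩]
  apply HasSum.tsum_eq
  apply hasSum_sum
  intro κ hκ
  have l1 := lam_pos hκ
  have l2 := lam_lt_two hκ
  have hg := hasSum_geometric_of_abs_lt_one (r := 1 - lam N κ) (by rw [abs_lt]; constructor <;> linarith)
  have := (hg.mul_right (ss N κ (pt N a) * ss N κ (pt N b))).mul_left (4 / (Mx N : ℝ) ^ 2)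
  have hM := Mx_pos hN
  have e : 4 / (Mx N : ℝ) ^ 2 * ((1 - (1 - lam N κ))⁻¹ * (ss N κ (pt N a) * ss N κ (pt N b)))
      = ww N κ * (ss N κ (pt N a) * ss N κ (pt N b)) := by
    unfold ww
    rw [sub_sub_cancel]
    field_simp
  rw [← e]
  exact this

end HV

open MeasureTheory ProbabilityTheory Real Set Filter

namespace HV

/-- Fourier coefficients of a field -/
noncomputable def bb (N : ℕ) (h : Z2 → ℝ) (κ : ℕ × ℕ) : ℝ :=
  ∑ a ∈ modes N, 4 / (Mx N : ℝ) ^ 2 * ss N κ (pt N a) * h (pt N a)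

lemma AF_bb (N K : ℕ) (h : Z2 → ℝ) (b : ℕ × ℕ) (hb : b ∈ modes N) :
    AF N K (bb N h) 0 (pt N b) = h (pt N b) := by
  unfold AF ip bb
  have e1 : ∀ κ ∈ modes N, psi N K 0 (pt N b) κ * (∑ a ∈ modes N, 4 / (Mx N : ℝ) ^ 2 * ss N κ (pt N a) * h (pt N a))
      = ∑ a ∈ modes N, 4 / (Mx N : ℝ) ^ 2 * (ss N κ (pt N a) * ss N κ (pt N b)) * h (pt N a) := by
    intro κ hκ
    have : psi N K 0 (pt N b) κ = ss N κ (pt N b) := by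
      obtain ⟨⟨_, h2⟩, _, h4⟩ := mem_modes.mp hκ
      unfold psi
      rw [if_pos]
      simp only [pow_zero, mul_one]
      exact max_le h2.le h4.le
    rw [this, Finset.mul_sum]
    exact Finset.sum_congr rfl fun _ _ => by ring
  rw [Finset.sum_congr rfl e1, Finset.sum_comm]
  simp_rw [← Finset.sum_mul]
  have e2 : ∀ a ∈ modes N, (∑ κ ∈ modes N, 4 / (Mx N : ℝ) ^ 2 * (ss N κ (pt N a) * ss N κ (pt N b))) * h (pt N a)
      = if a = b then h (pt N b) else 0 := by
    intro a ha
    obtain ⟨⟨_, h2⟩, _, h4⟩ := mem_modes.mp ha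
    rw [orth_modes N a b ⟨h2.le, h4.le⟩ hb]
    split_ifs with hab
    · rw [hab, one_mul]
    · simp
  rw [Finset.sum_congr rfl e2, Finset.sum_ite_eq' (modes N) b, if_pos hb]

/-- coefficients in physical space -/
noncomputable def cc (N : ℕ) (C : ℕ × ℕ → ℝ) (z : Z2) : ℝ :=
  ∑ κ ∈ modes N, C κ * (4 / (Mx N : ℝ) ^ 2 * ss N κ z)

lemma ip_bb (N : ℕ) (C : ℕ × ℕ → ℝ) (h : Z2 → ℝ) :
    ip N C (bb N h) = ∑ a ∈ modes N, cc N C (pt N a) * h (pt N a) := by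
  unfold ip bb cc
  simp_rw [Finset.mul_sum, Finset.sum_mul]
  rw [Finset.sum_comm]
  exact Finset.sum_congr rfl fun _ _ => Finset.sum_congr rfl fun _ _ => by ring

lemma cc_ss (N : ℕ) (C : ℕ × ℕ → ℝ) (κ : ℕ × ℕ) (hκ : κ ∈ modes N) :
    ∑ a ∈ modes N, cc N C (pt N a) * ss N κ (pt N a) = C κ := by
  unfold cc
  simp_rw [Finset.sum_mul]
  rw [Finset.sum_comm]
  have e2 : ∀ κ' ∈ modes N, (∑ a ∈ modes N, C κ' * (4 / (Mx N : ℝ) ^ 2 * ss N κ' (pt N a)) * ss N κ (pt N a))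
      = if κ' = κ then C κ else 0 := by
    intro κ' hκ'
    have : (∑ a ∈ modes N, C κ' * (4 / (Mx N : ℝ) ^ 2 * ss N κ' (pt N a)) * ss N κ (pt N a))
        = C κ' * ∑ a ∈ modes N, 4 / (Mx N : ℝ) ^ 2 * (ss N κ' (pt N a) * ss N κ (pt N a)) := by
      rw [Finset.mul_sum]
      exact Finset.sum_congr rfl fun _ _ => by ring
    rw [this, orth_dual N κ' κ hκ' hκ]
    split_ifs with hab
    · rw [hab, mul_one]
    · simp
  rw [Finset.sum_congr rfl e2, Finset.sum_ite_eq' (modes N) κ, if_pos hκ]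

variable {Ω : Type*} [MeasureSpace Ω] [IsProbabilityMeasure (ℙ : Measure Ω)]

lemma aem_of_map {X : Ω → ℝ} {v : NNReal} (h : Measure.map X (ℙ : Measure Ω) = gaussianReal 0 v) :
    AEMeasurable X (ℙ : Measure Ω) := by
  by_contra hc
  rw [Measure.map_of_not_aemeasurable hc] at h
  have : (gaussianReal 0 v) univ = 1 := measure_univ
  rw [← h] at this
  simp at this

lemma sq_of_map {X : Ω → ℝ} {v : NNReal} (h : Measure.map X (ℙ : Measure Ω) = gaussianReal 0 v) :
    ∫ ω, X ω * X ω = v := by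
  have hm := aem_of_map h
  have h1 : ∫ ω, X ω * X ω = ∫ x, x * x ∂(gaussianReal 0 v) := by
    rw [← h, integral_map hm (by fun_prop)]
  rw [h1]
  have h2 := variance_fun_id_gaussianReal (μ := 0) (v := v)
  rw [variance_eq_integral (by fun_prop)] at h2
  simp only [integral_id_gaussianReal] at h2
  rw [← h2]
  congr 1; ext x; ring

lemma memLp_of_map {X : Ω → ℝ} {v : NNReal} (h : Measure.map X (ℙ : Measure Ω) = gaussianReal 0 v) :
    MemLp X 2 (ℙ : Measure Ω) := by
  have hm := aem_of_map h
  have h1 : MemLp id 2 (Measure.map X (ℙ : Measure Ω)) := by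
    rw [h]; exact memLp_id_gaussianReal 2
  exact (memLp_map_measure_iff (by fun_prop) hm).mp h1

lemma ip_law {N : ℕ} (hN : 1 ≤ N) (η : Z2 → Ω → ℝ) (hη : IsDGFF (V5N N) η) (C : ℕ × ℕ → ℝ) :
    ∃ v : NNReal, (v : ℝ) = QQ N C ∧
      Measure.map (fun ω => ip N C (bb N fun z => η z ω)) (ℙ : Measure Ω) = gaussianReal 0 v := by
  classical
  obtain ⟨hg, -, hcov⟩ := hη
  obtain ⟨v, hv⟩ := hg ((modes N).image (pt N)) (cc N C)
  have e : (fun ω => ip N C (bb N fun z => η z ω)) =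
      fun ω => ∑ z ∈ (modes N).image (pt N), cc N C z * η z ω := by
    ext ω
    rw [ip_bb, Finset.sum_image]
    intro a _ b _ hab
    exact pt_inj N hab
  refine ⟨v, ?_, by rw [e]; exact hv⟩
  rw [← e] at hv
  rw [← sq_of_map hv]
  have hL : ∀ z, MemLp (η z) 2 (ℙ : Measure Ω) := by
    intro z
    obtain ⟨v', hv'⟩ := hg {z} (fun _ => 1)
    simp only [Finset.sum_singleton, one_mul] at hv'
    exact memLp_of_map hv'
  have hProdInt : ∀ z w, Integrable (fun ω => η z ω * η w ω) (ℙ : Measure Ω) := fun z w =>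
    MemLp.integrable_mul (hL z) (hL w)
  have hV : ∀ a ∈ modes N, pt N a ∈ V5N N := by
    intro a ha
    obtain ⟨⟨_, h2⟩, _, h4⟩ := mem_modes.mp ha
    exact (mem_V5N_iff hN _).mpr ⟨a, ⟨h2.le, h4.le⟩, rfl⟩
  have e2 : ∀ ω, ip N C (bb N fun z => η z ω) * ip N C (bb N fun z => η z ω) =
      ∑ a ∈ modes N, ∑ b ∈ modes N, (cc N C (pt N a) * cc N C (pt N b)) *
        (η (pt N a) ω * η (pt N b) ω) := by
    intro ω
    rw [ip_bb, Finset.sum_mul_sum]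
    exact Finset.sum_congr rfl fun _ _ => Finset.sum_congr rfl fun _ _ => by ring
  simp_rw [e2]
  rw [integral_finsetSum _ (fun a _ => integrable_finsetSum _ fun b _ => (hProdInt _ _).const_mul _)]
  have e3 : ∀ a ∈ modes N, ∫ ω, ∑ b ∈ modes N, (cc N C (pt N a) * cc N C (pt N b)) *
        (η (pt N a) ω * η (pt N b) ω) = ∑ b ∈ modes N, (cc N C (pt N a) * cc N C (pt N b)) *
        ∑ κ ∈ modes N, ww N κ * (ss N κ (pt N a) * ss N κ (pt N b)) := by
    intro a ha
    rw [integral_finsetSum _ (fun b _ => (hProdInt _ _).const_mul _)]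
    refine Finset.sum_congr rfl fun b hb => ?_
    rw [integral_const_mul, hcov _ (hV a ha) _ (hV b hb), green_fourier hN a b ha hb]
  rw [Finset.sum_congr rfl e3]
  unfold QQ
  have e4 : ∀ κ ∈ modes N, ww N κ * C κ ^ 2 = ∑ a ∈ modes N, ∑ b ∈ modes N,
      ww N κ * ((cc N C (pt N a) * ss N κ (pt N a)) * (cc N C (pt N b) * ss N κ (pt N b))) := by
    intro κ hκ
    simp_rw [← Finset.mul_sum]
    rw [← Finset.sum_mul, cc_ss N C κ hκ]; ring
  rw [Finset.sum_congr rfl e4]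
  symm
  rw [Finset.sum_comm]
  refine Finset.sum_congr rfl fun a _ => ?_
  rw [Finset.sum_comm]
  refine Finset.sum_congr rfl fun b _ => ?_
  symm
  rw [Finset.mul_sum]
  exact Finset.sum_congr rfl fun _ _ => by ring

lemma ip_tail {N : ℕ} (hN : 1 ≤ N) (η : Z2 → Ω → ℝ) (hη : IsDGFF (V5N N) η) (C : ℕ × ℕ → ℝ)
    (s t : ℝ) (ht : 0 ≤ t) :
    (ℙ : Measure Ω).real {ω | s ≤ ip N C (bb N fun z => η z ω)} ≤
      Real.exp (-t * s + t ^ 2 * QQ N C / 2) := by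
  obtain ⟨v, hv, hm⟩ := ip_law hN η hη C
  have hi : Integrable (fun ω => Real.exp (t * ip N C (bb N fun z => η z ω))) (ℙ : Measure Ω) := by
    have := integrable_exp_mul_gaussianReal (μ := 0) (v := v) t
    rw [← hm] at this
    exact (integrable_map_measure (by fun_prop) (aem_of_map hm)).mp this
  refine (measure_ge_le_exp_mul_mgf s ht hi).trans ?_
  rw [mgf_gaussianReal hm, ← Real.exp_add, hv]
  apply le_of_eq; congr 1; ring

end HV

open MeasureTheory ProbabilityTheory Real Set Filter

namespace HV

/-- finset version of the box -/
noncomputable def VF (N : ℕ) : Finset Z2 := Finset.Ico (0 : ℤ) N ×ˢ Finset.Ico (0 : ℤ) N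

lemma mem_VF {N : ℕ} {x : Z2} : x ∈ VF N ↔ x ∈ VN N := by
  simp [VF, VN, Finset.mem_product, and_assoc]

lemma VF_card (N : ℕ) : (VF N).card = N ^ 2 := by
  simp [VF, Finset.card_product]; ring

lemma VN_pt {N : ℕ} {x : Z2} (hx : x ∈ VN N) : ∃ a ∈ modes N, x = pt N a := by
  obtain ⟨h1, h2, h3, h4⟩ := hx
  refine ⟨((x.1 + 2 * N).toNat, (x.2 + 2 * N).toNat), ?_, ?_⟩
  · rw [mem_modes]; unfold Mx; simp only; omega
  · unfold pt; apply Prod.ext <;> simp only <;> omega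

section
variable {Ω : Type*} [MeasureSpace Ω] [IsProbabilityMeasure (ℙ : Measure Ω)]

lemma U_tail {N K L q : ℕ} (hN : 1 ≤ N) (hK : 16 ≤ K) (hKL : K = L * q) (hq : 2 ≤ q)
    (hL : 2 ^ L ≤ K) (η : Z2 → Ω → ℝ) (hη : IsDGFF (V5N N) η) (n : ℕ) (hn : K ^ n ≤ N)
    (t T : ℝ) (ht : 0 ≤ t) (s : Z2 × Z2) :
    (ℙ : Measure Ω).real {ω | T < UF N K L q (t * wv K / 2) (bb N fun z => η z ω) n s} ≤
      (N : ℝ) ^ 16 * Real.exp (-t * T + t ^ 2 * (n * vv K L) / 2) := by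
  have hsub : {ω | T < UF N K L q (t * wv K / 2) (bb N fun z => η z ω) n s} ⊆
      ⋃ p ∈ CS N K L q n s, {ω | T + (t * wv K / 2) * p.2 ≤ ip N p.1 (bb N fun z => η z ω)} := by
    intro ω hω
    obtain ⟨p, hp, h⟩ := UF_gt (by omega) _ _ _ _ _ hω
    simp only [Set.mem_iUnion]
    refine ⟨p, hp, ?_⟩
    simp only [Set.mem_ofPred_eq]; linarith
  refine (measureReal_mono hsub (measure_ne_top _ _)).trans ((measureReal_biUnion_finset_le _ _).trans ?_)
  have hb : ∀ p ∈ CS N K L q n s,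
      (ℙ : Measure Ω).real {ω | T + (t * wv K / 2) * p.2 ≤ ip N p.1 (bb N fun z => η z ω)} ≤
      Real.exp (-t * T + t ^ 2 * (n * vv K L) / 2) := by
    intro p hp
    refine (ip_tail hN η hη p.1 _ t ht).trans (Real.exp_le_exp.mpr ?_)
    have := (CS_inv hN hK hKL hq n hn s p hp).2
    nlinarith [mul_le_mul_of_nonneg_left this (sq_nonneg t)]
  refine (Finset.sum_le_sum hb).trans ?_
  rw [Finset.sum_const, nsmul_eq_mul]
  gcongr
  have h1 := CS_card N K L q hK hL n s
  have h2 : (K ^ 16) ^ n ≤ N ^ 16 := by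
    rw [← pow_mul, mul_comm, pow_mul]; gcongr
  exact_mod_cast h1.trans h2

lemma U_all {N K L q : ℕ} (hN : 1 ≤ N) (hK : 16 ≤ K) (hKL : K = L * q) (hq : 2 ≤ q)
    (hL : 2 ^ L ≤ K) (η : Z2 → Ω → ℝ) (hη : IsDGFF (V5N N) η) (n : ℕ) (hn : K ^ n ≤ N)
    (t T : ℝ) (ht : 0 ≤ t) :
    (ℙ : Measure Ω).real {ω | ∃ x ∈ VN N, ∃ y ∈ VN N,
        T < UF N K L q (t * wv K / 2) (bb N fun z => η z ω) n (x, y)} ≤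
      (N : ℝ) ^ 20 * Real.exp (-t * T + t ^ 2 * (n * vv K L) / 2) := by
  have hsub : {ω | ∃ x ∈ VN N, ∃ y ∈ VN N,
        T < UF N K L q (t * wv K / 2) (bb N fun z => η z ω) n (x, y)} ⊆
      ⋃ s ∈ VF N ×ˢ VF N, {ω | T < UF N K L q (t * wv K / 2) (bb N fun z => η z ω) n s} := by
    rintro ω ⟨x, hx, y, hy, h⟩
    simp only [Set.mem_iUnion]
    exact ⟨(x, y), Finset.mem_product.mpr ⟨mem_VF.mpr hx, mem_VF.mpr hy⟩, h⟩
  refine (measureReal_mono hsub (measure_ne_top _ _)).trans ((measureReal_biUnion_finset_le _ _).trans ?_)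
  refine (Finset.sum_le_sum fun s _ => U_tail hN hK hKL hq hL η hη n hn t T ht s).trans ?_
  rw [Finset.sum_const, nsmul_eq_mul, Finset.card_product, VF_card]
  apply le_of_eq; push_cast; ring

lemma A_all {N K : ℕ} (hN : 1 ≤ N) (hK : 16 ≤ K) (η : Z2 → Ω → ℝ) (hη : IsDGFF (V5N N) η)
    (n : ℕ) (Y : ℝ) (hY : (N : ℝ) ≤ Y * (K : ℝ) ^ n) (t T : ℝ) (ht : 0 ≤ t) :
    (ℙ : Measure Ω).real {ω | ∃ x ∈ VN N, T < |AF N K (bb N fun z => η z ω) n x|} ≤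
      2 * (N : ℝ) ^ 2 * Real.exp (-t * T + t ^ 2 * (400 * Y ^ 2) / 2) := by
  have hsub : {ω | ∃ x ∈ VN N, T < |AF N K (bb N fun z => η z ω) n x|} ⊆
      ⋃ s ∈ VF N ×ˢ (Finset.univ : Finset Bool),
        {ω | T ≤ ip N (fun κ => sg s.2 * psi N K n s.1 κ) (bb N fun z => η z ω)} := by
    rintro ω ⟨x, hx, h⟩
    obtain ⟨b, hb⟩ := exists_sg (AF N K (bb N fun z => η z ω) n x)
    simp only [Set.mem_iUnion]
    refine ⟨(x, b), Finset.mem_product.mpr ⟨mem_VF.mpr hx, Finset.mem_univ _⟩, ?_⟩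
    simp only [Set.mem_ofPred_eq]
    rw [← hb] at h
    unfold AF at h
    refine h.le.trans (le_of_eq ?_)
    unfold ip
    rw [Finset.mul_sum]
    exact Finset.sum_congr rfl fun _ _ => by ring
  refine (measureReal_mono hsub (measure_ne_top _ _)).trans ((measureReal_biUnion_finset_le _ _).trans ?_)
  have hb : ∀ s ∈ VF N ×ˢ (Finset.univ : Finset Bool), (ℙ : Measure Ω).real
      {ω | T ≤ ip N (fun κ => sg s.2 * psi N K n s.1 κ) (bb N fun z => η z ω)} ≤
      Real.exp (-t * T + t ^ 2 * (400 * Y ^ 2) / 2) := by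
    intro s _
    refine (ip_tail hN η hη _ T t ht).trans (Real.exp_le_exp.mpr ?_)
    have hKp : (0 : ℝ) < (K : ℝ) ^ n := by positivity
    have hM := Mx_pos hN
    set Z : ℝ := (Mx N : ℝ) / (K : ℝ) ^ n with hZ
    have hZ0 : 0 < Z := by positivity
    have hQ := Q_low N (fun κ => sg s.2 * psi N K n s.1 κ) Z Z hZ0 (by
      intro κ hκ _
      obtain ⟨⟨h1, h2⟩, h3, h4⟩ := mem_modes.mp hκ
      rw [abs_mul, abs_sg, one_mul, mul_div_assoc, mul_div_cancel₀ _ hZ0.ne']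
      refine (abs_psi_le _ _ _ _ _).trans ?_
      have : (1 : ℝ) ≤ κ.1 := by exact_mod_cast h1
      have : (0 : ℝ) ≤ κ.2 := by positivity
      linarith) (by
      intro κ hκ h
      rw [psi_eq_zero (by omega) _ h, mul_zero])
    have hZY : Z ≤ 5 * Y := by
      rw [hZ, div_le_iff₀ hKp, Mx_cast hN]; nlinarith
    have : Z ^ 2 ≤ (5 * Y) ^ 2 := by gcongr
    nlinarith [mul_le_mul_of_nonneg_left (hQ.trans (mul_le_mul_of_nonneg_left this (by norm_num : (0:ℝ) ≤ 16))) (sq_nonneg t)]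
  refine (Finset.sum_le_sum hb).trans ?_
  rw [Finset.sum_const, nsmul_eq_mul, Finset.card_product, VF_card]
  apply le_of_eq; simp; ring

end

/-- `f` is a simple nearest neighbour path of length `T` with vertices in `S`. -/
def SPath (S : Finset Z2) (x y : Z2) (T : ℕ) (f : ℕ → Z2) : Prop :=
  f 0 = x ∧ f T = y ∧ (∀ i < T, Adj (f i) (f (i + 1))) ∧ (∀ i ≤ T, f i ∈ S) ∧
    ∀ i ≤ T, ∀ j ≤ T, f i = f j → i = j

lemma Adj_norm {x y : Z2} (h : Adj x y) : ‖toC y - toC x‖ ≤ 1 := by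
  rw [← eZ_eq, eZ]
  apply Real.sqrt_le_one.mpr
  unfold Adj at h
  have : (y.1 - x.1) ^ 2 + (y.2 - x.2) ^ 2 ≤ 1 := by
    have h1 := abs_nonneg (x.1 - y.1)
    have h2 := abs_nonneg (x.2 - y.2)
    have e1 : (y.1 - x.1) ^ 2 = |x.1 - y.1| ^ 2 := by rw [sq_abs]; ring
    have e2 : (y.2 - x.2) ^ 2 = |x.2 - y.2| ^ 2 := by rw [sq_abs]; ring
    rw [e1, e2]; nlinarith
  exact_mod_cast this

lemma SPath_card {S : Finset Z2} {x y : Z2} {T : ℕ} {f : ℕ → Z2} (h : SPath S x y T f) :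
    T + 1 ≤ S.card := by
  classical
  obtain ⟨_, _, _, h4, h5⟩ := h
  have : (Finset.range (T + 1)).card ≤ S.card := by
    apply Finset.card_le_card_of_injOn f
    · intro i hi
      exact h4 i (by simpa [Nat.lt_succ_iff] using hi)
    · intro i hi j hj hij
      exact h5 i (by simpa [Nat.lt_succ_iff] using hi) j (by simpa [Nat.lt_succ_iff] using hj) hij
  simpa using this

lemma exists_SPath (P : List Z2) : P.IsChain Adj → ∀ x y, P.head? = some x → P.getLast? = some y →
    ∃ T f, SPath P.toFinset x y T f := by
  classical
  induction P with
  | nil => intro _ x y h; simp at h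
  | cons a P ih =>
    intro hc x y hx hy
    simp only [List.head?_cons, Option.some.injEq] at hx
    subst hx
    cases P with
    | nil =>
      simp only [List.getLast?_singleton, Option.some.injEq] at hy
      subst hy
      exact ⟨0, fun _ => a, rfl, rfl, by simp, by simp, by intro i hi j hj _; omega⟩
    | cons b P =>
      rw [List.isChain_cons_cons] at hc
      rw [List.getLast?_cons_cons] at hy
      obtain ⟨T, f, h1, h2, h3, h4, h5⟩ := ih hc.2 b y (by simp) hy
      by_cases ha : ∃ i ≤ T, f i = a
      · obtain ⟨i, hi, hia⟩ := ha
        refine ⟨T - i, fun j => f (j + i), by simpa using hia, by simp [Nat.sub_add_cancel hi, h2], ?_, ?_, ?_⟩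
        · intro j hj
          have := h3 (j + i) (by omega)
          rwa [show j + i + 1 = j + 1 + i by ring] at this
        · intro j hj
          rw [List.toFinset_cons]
          exact Finset.mem_insert_of_mem (h4 _ (by omega))
        · intro j hj k hk h
          have := h5 _ (by omega) _ (by omega) h
          omega
      · push Not at ha
        refine ⟨T + 1, fun j => if j = 0 then a else f (j - 1), by simp, by simp [h2], ?_, ?_, ?_⟩
        · intro j hj
          rcases j with _ | j
          · simp [h1, hc.1]
          · simpa using h3 j (by omega)
        · intro j hj
          rw [List.toFinset_cons]
          rcases j with _ | j
          · simp
          · exact Finset.mem_insert_of_mem (by simpa using h4 j (by omega))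
        · intro j hj k hk h
          rcases j with _ | j <;> rcases k with _ | k
          · rfl
          · simp at h; exact absurd h.symm (ha k (by omega))
          · simp at h; exact absurd h (ha j (by omega))
          · simp at h; rw [h5 j (by omega) k (by omega) h]

end HV

open MeasureTheory ProbabilityTheory Real Set Filter

namespace HV

lemma top {N K L q : ℕ} (hN : 1 ≤ N) (hK : 16 ≤ K) (hKL : K = L * q) (pen : ℝ) (hpen : 0 ≤ pen)
    (h : Z2 → ℝ) (n : ℕ) (κ T0 E W : ℝ) (hκ : 0 < κ) (hE : 0 < E) (hT0 : 0 ≤ T0) (hW : 0 < W)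
    (hn : RR K n + 1 ≤ κ * N / 10)
    (hU : ∀ x ∈ VN N, ∀ y ∈ VN N, UF N K L q pen (bb N h) n (x, y) ≤ T0)
    (hA : ∀ x ∈ VN N, |AF N K (bb N h) n x| ≤ T0)
    (hlog : 2 * T0 + pen + 4 * K ^ 2 * pen * Real.log (W / (3 / 10 * κ * N)) ≤ E / 2)
    (S : Finset Z2) (hS : ∀ z ∈ S, z ∈ VN N) (x y : Z2) (T : ℕ) (f : ℕ → Z2)
    (hP : SPath S x y T f) (hxy : κ * N ≤ eZ x y) (hTW : (T : ℝ) ≤ W) :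
    ∃ Z ⊆ S, (∀ z ∈ Z, -E ≤ h z) ∧ κ * N / 8 ≤ Z.card := by
  classical
  obtain ⟨hP1, hP2, hP3, hP4, hP5⟩ := hP
  have hKr : (16 : ℝ) ≤ K := by exact_mod_cast hK
  have hN1 : (1 : ℝ) ≤ N := by exact_mod_cast hN
  have hf : ∀ i ≤ T, f i ∈ VN N := fun i hi => hS _ (hP4 i hi)
  have hg : ∀ i < T, ‖toC (f (i + 1)) - toC (f i)‖ ≤ 1 := fun i hi => Adj_norm (hP3 i hi)
  have hR1 := RR_one_le K (by omega) n
  have hR2 := RR_le K (by omega) n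
  have hKn : (0 : ℝ) < (K : ℝ) ^ n := by positivity
  have hκN : 0 < κ * N := by positivity
  set M0 : ℕ := ⌊κ * N / (RR K n + 1)⌋₊ with hM0
  have hRp : 0 < RR K n + 1 := by linarith
  have hM1 : (M0 : ℝ) * (RR K n + 1) ≤ κ * N := by
    rw [← le_div_iff₀ hRp]; exact Nat.floor_le (by positivity)
  have hM2 : κ * N < ((M0 : ℝ) + 1) * (RR K n + 1) := by
    rw [← div_lt_iff₀ hRp]; exact Nat.lt_floor_add_one _
  have hM3 : 9 / 10 * (κ * N) ≤ (M0 : ℝ) * (RR K n + 1) := by nlinarith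
  have hM4 : 3 / 10 * κ * N ≤ (M0 : ℝ) * (K : ℝ) ^ n := by
    have : (M0 : ℝ) * (RR K n + 1) ≤ M0 * (3 * (K : ℝ) ^ n) := by gcongr; linarith
    linarith
  have hM0p : (0 : ℝ) < M0 := by
    by_contra hc
    have : (M0 : ℝ) * (K : ℝ) ^ n ≤ 0 := mul_nonpos_of_nonpos_of_nonneg (not_lt.mp hc) hKn.le
    have : 0 < 3 / 10 * κ * N := by positivity
    linarith
  obtain ⟨τ, h0, hτ, hτb⟩ := exists_nodes (fun i => toC (f i)) (r := RR K n) (by linarith) 0 T M0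
    (Nat.zero_le _) hg (by
      rw [hP1, hP2, norm_sub_rev, ← eZ_eq]; linarith)
  have hmono := tau_mono hτ
  have hle : ∀ i ≤ M0, τ i ≤ T := fun i hi => (hmono i M0 hi le_rfl).trans hτb
  have hcl := claim K L q N (AF N K (bb N h)) (UF N K L q pen (bb N h)) pen (by omega) hKL hpen
    (fun s => UF_zero pen _ s) (hbad_UF hK pen _) (hgood_UF hK hKL pen _) f T hf hg n
  have hcp : (0 : ℝ) ≤ 4 * K ^ 2 * pen := by positivity
  obtain ⟨Z, hZ1, hZ2, hZ3⟩ := combine (fun z => AF N K (bb N h) 0 (f z)) τ M0 0 T (K ^ n)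
    (Finset.range M0) (Finset.Subset.refl _) (by positivity) (fun i hi => (hτ i hi).1) h0 hτb
    (fun i => AF N K (bb N h) n (rd K n (f (τ i))))
    (fun i => UF N K L q pen (bb N h) n (rd K n (f (τ i)), rd K n (f (τ (i + 1)))) +
      if n = 0 then 0 else pen)
    0 (2 * T0 + pen) (4 * K ^ 2 * pen) (W / M0) hcp (by positivity)
    (by
      intro i hi
      have hi := Finset.mem_range.mp hi
      exact hcl _ _ (hle _ (by omega)) (hτ i hi))
    (by
      rw [← nsmul_eq_mul]
      apply Finset.sum_le_card_nsmul
      intro i hi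
      have hi := Finset.mem_range.mp hi
      have m1 := hf _ (hle i (by omega))
      have m2 := hf _ (hle (i + 1) (by omega))
      have a1 := hA _ (rd_mem (K := K) (j := n) (by omega) m1)
      have a2 := hU _ (rd_mem (K := K) (j := n) (by omega) m1) _ (rd_mem (K := K) (j := n) (by omega) m2)
      rw [sub_zero]
      have : (if n = 0 then 0 else pen) ≤ pen := by split_ifs <;> linarith
      linarith)
    (by
      rw [Finset.sum_range_sub (fun i => (τ i : ℝ)), h0, Finset.card_range, mul_div_cancel₀ _ hM0p.ne']
      have : (τ M0 : ℝ) ≤ T := by exact_mod_cast hτb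
      push_cast; linarith)
  rw [Finset.card_range] at hZ2 hZ3
  simp only [sub_zero] at hZ3
  have hZT : ∀ z ∈ Z, z ≤ T := fun z hz => (Finset.mem_Ico.mp (hZ1 hz)).2.le
  have hval : ∀ z ∈ Z, AF N K (bb N h) 0 (f z) = h (f z) := by
    intro z hz
    obtain ⟨a, ha, hfa⟩ := VN_pt (hf z (hZT z hz))
    rw [hfa]; exact AF_bb N K h a ha
  have hZ3' : ∑ z ∈ Z, |h (f z)| ≤ (M0 * K ^ n : ℕ) * (E / 2) := by
    rw [Finset.sum_congr rfl fun z hz => by rw [← hval z hz]]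
    refine hZ3.trans ?_
    gcongr
    refine le_trans ?_ hlog
    have : W / M0 / (K ^ n : ℕ) ≤ W / (3 / 10 * κ * N) := by
      rw [div_div]; push_cast
      gcongr
    gcongr
  set G := Z.filter fun z => -E ≤ h (f z) with hG
  set B := Z.filter fun z => ¬ -E ≤ h (f z) with hB
  have hGB : G.card + B.card = Z.card := Finset.card_filter_add_card_filter_not _
  have hBs : (B.card : ℝ) * E ≤ ∑ z ∈ Z, |h (f z)| := by
    calc (B.card : ℝ) * E = ∑ z ∈ B, E := by rw [Finset.sum_const, nsmul_eq_mul]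
      _ ≤ ∑ z ∈ B, |h (f z)| := by
        apply Finset.sum_le_sum
        intro z hz
        have := (Finset.mem_filter.mp hz).2
        push Not at this
        have h2 := neg_le_abs (h (f z))
        linarith
      _ ≤ _ := Finset.sum_le_sum_of_subset_of_nonneg (Finset.filter_subset _ _) fun _ _ _ => abs_nonneg _
  have hBc : (B.card : ℝ) ≤ (M0 * K ^ n : ℕ) / 2 := by
    have := hBs.trans hZ3'
    have : ((B.card : ℝ)) * E ≤ ((M0 * K ^ n : ℕ) / 2) * E := by linarith
    exact le_of_mul_le_mul_right this hE
  have hGc : (G.card : ℝ) + B.card = (M0 * K ^ n : ℕ) := by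
    rw [← hZ2, ← hGB]; push_cast; ring
  refine ⟨G.image f, ?_, ?_, ?_⟩
  · intro z hz
    obtain ⟨i, hi, rfl⟩ := Finset.mem_image.mp hz
    exact hP4 i (hZT i (Finset.mem_filter.mp hi).1)
  · intro z hz
    obtain ⟨i, hi, rfl⟩ := Finset.mem_image.mp hz
    exact (Finset.mem_filter.mp hi).2
  · rw [Finset.card_image_of_injOn]
    · push_cast at hGc hBc
      nlinarith
    · intro i hi j hj hij
      exact hP5 i (hZT i (Finset.mem_filter.mp hi).1) j (hZT j (Finset.mem_filter.mp hj).1) hij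

lemma exists_level (K : ℕ) (hK : 16 ≤ K) (κ : ℝ) (hκ : 0 < κ) (hκ1 : κ < 1) (N : ℕ) (hN : 20 ≤ κ * N) :
    ∃ n, RR K n + 1 ≤ κ * N / 10 ∧ K ^ n ≤ N ∧ (N : ℝ) ≤ 30 * K / κ * (K : ℝ) ^ n := by
  classical
  have hKr : (16 : ℝ) ≤ K := by exact_mod_cast hK
  have hlt : ∀ n, RR K n + 1 ≤ κ * N / 10 → K ^ n ≤ N := by
    intro n hn
    have h1 := RR_ge K (by omega) n
    have h2 : (0 : ℝ) ≤ N := by positivity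
    have : (K : ℝ) ^ n ≤ N := by nlinarith
    exact_mod_cast this
  have h0 : RR K 0 + 1 ≤ κ * N / 10 := by simp only [RR]; linarith
  have hspec := Nat.findGreatest_spec (P := fun n => RR K n + 1 ≤ κ * N / 10) (Nat.zero_le N) h0
  set n := Nat.findGreatest (fun n => RR K n + 1 ≤ κ * N / 10) N with hn
  refine ⟨n, hspec, hlt n hspec, ?_⟩
  have h3 : ¬ RR K (n + 1) + 1 ≤ κ * N / 10 := by
    intro hc
    have h4 : n + 1 ≤ N := ((Nat.lt_pow_self (by omega : 1 < K)).trans_le (hlt _ hc)).le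
    have := Nat.le_findGreatest (P := fun n => RR K n + 1 ≤ κ * N / 10) h4 hc
    omega
  push Not at h3
  have h5 := RR_le K (by omega) (n + 1)
  rw [pow_succ] at h5
  rw [div_mul_eq_mul_div, le_div_iff₀ hκ]
  nlinarith

lemma exists_params (t : ℝ) : ∃ K L q : ℕ, 16 ≤ K ∧ K = L * q ∧ 2 ≤ q ∧ 2 ^ L ≤ K ∧
    t ^ 2 * vv K L ≤ 2 * Real.log K := by
  have ht1 : Tendsto (fun l : ℕ => t ^ 2 * (647800 * ((l : ℝ) ^ 0 / 2 ^ l) + 16 * ((l : ℝ) ^ 1 / 2 ^ l))) atTop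
      (nhds (t ^ 2 * (647800 * 0 + 16 * 0))) :=
    (((tendsto_pow_const_div_const_pow_of_one_lt 0 one_lt_two).const_mul _).add
      ((tendsto_pow_const_div_const_pow_of_one_lt 1 one_lt_two).const_mul _)).const_mul _
  have h1 := ht1.eventually (gt_mem_nhds (by norm_num : t ^ 2 * (647800 * 0 + 16 * 0) < 1))
  obtain ⟨l, hl1, hl2⟩ := (h1.and (eventually_ge_atTop 2)).exists
  have hlL : l < 2 ^ l := Nat.lt_two_pow_self
  have h4 : 4 ≤ 2 ^ l := by
    calc 4 = 2 ^ 2 := by norm_num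
      _ ≤ 2 ^ l := Nat.pow_le_pow_right (by norm_num) hl2
  refine ⟨2 ^ (2 ^ l), 2 ^ l, 2 ^ (2 ^ l - l), ?_, ?_, ?_, le_rfl, ?_⟩
  · calc 16 = 2 ^ 4 := by norm_num
      _ ≤ _ := Nat.pow_le_pow_right (by norm_num) h4
  · rw [← pow_add]; congr 1; omega
  · calc 2 = 2 ^ 1 := by norm_num
      _ ≤ _ := Nat.pow_le_pow_right (by norm_num) (by omega)
  · unfold vv
    push_cast
    rw [Real.log_pow, Real.log_pow]
    push_cast
    have l1 : (1 / 2 : ℝ) ≤ Real.log 2 := by linarith [Real.log_two_gt_d9]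
    have l2 : Real.log 2 ≤ 1 := by linarith [Real.log_two_lt_d9]
    have hp : (4 : ℝ) ≤ 2 ^ l := by exact_mod_cast h4
    set p : ℝ := 2 ^ l with hpdef
    have hlpos : (0 : ℝ) ≤ l := by positivity
    have e1 : 16 / p * (1 + p * Real.log 2) ≤ 20 := by
      rw [div_mul_eq_mul_div, div_le_iff₀ (by linarith)]; nlinarith
    have e2 : t ^ 2 * (647800 + 16 * l) ≤ p := by
      have : t ^ 2 * (647800 * ((l : ℝ) ^ 0 / p) + 16 * ((l : ℝ) ^ 1 / p)) = t ^ 2 * (647800 + 16 * l) / p := by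
        field_simp
      rw [this, div_lt_one (by linarith)] at hl1
      exact hl1.le
    calc _ ≤ t ^ 2 * (647800 + 16 * l) := by
          have e3 : 647760 + 16 * (l * Real.log 2) + 16 / p * (1 + p * Real.log 2) ≤ 647800 + 16 * l := by
            nlinarith
          exact mul_le_mul_of_nonneg_left e3 (sq_nonneg t)
      _ ≤ p := e2
      _ ≤ _ := by nlinarith

end HV

open MeasureTheory ProbabilityTheory Real Set Filter

namespace HV

/-- the good event -/
def Ev {Ω : Type} (η : Z2 → Ω → ℝ) (δ α κ : ℝ) (N : ℕ) : Set Ω := {ω : Ω |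
  ∀ P : List Z2, LPathIn (VN N) P →
    ∀ x y : Z2, P.head? = some x → P.getLast? = some y →
      κ * N ≤ eZ x y → (P.toFinset.card : ℝ) ≤ (N : ℝ) ^ ((1 : ℝ) + α) →
      κ * N / 8 ≤
        (Nat.card {z : Z2 | z ∈ P ∧
          -(15 * Real.sqrt δ * Real.log N) ≤ η z ω} : ℝ)}

lemma Ev_prob {Ω : Type} [MeasureSpace Ω] [IsProbabilityMeasure (ℙ : Measure Ω)]
    (η : Z2 → Ω → ℝ) {N K L q : ℕ} (hη : IsDGFF (V5N N) η) (hN : 2 ≤ N)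
    (hK : 16 ≤ K) (hKL : K = L * q) (hq : 2 ≤ q) (hL : 2 ^ L ≤ K) (δ α κ ε t pen : ℝ)
    (hε : ε = 15 * Real.sqrt δ) (hε0 : 0 < ε) (ht : t = 176 / ε) (hpen : pen = t * wv K / 2)
    (hpen0 : 0 ≤ pen)
    (hv : t ^ 2 * vv K L ≤ 2 * Real.log K)
    (hα : 4 * K ^ 2 * pen * α = ε / 8)
    (hκ : 0 < κ) (hκ1 : κ < 1) (hκN : 20 ≤ κ * N)
    (hbig : pen + 4 * K ^ 2 * pen * Real.log (10 / (3 * κ)) ≤ ε / 8 * Real.log N) :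
    1 - (1 + 2 * Real.exp (t ^ 2 * (400 * (30 * K / κ) ^ 2) / 2)) / N ≤
      (ℙ : Measure Ω).real (Ev η δ α κ N) := by
  have hKr : (16 : ℝ) ≤ K := by exact_mod_cast hK
  have hNr : (2 : ℝ) ≤ N := by exact_mod_cast hN
  have hlN : 0 < Real.log N := Real.log_pos (by linarith)
  have ht0 : 0 ≤ t := by rw [ht]; positivity
  obtain ⟨n, hn1, hn2, hn3⟩ := exists_level K hK κ hκ hκ1 N hκN
  set T0 := ε / 8 * Real.log N with hT0
  have htT : t * T0 = 22 * Real.log N := by rw [ht, hT0]; field_simp; norm_num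
  have b1 := U_all (by omega) hK hKL hq hL η hη n hn2 t T0 ht0
  have b2 := A_all (by omega) hK η hη n _ hn3 t T0 ht0
  rw [← hpen] at b1
  set B1 := {ω | ∃ x ∈ VN N, ∃ y ∈ VN N, T0 < UF N K L q pen (bb N fun z => η z ω) n (x, y)} with hB1
  set B2 := {ω | ∃ x ∈ VN N, T0 < |AF N K (bb N fun z => η z ω) n x|} with hB2
  have hcover : (univ : Set Ω) ⊆ Ev η δ α κ N ∪ (B1 ∪ B2) := by
    intro ω _
    by_cases hb : ω ∈ B1 ∪ B2
    · exact Or.inr hb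
    left
    have hb1 : ω ∉ B1 := fun h => hb (Or.inl h)
    have hb2 : ω ∉ B2 := fun h => hb (Or.inr h)
    simp only [hB1, Set.mem_ofPred_eq, not_exists, not_and, not_lt] at hb1
    simp only [hB2, Set.mem_ofPred_eq, not_exists, not_and, not_lt] at hb2
    intro P hP x y hx hy hxy hcard
    obtain ⟨T, f, hf⟩ := exists_SPath P hP.2.1 x y hx hy
    have hT : (T : ℝ) ≤ (N : ℝ) ^ ((1 : ℝ) + α) := by
      have h1 := SPath_card hf
      have h2 : (T : ℝ) ≤ P.toFinset.card := by exact_mod_cast (by omega : T ≤ P.toFinset.card)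
      linarith
    have hlog : Real.log ((N : ℝ) ^ ((1 : ℝ) + α) / (3 / 10 * κ * N)) =
        α * Real.log N + Real.log (10 / (3 * κ)) := by
      have e : (N : ℝ) ^ ((1 : ℝ) + α) / (3 / 10 * κ * N) = (N : ℝ) ^ α * (10 / (3 * κ)) := by
        rw [Real.rpow_add (by linarith), Real.rpow_one]
        field_simp
      rw [e, Real.log_mul (by positivity) (by positivity), Real.log_rpow (by linarith)]
    obtain ⟨Z, hZ1, hZ2, hZ3⟩ := top (by omega) hK hKL pen hpen0 (fun z => η z ω) n κ T0
      (ε * Real.log N) ((N : ℝ) ^ ((1 : ℝ) + α)) hκ (by positivity) (by positivity) (by positivity)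
      hn1 hb1 hb2 (by
        have hα2 : 4 * (K : ℝ) ^ 2 * pen * (α * Real.log N) = T0 := by
          rw [hT0, ← hα]; ring
        have hT2 : ε * Real.log N / 2 = 4 * T0 := by rw [hT0]; ring
        rw [hlog, mul_add, hα2, hT2]
        linarith) P.toFinset (fun z hz => hP.2.2 z (List.mem_toFinset.mp hz)) x y T f hf hxy hT
    refine hZ3.trans ?_
    rw [hε] at hZ2
    have hfin : {z : Z2 | z ∈ P ∧ -(15 * Real.sqrt δ * Real.log N) ≤ η z ω}.Finite :=
      P.toFinset.finite_toSet.subset fun z hz => by simpa using hz.1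
    have hsub : (Z : Set Z2) ⊆ {z : Z2 | z ∈ P ∧ -(15 * Real.sqrt δ * Real.log N) ≤ η z ω} :=
      fun z hz => ⟨List.mem_toFinset.mp (hZ1 hz), hZ2 z hz⟩
    have := Set.ncard_le_ncard hsub hfin
    rw [Set.ncard_coe_finset] at this
    rw [Nat.card_coe_set_eq]
    exact_mod_cast this
  have h1 : 1 ≤ (ℙ : Measure Ω).real (Ev η δ α κ N) +
      ((ℙ : Measure Ω).real B1 + (ℙ : Measure Ω).real B2) := by
    have e : (ℙ : Measure Ω).real univ = 1 := by simp
    rw [← e]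
    refine (measureReal_mono hcover (measure_ne_top _ _)).trans ((measureReal_union_le _ _).trans ?_)
    gcongr
    exact measureReal_union_le _ _
  have hexp : ∀ m : ℕ, Real.exp (-(m * Real.log N)) = ((N : ℝ) ^ m)⁻¹ := by
    intro m
    rw [Real.exp_neg, ← Real.log_pow, Real.exp_log (by positivity)]
  have hnv : t ^ 2 * (n * vv K L) / 2 ≤ Real.log N := by
    have h2 : n * Real.log K ≤ Real.log N := by
      rw [← Real.log_pow]
      apply Real.log_le_log (by positivity)
      exact_mod_cast hn2
    have h3 : (n : ℝ) * (t ^ 2 * vv K L) ≤ n * (2 * Real.log K) := by gcongr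
    linarith
  have c1 : (ℙ : Measure Ω).real B1 ≤ 1 / N := by
    refine b1.trans ?_
    calc (N : ℝ) ^ 20 * Real.exp (-t * T0 + t ^ 2 * (n * vv K L) / 2)
        ≤ (N : ℝ) ^ 20 * Real.exp (-((21 : ℕ) * Real.log N)) := by
          gcongr
          push_cast
          linarith
      _ = 1 / (N : ℝ) := by rw [hexp]; field_simp
  have c2 : (ℙ : Measure Ω).real B2 ≤ 2 * Real.exp (t ^ 2 * (400 * (30 * K / κ) ^ 2) / 2) / N := by
    refine b2.trans ?_
    rw [Real.exp_add]
    have : -t * T0 = -((22 : ℕ) * Real.log N) := by push_cast; linarith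
    rw [this, hexp]
    have h5 : (N : ℝ) ^ 2 * ((N : ℝ) ^ 22)⁻¹ ≤ 1 / N := by
      rw [← div_eq_mul_inv, div_le_div_iff₀ (by positivity) (by positivity)]
      have : (N : ℝ) ^ 3 ≤ (N : ℝ) ^ 22 := pow_le_pow_right₀ (by linarith) (by norm_num)
      linarith
    calc _ = 2 * Real.exp (t ^ 2 * (400 * (30 * K / κ) ^ 2) / 2) * ((N : ℝ) ^ 2 * ((N : ℝ) ^ 22)⁻¹) := by ring
      _ ≤ 2 * Real.exp (t ^ 2 * (400 * (30 * K / κ) ^ 2) / 2) * (1 / N) := by gcongr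
      _ = _ := by ring
  rw [add_div]
  linarith

lemma wv_pos (K : ℕ) (hK : 16 ≤ K) : 0 < wv K := by
  unfold wv
  have : 0 ≤ Real.log K := Real.log_nonneg (by exact_mod_cast (by omega : 1 ≤ K))
  linarith

end HV


open MeasureTheory ProbabilityTheory Real Set Filter

theorem many_points_with_high_values :
    ∀ δ : ℝ, 0 < δ → δ < 1 →
      ∃ α : ℝ, 0 < α ∧ ∀ κ : ℝ, 0 < κ → κ < 1 →
        ∀ (Ω : Type) (_ : MeasureSpace Ω), IsProbabilityMeasure (ℙ : Measure Ω) →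
          ∀ η : ℕ → Z2 → Ω → ℝ, (∀ N, IsDGFF (V5N N) (η N)) →
            Tendsto
              (fun N : ℕ => ℙ {ω : Ω |
                ∀ P : List Z2, LPathIn (VN N) P →
                  ∀ x y : Z2, P.head? = some x → P.getLast? = some y →
                    κ * N ≤ eZ x y → (P.toFinset.card : ℝ) ≤ (N : ℝ) ^ ((1 : ℝ) + α) →
                    κ * N / 8 ≤
                      (Nat.card {z : Z2 | z ∈ P ∧
                        -(15 * Real.sqrt δ * Real.log N) ≤ η N z ω} : ℝ)})
              atTop (nhds 1) := by
  intro δ hδ hδ1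
  have hε0 : 0 < 15 * Real.sqrt δ := by positivity
  obtain ⟨K, L, q, hK, hKL, hq, hL, hv⟩ := HV.exists_params (176 / (15 * Real.sqrt δ))
  have hKr : (16 : ℝ) ≤ K := by exact_mod_cast hK
  have hw := HV.wv_pos K hK
  obtain ⟨ε, hε⟩ : ∃ ε, ε = 15 * Real.sqrt δ := ⟨_, rfl⟩
  rw [← hε] at hε0 hv
  obtain ⟨pen, hpen⟩ : ∃ pen, pen = 176 / ε * HV.wv K / 2 := ⟨_, rfl⟩
  have hpen0 : 0 < pen := by rw [hpen]; positivity
  refine ⟨ε / (8 * (4 * K ^ 2 * pen)), by positivity, ?_⟩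
  intro κ hκ hκ1 Ω _ _ η hη
  have hα : 4 * K ^ 2 * pen * (ε / (8 * (4 * K ^ 2 * pen))) = ε / 8 := by
    field_simp
  have key : Tendsto (fun N : ℕ => (ℙ : Measure Ω).real
      (HV.Ev (η N) δ (ε / (8 * (4 * K ^ 2 * pen))) κ N)) atTop (nhds 1) := by
    have hlow : Tendsto (fun N : ℕ => 1 - (1 + 2 * Real.exp ((176 / ε) ^ 2 * (400 * (30 * K / κ) ^ 2) / 2)) / (N : ℝ))
        atTop (nhds (1 - 0)) :=
      (tendsto_const_div_atTop_nhds_zero_nat _).const_sub 1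
    rw [sub_zero] at hlow
    refine tendsto_of_tendsto_of_tendsto_of_le_of_le' hlow tendsto_const_nhds ?_ ?_
    · have e1 : Tendsto (fun N : ℕ => κ * (N : ℝ)) atTop atTop :=
        tendsto_natCast_atTop_atTop.const_mul_atTop hκ
      have e2 : Tendsto (fun N : ℕ => ε / 8 * Real.log (N : ℝ)) atTop atTop :=
        (Real.tendsto_log_atTop.comp tendsto_natCast_atTop_atTop).const_mul_atTop (by positivity)
      filter_upwards [e1.eventually_ge_atTop 20,
        e2.eventually_ge_atTop (pen + 4 * K ^ 2 * pen * Real.log (10 / (3 * κ))),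
        eventually_ge_atTop 2] with N h1 h2 h3
      exact HV.Ev_prob (η N) (hη N) h3 hK hKL hq hL δ _ κ ε _ pen hε hε0 rfl hpen hpen0.le hv hα
        hκ hκ1 h1 h2
    · exact Filter.Eventually.of_forall fun N => measureReal_le_one
  have := (ENNReal.tendsto_toReal_iff (fun N => measure_ne_top (ℙ : Measure Ω)
      (HV.Ev (η N) δ (ε / (8 * (4 * K ^ 2 * pen))) κ N)) ENNReal.one_ne_top).mp
      (by simpa [Measure.real] using key)
  exact this
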